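/- arXiv:2301.07872 — 2 statements merged into one kernel-verified Lean document; each statement's English description precedes it below -/
import Mathlib

section
/- For every positive integer n there exists a constant C_n depending only on n with the following property: for all positive weights a_0,…,a_{n+1} with ℙ(a_0,…,a_{n+1}) well-formed and every nonzero weighted-homogeneous quasismooth f ∈ S of degree d such that the linear automorphism group Lin(X) = G_f/Δ is finite, one has |Lin(X)| ≤ C_n · d^{n+1}/(a_0·a_1⋯a_{n+1}). -/
open MvPolynomial

noncomputable section

/-- The predicate that an algebra automorphism of `ℂ[x_0,…,x_{n+1}]` is graded with
respect to the weights `a`, i.e. preserves all weighted-homogeneous pieces. -/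
def IsGradedAut {n : ℕ} (a : Fin (n + 2) → ℕ)
    (φ : MvPolynomial (Fin (n + 2)) ℂ ≃ₐ[ℂ] MvPolynomial (Fin (n + 2)) ℂ) : Prop :=
  ∀ (d : ℕ) (f : MvPolynomial (Fin (n + 2)) ℂ),
    f.IsWeightedHomogeneous a d ↔ (φ f).IsWeightedHomogeneous a d

lemma IsGradedAut.one {n : ℕ} (a : Fin (n + 2) → ℕ) : IsGradedAut a 1 := by
  intro d f
  rfl

lemma IsGradedAut.mul {n : ℕ} {a : Fin (n + 2) → ℕ}
    {φ ψ : MvPolynomial (Fin (n + 2)) ℂ ≃ₐ[ℂ] MvPolynomial (Fin (n + 2)) ℂ}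
    (hφ : IsGradedAut a φ) (hψ : IsGradedAut a ψ) : IsGradedAut a (φ * ψ) := by
  intro d f
  rw [AlgEquiv.mul_apply]
  exact (hψ d f).trans (hφ d (ψ f))

lemma IsGradedAut.inv {n : ℕ} {a : Fin (n + 2) → ℕ}
    {φ : MvPolynomial (Fin (n + 2)) ℂ ≃ₐ[ℂ] MvPolynomial (Fin (n + 2)) ℂ}
    (hφ : IsGradedAut a φ) : IsGradedAut a φ⁻¹ := by
  intro d f
  have h := hφ d (φ⁻¹ f)
  rw [show φ (φ⁻¹ f) = f from φ.apply_symm_apply f] at h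
  exact h.symm

/-- The group of graded automorphisms `Aut(S)`. -/
def gradedAut {n : ℕ} (a : Fin (n + 2) → ℕ) :
    Subgroup (MvPolynomial (Fin (n + 2)) ℂ ≃ₐ[ℂ] MvPolynomial (Fin (n + 2)) ℂ) where
  carrier := {φ | IsGradedAut a φ}
  one_mem' := IsGradedAut.one a
  mul_mem' hφ hψ := hφ.mul hψ
  inv_mem' hφ := hφ.inv

/-- The group `G_f` of graded automorphisms mapping `f` to a nonzero scalar multiple of itself. -/
def linGroup {n : ℕ} (a : Fin (n + 2) → ℕ) (f : MvPolynomial (Fin (n + 2)) ℂ) :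
    Subgroup (MvPolynomial (Fin (n + 2)) ℂ ≃ₐ[ℂ] MvPolynomial (Fin (n + 2)) ℂ) where
  carrier := {φ | IsGradedAut a φ ∧ ∃ c : ℂˣ, φ f = (c : ℂ) • f}
  one_mem' := ⟨IsGradedAut.one a, 1, by simp⟩
  mul_mem' := by
    rintro φ ψ ⟨hφ, c₁, hc₁⟩ ⟨hψ, c₂, hc₂⟩
    refine ⟨hφ.mul hψ, c₁ * c₂, ?_⟩
    rw [AlgEquiv.mul_apply, hc₂, map_smul, hc₁, smul_smul, Units.val_mul, mul_comm]
  inv_mem' := by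
    rintro φ ⟨hφ, c, hc⟩
    refine ⟨hφ.inv, c⁻¹, ?_⟩
    rw [show φ⁻¹ f = φ.symm f from rfl, AlgEquiv.symm_apply_eq, map_smul, hc, smul_smul]
    simp

/-- The subgroup `Δ` of diagonal scalar automorphisms `x_i ↦ t^{a_i} x_i`. -/
def diagSubgroup {n : ℕ} (a : Fin (n + 2) → ℕ) :
    Subgroup (MvPolynomial (Fin (n + 2)) ℂ ≃ₐ[ℂ] MvPolynomial (Fin (n + 2)) ℂ) where
  carrier := {φ | ∃ t : ℂˣ, ∀ i, φ (X i) = ((t : ℂ) ^ (a i)) • X i}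
  one_mem' := ⟨1, fun i => by simp⟩
  mul_mem' := by
    rintro φ ψ ⟨t, ht⟩ ⟨s, hs⟩
    refine ⟨t * s, fun i => ?_⟩
    rw [AlgEquiv.mul_apply, hs i, map_smul, ht i, smul_smul, Units.val_mul, mul_pow, mul_comm]
  inv_mem' := by
    rintro φ ⟨t, ht⟩
    refine ⟨t⁻¹, fun i => ?_⟩
    have key : φ (((t⁻¹ : ℂˣ) : ℂ) ^ (a i) • X i) = X i := by
      rw [map_smul, ht i, smul_smul, ← mul_pow]
      norm_num
    rw [show φ⁻¹ (X i) = φ.symm (X i) from rfl, AlgEquiv.symm_apply_eq]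
    exact key.symm

/-- Quasismoothness of the hypersurface `{f = 0}`: the punctured affine cone is smooth, i.e.
at every nonzero point of the affine cone some partial derivative of `f` is nonzero. -/
def Quasismooth {n : ℕ} (f : MvPolynomial (Fin (n + 2)) ℂ) : Prop :=
  ∀ x : Fin (n + 2) → ℂ, x ≠ 0 → eval x f = 0 → ∃ i, eval x (pderiv i f) ≠ 0

/-- Well-formedness of the weighted projective space `ℙ(a_0,…,a_{n+1})`: omitting any one
weight, the remaining weights have gcd `1`. -/
def WellFormed {n : ℕ} (a : Fin (n + 2) → ℕ) : Prop :=
  ∀ i : Fin (n + 2), (Finset.univ.erase i).gcd a = 1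


/-- isotypic projector -/
def eigProj {H : Type} [CommGroup H] [Fintype H] {V : Type*} [AddCommGroup V] [Module ℂ V]
    (ρ : H →* Module.End ℂ V) (χ : H →* ℂˣ) (v : V) : V :=
  (Fintype.card H : ℂ)⁻¹ • ∑ h : H, ((χ h⁻¹ : ℂˣ) : ℂ) • ρ h v

lemma eigProj_eig {H : Type} [CommGroup H] [Fintype H] {V : Type*} [AddCommGroup V] [Module ℂ V]
    (ρ : H →* Module.End ℂ V) (χ : H →* ℂˣ) (v : V) (g : H) :
    ρ g (eigProj ρ χ v) = ((χ g : ℂˣ) : ℂ) • eigProj ρ χ v := by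
  unfold eigProj
  rw [map_smul, smul_comm, map_sum]
  congr 1
  rw [Finset.smul_sum]
  refine Fintype.sum_equiv (Equiv.mulLeft g) _ _ ?_
  intro h
  simp only [Equiv.coe_mulLeft, map_smul, map_mul, smul_smul, mul_inv_rev, Module.End.mul_apply]
  congr 1
  rw [← Units.val_mul]
  congr 1
  simp

lemma sum_char {H : Type} [CommGroup H] [Fintype H] [Fintype (H →* ℂˣ)] [DecidableEq H] (h : H) :
    ∑ χ : H →* ℂˣ, ((χ h⁻¹ : ℂˣ) : ℂ) = if h = 1 then (Fintype.card H : ℂ) else 0 := by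
  classical
  let ev : (H →* ℂˣ) →* ℂ := (Units.coeHom ℂ).comp (MonoidHom.eval h⁻¹)
  have h1 := sum_hom_units ev
  have h2 : ∀ χ : H →* ℂˣ, ev χ = ((χ h⁻¹ : ℂˣ) : ℂ) := fun χ => rfl
  simp only [h2] at h1
  rw [h1]
  have hcard : Fintype.card (H →* ℂˣ) = Fintype.card H := by
    rw [← Nat.card_eq_fintype_card, ← Nat.card_eq_fintype_card]
    exact CommGroup.card_monoidHom_of_hasEnoughRootsOfUnity H ℂ
  by_cases hh : h = 1
  · have : ev = 1 := by
      ext χ; simp [h2, hh]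
    rw [if_pos this, if_pos hh, hcard]
  · have : ev ≠ 1 := by
      intro he
      obtain ⟨χ, hχ⟩ := CommGroup.exists_apply_ne_one_of_hasEnoughRootsOfUnity H ℂ hh
      apply hχ
      have := DFunLike.congr_fun he χ
      rw [h2] at this
      simpa using this
    rw [if_neg this, if_neg hh]; simp

lemma eigProj_sum {H : Type} [CommGroup H] [Fintype H] [Fintype (H →* ℂˣ)] {V : Type*}
    [AddCommGroup V] [Module ℂ V] (ρ : H →* Module.End ℂ V) (v : V) :
    ∑ χ : H →* ℂˣ, eigProj ρ χ v = v := by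
  classical
  unfold eigProj
  rw [← Finset.smul_sum, Finset.sum_comm]
  simp_rw [← Finset.sum_smul, sum_char]
  simp [ite_smul, smul_smul]

lemma jordan_step {E : Type*} [NormedAddCommGroup E] [InnerProductSpace ℂ E]
    {G : Type} [Group G] [Finite G] (ρ : G →* (E →L[ℂ] E)) (hinj : Function.Injective ρ)
    (hiso : ∀ g x, ‖ρ g x‖ = ‖x‖) (A B : G) (hB : ‖ρ B - 1‖ < 1)
    (hc : Commute A (A * B * A⁻¹ * B⁻¹)) : Commute A B := by
  classical
  set A' := B * A * B⁻¹ with hA'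
  have hAA : Commute A A' := by
    have h1 : (A * B * A⁻¹ * B⁻¹) = A * A'⁻¹ := by rw [hA']; group
    rw [h1] at hc
    have h2 : Commute A A'⁻¹ := by
      have := (Commute.refl A).inv_right.mul_right hc
      simpa using this
    simpa using h2.inv_right
  suffices h : ρ A = ρ A' by
    have := hinj h
    rw [hA'] at this
    show A * B = B * A
    conv_lhs => rw [this]
    group
  let H := Subgroup.closure ({A, A'} : Set G)
  have hcomm : ∀ x ∈ ({A, A'} : Set G), ∀ y ∈ ({A, A'} : Set G), x * y = y * x := by
    rintro x (rfl | rfl) y (rfl | rfl)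
    · rfl
    · exact hAA
    · exact hAA.symm
    · rfl
  let _ : CommGroup H := Subgroup.closureCommGroupOfComm hcomm
  let _ : Fintype H := Fintype.ofFinite H
  have : Finite (H →* ℂˣ) := Nat.finite_of_card_ne_zero (by
    rw [CommGroup.card_monoidHom_of_hasEnoughRootsOfUnity H ℂ]; exact Nat.card_pos.ne')
  let _ : Fintype (H →* ℂˣ) := Fintype.ofFinite _
  let tol : (E →L[ℂ] E) →* Module.End ℂ E :=
    { toFun := fun T => T.toLinearMap, map_one' := rfl, map_mul' := fun _ _ => rfl }
  let ρ' : H →* Module.End ℂ E := (tol.comp ρ).comp H.subtype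
  have hρ' : ∀ (h : H) x, ρ' h x = ρ h x := fun _ _ => rfl
  let a : H := ⟨A, Subgroup.subset_closure (by simp)⟩
  let a' : H := ⟨A', Subgroup.subset_closure (by simp)⟩
  ext v
  rw [← eigProj_sum ρ' v, map_sum, map_sum]
  refine Finset.sum_congr rfl fun χ _ => ?_
  set w := eigProj ρ' χ v
  have h1 : ρ A w = ((χ a : ℂˣ) : ℂ) • w := eigProj_eig ρ' χ v a
  have h2 : ρ A' w = ((χ a' : ℂˣ) : ℂ) • w := eigProj_eig ρ' χ v a'
  by_cases hw : w = 0
  · simp [hw]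
  by_cases hχ : χ a = χ a'
  · rw [h1, h2, hχ]
  exfalso
  have hu : ∀ g x, ρ g⁻¹ (ρ g x) = x := fun g x => by
    rw [← mul_apply_eq_comp, ← map_mul]; simp
  have hu' : ∀ g x, ρ g (ρ g⁻¹ x) = x := fun g x => by
    rw [← mul_apply_eq_comp, ← map_mul]; simp
  set u := ρ B⁻¹ w with hu0
  have hwu : w = ρ B u := (hu' B w).symm
  have h3 : ρ A u = ((χ a' : ℂˣ) : ℂ) • u := by
    have : ρ A u = ρ B⁻¹ (ρ A' w) := by
      rw [hwu, ← mul_apply_eq_comp, ← mul_apply_eq_comp, ← map_mul,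
        ← map_mul, hA']
      congr 2; group
    rw [this, h2, map_smul]
  have hinner : ∀ x y, inner ℂ (ρ A x) (ρ A y) = inner ℂ x y := by
    intro x y
    exact LinearIsometry.inner_map_map (⟨(ρ A).toLinearMap, hiso A⟩ : E →ₗᵢ[ℂ] E) x y
  have hn : ∀ (c : ℂ), ρ A w = c • w → ‖c‖ = 1 := by
    intro c hc
    have := hiso A w
    rw [hc, norm_smul] at this
    have hw' : ‖w‖ ≠ 0 := norm_ne_zero_iff.mpr hw
    field_simp at this
    exact this
  have hortho : inner ℂ w u = 0 := by
    have h4 := hinner w u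
    rw [h1, h3, inner_smul_left, inner_smul_right] at h4
    have h5 := hn _ h1
    have h6 : (starRingEnd ℂ) ((χ a : ℂˣ) : ℂ) * ((χ a : ℂˣ) : ℂ) = 1 := by
      rw [mul_comm, Complex.mul_conj, Complex.normSq_eq_norm_sq, h5]; simp
    by_contra hne
    rw [← mul_assoc] at h4
    have h7 := mul_right_cancel₀ hne (h4.trans (one_mul _).symm)
    apply hχ
    have hc0 : (starRingEnd ℂ) ((χ a : ℂˣ) : ℂ) ≠ 0 := by
      intro h0; rw [h0] at h6; simp at h6
    exact Units.ext (mul_left_cancel₀ hc0 (h6.trans h7.symm))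
  have hnu : ‖u‖ = ‖w‖ := hiso _ _
  have h8 : ‖w - u‖ ≤ ‖ρ B - 1‖ * ‖u‖ := by
    have := (ρ B - 1).le_opNorm u
    rwa [sub_apply, one_apply_eq_self, ← hwu] at this
  have h9 : ‖w - u‖ * ‖w - u‖ = ‖w‖ * ‖w‖ + ‖u‖ * ‖u‖ :=
    by
    have := norm_sub_sq (𝕜 := ℂ) w u
    rw [hortho] at this
    simp only [map_zero, mul_zero, sub_zero] at this
    nlinarith
  have hw' : 0 < ‖w‖ := norm_pos_iff.mpr hw
  rw [hnu] at h8 h9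
  have h10 : ‖w - u‖ ≤ ‖w‖ := by nlinarith [norm_nonneg (ρ B - 1)]
  nlinarith [norm_nonneg (w - u)]

lemma jordan_comm {E : Type*} [NormedAddCommGroup E] [InnerProductSpace ℂ E]
    {G : Type} [Group G] [Finite G] (ρ : G →* (E →L[ℂ] E)) (hinj : Function.Injective ρ)
    (hiso : ∀ g x, ‖ρ g x‖ = ‖x‖) (A B : G) (hA : ‖ρ A - 1‖ < 1 / 2) (hB : ‖ρ B - 1‖ < 1 / 2) :
    Commute A B := by
  have hnorm : ∀ g, ‖ρ g‖ ≤ 1 := fun g =>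
    ContinuousLinearMap.opNorm_le_bound _ zero_le_one fun x => by rw [hiso, one_mul]
  have hcom : ∀ g h : G, ‖ρ (g * h * g⁻¹ * h⁻¹) - 1‖ ≤ 2 * ‖ρ g - 1‖ * ‖ρ h - 1‖ := by
    intro g h
    have h1 : ρ (g * h * g⁻¹ * h⁻¹) - 1 =
        ((ρ g - 1) * (ρ h - 1) - (ρ h - 1) * (ρ g - 1)) * ρ (g⁻¹ * h⁻¹) := by
      have e1 : (ρ g - 1) * (ρ h - 1) - (ρ h - 1) * (ρ g - 1) = ρ (g * h) - ρ (h * g) := by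
        rw [map_mul, map_mul]; noncomm_ring
      rw [e1, sub_mul, ← map_mul, ← map_mul]
      have e2 : h * g * (g⁻¹ * h⁻¹) = 1 := by group
      have e3 : g * h * (g⁻¹ * h⁻¹) = g * h * g⁻¹ * h⁻¹ := by group
      rw [e2, e3, map_one]
    rw [h1]
    calc _ ≤ ‖(ρ g - 1) * (ρ h - 1) - (ρ h - 1) * (ρ g - 1)‖ * ‖ρ (g⁻¹ * h⁻¹)‖ := norm_mul_le _ _
      _ ≤ ‖(ρ g - 1) * (ρ h - 1) - (ρ h - 1) * (ρ g - 1)‖ * 1 := by gcongr; exact hnorm _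
      _ ≤ ‖(ρ g - 1) * (ρ h - 1)‖ + ‖(ρ h - 1) * (ρ g - 1)‖ := by rw [mul_one]; exact norm_sub_le _ _
      _ ≤ ‖ρ g - 1‖ * ‖ρ h - 1‖ + ‖ρ h - 1‖ * ‖ρ g - 1‖ := by gcongr <;> exact norm_mul_le _ _
      _ = _ := by ring
  let s : ℕ → G := fun k => (fun x => A * x * A⁻¹ * x⁻¹)^[k] B
  have hs : ∀ k, s (k + 1) = A * s k * A⁻¹ * (s k)⁻¹ := fun k => Function.iterate_succ_apply' _ _ _
  set r := 2 * ‖ρ A - 1‖ with hr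
  have hr1 : r < 1 := by linarith
  have hr0 : 0 ≤ r := by positivity
  have hbd : ∀ k, ‖ρ (s k) - 1‖ ≤ r ^ k * (1 / 2) := by
    intro k
    induction k with
    | zero => simp only [pow_zero, one_mul]; exact hB.le
    | succ k ih =>
      rw [hs, pow_succ']
      calc _ ≤ r * ‖ρ (s k) - 1‖ := hcom _ _
        _ ≤ r * (r ^ k * (1 / 2)) := by gcongr
        _ = _ := by ring
  have hlt : ∀ k, ‖ρ (s k) - 1‖ < 1 := fun k => by
    have := hbd k
    have := pow_le_one₀ hr0 hr1.le (n := k)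
    linarith
  -- some s k = 1
  have hex : ∃ k, s k = 1 := by
    have ht : Filter.Tendsto (fun k => ρ (s k)) Filter.atTop (nhds 1) := by
      rw [tendsto_iff_norm_sub_tendsto_zero]
      refine squeeze_zero (fun _ => norm_nonneg _) hbd ?_
      have := (tendsto_pow_atTop_nhds_zero_of_lt_one hr0 hr1).mul_const (1 / 2 : ℝ)
      simpa using this
    have hfin : (Set.range ρ \ {1}).Finite := (Set.finite_range ρ).subset Set.diff_subset
    have hopen : (Set.range ρ \ {1})ᶜ ∈ nhds (1 : E →L[ℂ] E) :=
      hfin.isClosed.isOpen_compl.mem_nhds (by simp)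
    obtain ⟨k, hk⟩ := (ht.eventually hopen).exists
    refine ⟨k, hinj ?_⟩
    rw [map_one]
    by_contra hne
    exact hk ⟨⟨_, rfl⟩, hne⟩
  obtain ⟨k, hk⟩ := hex
  have hdesc : ∀ j, Commute A (s j) → Commute A (s 0) := by
    intro j
    induction j with
    | zero => exact id
    | succ j ih =>
      intro hj
      apply ih
      rw [hs] at hj
      exact jordan_step ρ hinj hiso A (s j) (hlt j) hj
  exact hdesc k (by rw [hk]; exact Commute.one_right A)

lemma jordan_isometric (E : Type) [NormedAddCommGroup E] [InnerProductSpace ℂ E]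
    [FiniteDimensional ℂ E] :
    ∃ J : ℕ, ∀ (G : Type) [Group G] [Finite G] (ρ : G →* (E →L[ℂ] E)), Function.Injective ρ →
      (∀ g x, ‖ρ g x‖ = ‖x‖) → ∃ A : Subgroup G, (∀ x ∈ A, ∀ y ∈ A, x * y = y * x) ∧
        A.index ≤ J := by
  classical
  have : ProperSpace (E →L[ℂ] E) := FiniteDimensional.proper ℂ _
  have hK : IsCompact (Metric.closedBall (0 : E →L[ℂ] E) 1) := isCompact_closedBall _ _
  obtain ⟨t, -, htf, ht⟩ := Metric.totallyBounded_iff.mp hK.totallyBounded (1 / 4) (by norm_num) |>.imp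
    fun t ht => (⟨trivial, ht⟩ : True ∧ _)
  refine ⟨htf.toFinset.card, ?_⟩
  intro G _ _ ρ hinj hiso
  have hnorm : ∀ g, ‖ρ g‖ ≤ 1 := fun g =>
    ContinuousLinearMap.opNorm_le_bound _ zero_le_one fun x => by rw [hiso, one_mul]
  let S : Set G := {g | ‖ρ g - 1‖ < 1 / 2}
  let A := Subgroup.closure S
  have hcomm : ∀ x ∈ S, ∀ y ∈ S, x * y = y * x := fun x hx y hy =>
    jordan_comm ρ hinj hiso x y hx hy
  refine ⟨A, ?_, ?_⟩
  · let _ : CommGroup A := Subgroup.closureCommGroupOfComm hcomm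
    intro x hx y hy
    have := mul_comm (⟨x, hx⟩ : A) ⟨y, hy⟩
    exact congrArg Subtype.val this
  · have hc : ∀ g, ∃ c ∈ t, ρ g ∈ Metric.ball c (1 / 4) := fun g => by
      have : ρ g ∈ Metric.closedBall (0 : E →L[ℂ] E) 1 := by simpa using hnorm g
      simpa using ht this
    choose c hct hcb using hc
    have : Finite (G ⧸ A) := inferInstance
    let F : G ⧸ A → htf.toFinset := fun q => ⟨c q.out, by simpa using hct _⟩
    have hF : Function.Injective F := by
      intro p q hpq
      have h1 : c p.out = c q.out := congrArg Subtype.val hpq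
      have h2 : ‖ρ p.out - ρ q.out‖ < 1 / 2 := by
        have e1 := hcb p.out
        have e2 := hcb q.out
        rw [← h1] at e2
        rw [Metric.mem_ball] at e1 e2
        rw [← dist_eq_norm]
        have := dist_triangle_right (ρ p.out) (ρ q.out) (c p.out)
        linarith
      rw [← p.out_eq, ← q.out_eq]
      apply QuotientGroup.eq.mpr
      apply Subgroup.subset_closure
      show ‖ρ _ - 1‖ < 1 / 2
      have h3 : ρ (p.out⁻¹ * q.out) - 1 = ρ p.out⁻¹ * (ρ q.out - ρ p.out) := by
        rw [mul_sub, ← map_mul, ← map_mul]; simp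
      rw [h3]
      calc _ ≤ ‖ρ p.out⁻¹‖ * ‖ρ q.out - ρ p.out‖ := norm_mul_le _ _
        _ ≤ 1 * ‖ρ q.out - ρ p.out‖ := by gcongr; exact hnorm _
        _ < 1 / 2 := by rw [one_mul, norm_sub_rev]; exact h2
    have := Nat.card_le_card_of_injective F hF
    rw [Nat.card_eq_fintype_card (α := htf.toFinset), Fintype.card_coe] at this
    exact this

lemma jordan_matrix (N : ℕ) :
    ∃ J : ℕ, ∀ (G : Type) [Group G] [Finite G] (π : G →* Matrix (Fin N) (Fin N) ℂ),
      Function.Injective π → ∃ A : Subgroup G, (∀ x ∈ A, ∀ y ∈ A, x * y = y * x) ∧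
        A.index ≤ J := by
  classical
  obtain ⟨J, hJ⟩ := jordan_isometric (EuclideanSpace ℂ (Fin N))
  refine ⟨J, ?_⟩
  intro G _ _ π hπ
  let _ : Fintype G := Fintype.ofFinite G
  let V := EuclideanSpace ℂ (Fin N)
  let F := PiLp 2 (fun _ : G => V)
  let τ : G →* Module.End ℂ V :=
    ((Matrix.toLpLinAlgEquiv (R := ℂ) (n := Fin N) 2 : _ ≃ₐ[ℂ] _) : _ →* _).comp π
  have hτ : Function.Injective τ :=
    (Matrix.toLpLinAlgEquiv (R := ℂ) (n := Fin N) 2).injective.comp hπ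
  let T : V →ₗ[ℂ] F := (WithLp.linearEquiv 2 ℂ (G → V)).symm.toLinearMap ∘ₗ
    LinearMap.pi (fun g => τ g)
  have hT : ∀ x g, T x g = τ g x := fun x g => rfl
  have hTinj : Function.Injective T := by
    intro x y hxy
    have := congrArg (fun z : F => z 1) hxy
    simpa [hT] using this
  let W := LinearMap.range T
  let e : V ≃ₗ[ℂ] W := LinearEquiv.ofInjective T hTinj
  have hW : Module.finrank ℂ W = N := by
    rw [← e.finrank_eq]; simp [V]
  let b := (stdOrthonormalBasis ℂ W).reindex (finCongr hW)
  let Q : V ≃ₗ[ℂ] V := e.trans b.repr.toLinearEquiv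
  have hQ : ∀ x, ‖Q x‖ ^ 2 = ∑ g : G, ‖τ g x‖ ^ 2 := by
    intro x
    have h1 : ‖Q x‖ = ‖T x‖ := by
      show ‖b.repr (e x)‖ = _
      rw [LinearIsometryEquiv.norm_map]; rfl
    rw [h1, PiLp.norm_sq_eq_of_L2]
    rfl
  let ρ : G →* (V →L[ℂ] V) :=
    { toFun := fun g => LinearMap.toContinuousLinearMap (Q.toLinearMap ∘ₗ τ g ∘ₗ Q.symm.toLinearMap)
      map_one' := by ext x; simp
      map_mul' := by intro g h; ext x; simp }
  have hρ : ∀ g x, ρ g x = Q (τ g (Q.symm x)) := fun g x => rfl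
  refine hJ G ρ ?_ ?_
  · intro g h hgh
    apply hτ
    ext1 x
    have := DFunLike.congr_fun hgh (Q x)
    rw [hρ, hρ] at this
    simpa using this
  · intro g x
    rw [hρ]
    have h1 : ‖Q (τ g (Q.symm x))‖ ^ 2 = ‖x‖ ^ 2 := by
      conv_rhs => rw [← Q.apply_symm_apply x]
      rw [hQ, hQ]
      refine Fintype.sum_equiv (Equiv.mulRight g) _ _ fun h => ?_
      simp
    exact (sq_eq_sq₀ (norm_nonneg _) (norm_nonneg _)).mp h1

lemma det_weight_bound {N : ℕ} (E : Matrix (Fin N) (Fin N) ℤ) (hE : ∀ i j, 0 ≤ E i j)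
    (a : Fin N → ℕ) (d : ℕ) (h : ∀ i, ∑ j, E i j * a j = d) :
    (E.det.natAbs : ℤ) * ∏ i, (a i : ℤ) ≤ (d : ℤ) ^ N := by
  classical
  rw [Int.natCast_natAbs]
  have h1 : |E.det| ≤ ∑ σ : Equiv.Perm (Fin N), ∏ i, E i (σ i) := by
    rw [← Matrix.det_transpose, Matrix.det_apply]
    refine (Finset.abs_sum_le_sum_abs _ _).trans (Finset.sum_le_sum fun σ _ => ?_)
    have h2 : |Equiv.Perm.sign σ • ∏ i, E.transpose (σ i) i| = |∏ i, E.transpose (σ i) i| := by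
      rcases Int.units_eq_one_or (Equiv.Perm.sign σ) with h | h <;> simp [h]
    rw [h2, abs_of_nonneg]
    · rfl
    · exact Finset.prod_nonneg fun i _ => hE _ _
  calc |E.det| * ∏ i, (a i : ℤ) ≤ (∑ σ : Equiv.Perm (Fin N), ∏ i, E i (σ i)) * ∏ i, (a i : ℤ) := by
        gcongr
    _ = ∑ σ : Equiv.Perm (Fin N), ∏ i, (E i (σ i) * a (σ i)) := by
        rw [Finset.sum_mul]
        refine Finset.sum_congr rfl fun σ _ => ?_
        rw [Finset.prod_mul_distrib, Equiv.prod_comp σ (fun i => (a i : ℤ))]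
    _ = ∑ φ ∈ Finset.univ.image (fun σ : Equiv.Perm (Fin N) => (σ : Fin N → Fin N)),
          ∏ i, (E i (φ i) * a (φ i)) := by
        rw [Finset.sum_image]
        intro σ _ τ _ hst
        exact DFunLike.coe_injective hst
    _ ≤ ∑ φ : Fin N → Fin N, ∏ i, (E i (φ i) * a (φ i)) := by
        refine Finset.sum_le_sum_of_subset_of_nonneg (Finset.subset_univ _) fun φ _ _ => ?_
        exact Finset.prod_nonneg fun i _ => mul_nonneg (hE _ _) (by positivity)
    _ = ∏ i, ∑ j, E i j * a j := by
        rw [Finset.prod_univ_sum, Fintype.piFinset_univ]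
    _ = (d : ℤ) ^ N := by simp [h]

lemma card_torus_le {N : ℕ} (E : Matrix (Fin N) (Fin N) ℤ) (hE : E.det ≠ 0) :
    Finite {t : Fin N → ℂˣ // ∀ i, ∏ j, t j ^ E i j = 1} ∧
    Nat.card {t : Fin N → ℂˣ // ∀ i, ∏ j, t j ^ E i j = 1} ≤ E.det.natAbs := by
  classical
  let f : (Fin N → ℤ) →ₗ[ℤ] (Fin N → ℤ) := E.transpose.mulVecLin
  have hf : Function.Injective f := by
    rw [← LinearMap.ker_eq_bot]
    have := Matrix.det_transpose E
    rw [LinearMap.ker_eq_bot']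
    intro v hv
    exact Matrix.eq_zero_of_mulVec_eq_zero (by rwa [this]) hv
  let e : (Fin N → ℤ) ≃ₗ[ℤ] LinearMap.range f := LinearEquiv.ofInjective f hf
  have hdet := Submodule.natAbs_det_equiv (LinearMap.range f) e
  have hcomp : (LinearMap.range f).subtype ∘ₗ AddMonoidHom.toIntLinearMap (e : (Fin N → ℤ) →+ LinearMap.range f) = f := by
    ext1; rfl
  rw [hcomp] at hdet
  have hdf : LinearMap.det f = E.det := by
    rw [← Matrix.det_transpose, ← LinearMap.det_toLin']; rfl
  rw [hdf] at hdet
  let Q := (Fin N → ℤ) ⧸ LinearMap.range f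
  have hQ : Nat.card Q = E.det.natAbs := hdet.symm
  have : Finite Q := Nat.finite_of_card_ne_zero (by rw [hQ]; simpa using hE)
  have : Finite (Multiplicative Q) := inferInstanceAs (Finite Q)
  have hd : Nat.card (Multiplicative Q →* ℂˣ) = E.det.natAbs := by
    rw [CommGroup.card_monoidHom_of_hasEnoughRootsOfUnity (Multiplicative Q) ℂ, ← hQ]; rfl
  have : Finite (Multiplicative Q →* ℂˣ) := Nat.finite_of_card_ne_zero (by rw [hd]; simpa using hE)
  rw [← hd]
  let ev : (Fin N → ℂˣ) → ((Fin N → ℤ) →ₗ[ℤ] Additive ℂˣ) := fun t =>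
    { toFun := fun v => Additive.ofMul (∏ j, t j ^ v j)
      map_add' := by
        intro v w
        rw [← ofMul_mul, ← Finset.prod_mul_distrib]
        simp [zpow_add]
      map_smul' := by
        intro c v
        simp only [RingHom.id_apply, ← ofMul_zpow, ← Finset.prod_zpow]
        congr 1
        refine Finset.prod_congr rfl fun j _ => ?_
        rw [← zpow_mul, mul_comm, Pi.smul_apply, smul_eq_mul] }
  have hker : ∀ t : {t : Fin N → ℂˣ // ∀ i, ∏ j, t j ^ E i j = 1},
      LinearMap.range f ≤ LinearMap.ker (ev t.1) := by
    rintro t _ ⟨v, rfl⟩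
    rw [LinearMap.mem_ker]
    have hfc : (ev t.1).comp f = 0 := by
      refine LinearMap.pi_ext' fun i => ?_
      refine LinearMap.ext_ring ?_
      have : f (Pi.single i 1) = fun j => E i j := by
        ext j; simp [f]
      simp only [LinearMap.comp_apply, LinearMap.coe_single, this]
      exact congrArg Additive.ofMul (t.2 i)
    exact DFunLike.congr_fun hfc v
  let Φ : {t : Fin N → ℂˣ // ∀ i, ∏ j, t j ^ E i j = 1} → (Multiplicative Q →* ℂˣ) := fun t =>
    AddMonoidHom.toMultiplicativeLeft (((LinearMap.range f).liftQ (ev t.1) (hker t)).toAddMonoidHom)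
  suffices hinj : Function.Injective Φ from
    ⟨Finite.of_injective Φ hinj, Nat.card_le_card_of_injective Φ hinj⟩
  intro t s hts
  ext1
  funext j
  have h1 := DFunLike.congr_fun hts (Multiplicative.ofAdd
    (Submodule.Quotient.mk (p := LinearMap.range f) (Pi.single j 1)))
  have h2 : ∀ t : {t : Fin N → ℂˣ // ∀ i, ∏ j, t j ^ E i j = 1}, Φ t (Multiplicative.ofAdd
    (Submodule.Quotient.mk (p := LinearMap.range f) (Pi.single j 1))) = t.1 j := by
    intro t
    have : ∏ k, t.1 k ^ (Pi.single j 1 : Fin N → ℤ) k = t.1 j := by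
      rw [Finset.prod_eq_single j]
      · simp
      · intro b _ hb; simp [hb]
      · simp
    exact this
  rwa [h2, h2] at h1

lemma prod_zpow_sum' {N : ℕ} (s : ℂˣ) (f : Fin N → ℤ) : ∏ i, s ^ f i = s ^ ∑ i, f i := by
  classical
  induction (Finset.univ : Finset (Fin N)) using Finset.induction with
  | empty => simp
  | insert i S hi ih => rw [Finset.prod_insert hi, Finset.sum_insert hi, zpow_add, ih]

lemma exists_indep_rows {N : ℕ} (M : Set (Fin N →₀ ℕ))
    (hfin : {t : Fin N → ℂˣ | ∀ m ∈ M, ∏ i, t i ^ m i = 1}.Finite) :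
    ∃ r : Fin N → (Fin N →₀ ℕ), (∀ i, r i ∈ M) ∧
      (Matrix.of fun i j => ((r i j : ℕ) : ℤ)).det ≠ 0 := by
  classical
  let q : (Fin N →₀ ℕ) → (Fin N → ℚ) := fun m j => (m j : ℚ)
  by_cases hs : Submodule.span ℚ (q '' M) = ⊤
  · obtain ⟨b, hb, hspan, hli⟩ := exists_linearIndependent ℚ (q '' M)
    rw [hs] at hspan
    let B : Module.Basis b ℚ (Fin N → ℚ) := Module.Basis.mk hli (by simp [hspan])
    have hfb : Fintype b := FiniteDimensional.fintypeBasisIndex B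
    have hcard : Fintype.card b = N := by
      rw [← Module.finrank_eq_card_basis B]; simp
    let eq : Fin N ≃ b := (Fintype.equivFinOfCardEq hcard).symm
    have hr : ∀ i : Fin N, ∃ m ∈ M, q m = (eq i : Fin N → ℚ) := fun i => hb (eq i).2
    choose r hrM hrq using hr
    refine ⟨r, hrM, ?_⟩
    have hli' : LinearIndependent ℚ (fun i => q (r i)) := by
      have := hli.comp eq eq.injective
      have he : (fun i => q (r i)) = (Subtype.val ∘ eq) := funext hrq
      rw [he]; exact this
    have hunit : IsUnit (Matrix.of fun i j => q (r i) j) :=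
      Matrix.linearIndependent_rows_iff_isUnit.mp hli'
    rw [Matrix.isUnit_iff_isUnit_det, isUnit_iff_ne_zero] at hunit
    intro h0
    apply hunit
    have : (Matrix.of fun i j => q (r i) j) =
        (Int.castRingHom ℚ).mapMatrix (Matrix.of fun i j => ((r i j : ℕ) : ℤ)) := by
      ext i j; simp [q]
    rw [this, ← RingHom.map_det, h0, map_zero]
  · exfalso
    obtain ⟨φ, hφ0, hφ⟩ := Submodule.exists_le_ker_of_lt_top _ (lt_top_iff_ne_top.mpr hs)
    obtain ⟨D, hD⟩ := IsLocalization.exist_integer_multiples_of_finite (nonZeroDivisors ℤ)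
      (fun i => φ (Pi.single i 1))
    choose v hv using hD
    have hD0 : ((D : ℤ) : ℚ) ≠ 0 := by
      have := nonZeroDivisors.coe_ne_zero D
      exact_mod_cast this
    have hv' : ∀ i, (v i : ℚ) = (D : ℤ) * φ (Pi.single i 1) := by
      intro i
      have := hv i
      simpa [Algebra.smul_def] using this
    have hφe : ∀ x, φ x = ∑ i, x i * φ (Pi.single i 1) := by
      intro x
      conv_lhs => rw [pi_eq_sum_univ' x]
      rw [map_sum]
      refine Finset.sum_congr rfl fun i _ => ?_
      rw [map_smul, smul_eq_mul]
    have hvne : ∃ i, v i ≠ 0 := by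
      by_contra hall
      push Not at hall
      apply hφ0
      ext i
      have := hv' i
      rw [hall i] at this
      simp at this
      simpa [hD0] using this
    have hort : ∀ m ∈ M, ∑ i, v i * (m i : ℤ) = 0 := by
      intro m hm
      have h1 : φ (q m) = 0 := hφ (Submodule.subset_span ⟨m, hm, rfl⟩)
      rw [hφe] at h1
      have : ((∑ i, v i * (m i : ℤ) : ℤ) : ℚ) = 0 := by
        push_cast
        rw [← mul_zero ((D : ℤ) : ℚ), ← h1, Finset.mul_sum]
        refine Finset.sum_congr rfl fun i _ => ?_
        rw [hv']; simp only [q]; ring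
      exact_mod_cast this
    obtain ⟨i₀, hi₀⟩ := hvne
    let s : ℕ → ℂˣ := fun k => (Units.mk0 (2 : ℂ) two_ne_zero) ^ k
    let t : ℕ → (Fin N → ℂˣ) := fun k i => s k ^ v i
    have htm : ∀ k, t k ∈ {t : Fin N → ℂˣ | ∀ m ∈ M, ∏ i, t i ^ m i = 1} := by
      intro k m hm
      have : ∀ i, t k i ^ m i = s k ^ (v i * (m i : ℤ)) := fun i => by
        simp only [t]; rw [zpow_mul, zpow_natCast]
      simp only [this]
      rw [prod_zpow_sum', hort m hm, zpow_zero]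
    have htinj : Function.Injective t := by
      intro k l hkl
      have h1 := congrFun hkl i₀
      simp only [t, s] at h1
      have h2 := congrArg (fun u : ℂˣ => ‖(u : ℂ)‖) h1
      simp only [Units.val_zpow_eq_zpow_val, Units.val_pow_eq_pow_val, Units.val_mk0, norm_zpow, norm_pow,
        Complex.norm_ofNat] at h2
      rw [← zpow_natCast, ← zpow_natCast, ← zpow_mul, ← zpow_mul] at h2
      have h3 := zpow_right_injective₀ (by norm_num : (0 : ℝ) < 2) (by norm_num) h2
      have := mul_right_cancel₀ hi₀ h3
      exact_mod_cast this
    exact (Set.infinite_of_injective_forall_mem htinj htm) hfin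

lemma torus_bound {N : ℕ} (M : Set (Fin N →₀ ℕ)) (a : Fin N → ℕ) (d : ℕ)
    (hM : ∀ m ∈ M, ∑ i, m i * a i = d)
    (hfin : {t : Fin N → ℂˣ | ∀ m ∈ M, ∏ i, t i ^ m i = 1}.Finite) :
    Nat.card {t : Fin N → ℂˣ | ∀ m ∈ M, ∏ i, t i ^ m i = 1} * ∏ i, a i ≤ d ^ N := by
  classical
  obtain ⟨r, hr, hdet⟩ := exists_indep_rows M hfin
  set E : Matrix (Fin N) (Fin N) ℤ := Matrix.of fun i j => ((r i j : ℕ) : ℤ) with hEdef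
  have hb := det_weight_bound E (fun i j => by simp [hEdef]) a d (fun i => by
    have := hM _ (hr i)
    simp only [hEdef, Matrix.of_apply]
    exact_mod_cast this)
  obtain ⟨hfin', hc⟩ := card_torus_le E hdet
  have hle : Nat.card {t : Fin N → ℂˣ | ∀ m ∈ M, ∏ i, t i ^ m i = 1} ≤
      Nat.card {t : Fin N → ℂˣ // ∀ i, ∏ j, t j ^ E i j = 1} := by
    refine Nat.card_le_card_of_injective
      (fun t => ⟨t.1, fun i => ?_⟩) ?_
    · have := t.2 _ (hr i)
      simpa [hEdef] using this
    · intro t s hts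
      exact Subtype.ext (Subtype.mk.inj hts)
  have h2 : (E.det.natAbs) * ∏ i, a i ≤ d ^ N := by exact_mod_cast hb
  exact (Nat.mul_le_mul_right _ (hle.trans hc)).trans h2

lemma coeff_single_eq_pderiv {N : ℕ} (p : MvPolynomial (Fin N) ℂ) (j : Fin N) :
    coeff (Finsupp.single j 1) p = constantCoeff (pderiv j p) := by
  classical
  induction p using MvPolynomial.induction_on with
  | C c => simp [coeff_C, eq_comm, Finsupp.single_eq_zero]
  | add p q hp hq => simp [hp, hq]
  | mul_X p i hp =>
    rw [coeff_mul_X', Derivation.leibniz, pderiv_X]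
    by_cases h : i = j
    · subst h; simp; rfl
    · simp [h, Pi.single_apply, Finsupp.single_apply, Ne.symm h]

lemma constantCoeff_hom {N : ℕ} (φ : MvPolynomial (Fin N) ℂ →ₐ[ℂ] MvPolynomial (Fin N) ℂ)
    (h0 : ∀ k, constantCoeff (φ (X k)) = 0) (p : MvPolynomial (Fin N) ℂ) :
    constantCoeff (φ p) = constantCoeff p := by
  induction p using MvPolynomial.induction_on with
  | C c => rw [← algebraMap_eq, AlgHom.commutes]
  | add p q hp hq => simp [hp, hq]
  | mul_X p i hp => simp [h0]

lemma coeff_single_hom {N : ℕ} (φ : MvPolynomial (Fin N) ℂ →ₐ[ℂ] MvPolynomial (Fin N) ℂ)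
    (h0 : ∀ k, constantCoeff (φ (X k)) = 0) (p : MvPolynomial (Fin N) ℂ) (j : Fin N) :
    coeff (Finsupp.single j 1) (φ p) =
      ∑ k, coeff (Finsupp.single k 1) p * coeff (Finsupp.single j 1) (φ (X k)) := by
  classical
  simp only [coeff_single_eq_pderiv]
  induction p using MvPolynomial.induction_on with
  | C c => rw [← algebraMap_eq, AlgHom.commutes]; simp
  | add p q hp hq => simp [hp, hq, add_mul, Finset.sum_add_distrib]
  | mul_X p i hp =>
    simp only [map_mul, Derivation.leibniz, smul_eq_mul, map_add, h0, constantCoeff_hom φ h0,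
      constantCoeff_X, zero_mul, add_zero, pderiv_X]
    rw [Finset.sum_eq_single i]
    · simp
    · intro b _ hb; simp [Pi.single_apply, hb]
    · simp

lemma wh_constantCoeff {N : ℕ} {a : Fin N → ℕ} {w : ℕ} (hw : 0 < w)
    {p : MvPolynomial (Fin N) ℂ} (hp : p.IsWeightedHomogeneous a w) : constantCoeff p = 0 := by
  by_contra h
  have := hp (d := 0) h
  simp at this; omega

lemma wh_coeff_single {N : ℕ} {a : Fin N → ℕ} {w : ℕ} {j : Fin N}
    {p : MvPolynomial (Fin N) ℂ} (hp : p.IsWeightedHomogeneous a w) (hj : a j ≠ w) :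
    coeff (Finsupp.single j 1) p = 0 := by
  by_contra h
  have := hp h
  rw [Finsupp.weight_single] at this
  simp at this; exact hj this

/-- the linear part matrix -/
def linPart {N : ℕ} (y : Fin N → MvPolynomial (Fin N) ℂ) : Matrix (Fin N) (Fin N) ℂ :=
  Matrix.of fun i j => coeff (Finsupp.single j 1) (y i)

lemma aeval_surj {N : ℕ} (a : Fin N → ℕ) (ha : ∀ i, 0 < a i)
    (y : Fin N → MvPolynomial (Fin N) ℂ) (hy : ∀ i, (y i).IsWeightedHomogeneous a (a i))
    (hdet : (linPart y).det ≠ 0) : Function.Surjective (aeval y : _ →ₐ[ℂ] MvPolynomial (Fin N) ℂ) := by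
  classical
  let R := (aeval y : _ →ₐ[ℂ] MvPolynomial (Fin N) ℂ).range
  have hyR : ∀ k, y k ∈ R := fun k => ⟨X k, by simp⟩
  set A := linPart y with hA
  have hAij : ∀ i j, a j ≠ a i → A i j = 0 := fun i j h => wh_coeff_single (hy i) h
  have hu : IsUnit A.det := isUnit_iff_ne_zero.mpr hdet
  let D : Matrix (Fin N) (Fin N) ℂ := Matrix.diagonal fun i => (a i : ℂ)
  have hAD : A * D = D * A := by
    ext i j
    rw [Matrix.mul_diagonal, Matrix.diagonal_mul]
    by_cases h : a j = a i
    · rw [h, mul_comm]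
    · rw [hAij i j h]; simp
  have hBD : A⁻¹ * D = D * A⁻¹ := by
    calc A⁻¹ * D = A⁻¹ * D * (A * A⁻¹) := by rw [Matrix.mul_nonsing_inv _ hu, mul_one]
      _ = A⁻¹ * (D * A) * A⁻¹ := by simp only [mul_assoc]
      _ = A⁻¹ * (A * D) * A⁻¹ := by rw [hAD]
      _ = (A⁻¹ * A) * D * A⁻¹ := by simp only [mul_assoc]
      _ = D * A⁻¹ := by rw [Matrix.nonsing_inv_mul _ hu, one_mul]
  have hB : ∀ i j, a j ≠ a i → A⁻¹ i j = 0 := by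
    intro i j h
    have h1 := congrFun (congrFun hBD i) j
    rw [Matrix.mul_diagonal, Matrix.diagonal_mul] at h1
    have h2 : A⁻¹ i j * ((a j : ℂ) - a i) = 0 := by rw [mul_sub, h1]; ring
    rcases mul_eq_zero.mp h2 with h3 | h3
    · exact h3
    · exact absurd (by exact_mod_cast sub_eq_zero.mp h3) h
  have key : ∀ w, ∀ i, a i = w → X i ∈ R := by
    intro w
    induction w using Nat.strong_induction_on with
    | _ w ih =>
      intro i hi
      let L : Fin N → MvPolynomial (Fin N) ℂ := fun k => ∑ j, A k j • X j
      have hL : ∀ k, a k = w → L k ∈ R := by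
        intro k hk
        have hLh : (L k).IsWeightedHomogeneous a (a k) := by
          refine IsWeightedHomogeneous.sum _ _ _ fun j _ => ?_
          by_cases h : a j = a k
          · rw [smul_eq_C_mul, ← h]
            exact (isWeightedHomogeneous_X ℂ a j).C_mul _
          · rw [hAij k j h, zero_smul]; exact isWeightedHomogeneous_zero _ _ _
        have hz : (y k - L k).IsWeightedHomogeneous a (a k) := (hy k).sub hLh
        have hz1 : ∀ j, coeff (Finsupp.single j 1) (y k - L k) = 0 := by
          intro j
          simp only [L, coeff_sub, coeff_sum, coeff_smul, coeff_X, smul_eq_mul]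
          rw [Finset.sum_eq_single j]
          · simp [hA, linPart]
          · intro b _ hb
            rw [if_neg, mul_zero]
            intro h
            exact hb (Finsupp.single_left_injective one_ne_zero h)
          · simp
        have hzR : y k - L k ∈ R := by
          rw [as_sum (y k - L k)]
          refine Subalgebra.sum_mem _ fun m hm => ?_
          rw [monomial_eq]
          refine Subalgebra.mul_mem _ (Subalgebra.algebraMap_mem R _) ?_
          refine Subalgebra.prod_mem _ fun l hl => Subalgebra.pow_mem _ ?_ _
          have hmw := hz (mem_support_iff.mp hm)
          refine ih (a l) ?_ l rfl
          by_contra hge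
          apply mem_support_iff.mp hm
          have hml : 1 ≤ m l := Nat.one_le_iff_ne_zero.mpr (Finsupp.mem_support_iff.mp hl)
          have hdec : m = Finsupp.single l 1 + (m - Finsupp.single l 1) := by
            rw [add_tsub_cancel_of_le]
            rwa [Finsupp.single_le_iff]
          rw [hdec, map_add, Finsupp.weight_single] at hmw
          have h0 : Finsupp.weight a (m - Finsupp.single l 1) = 0 := by
            simp at hmw; omega
          have h00 : m - Finsupp.single l 1 = 0 := by
            ext t
            rw [Finsupp.weight_apply, Finsupp.sum_fintype _ _ (by simp)] at h0
            have := (Finset.sum_eq_zero_iff.mp h0) t (Finset.mem_univ _)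
            have ht := ha t
            simp only [smul_eq_mul, mul_eq_zero] at this
            rcases this with h | h
            · exact h
            · omega
          rw [hdec, h00, add_zero]
          exact hz1 l
        have : L k = y k - (y k - L k) := by ring
        rw [this]
        exact Subalgebra.sub_mem _ (hyR k) hzR
      have hX : X i = ∑ k, A⁻¹ i k • L k := by
        have h1 : ∑ k, A⁻¹ i k • L k = ∑ j, (A⁻¹ * A) i j • (X j : MvPolynomial (Fin N) ℂ) := by
          simp only [L, Finset.smul_sum, smul_smul, Matrix.mul_apply, Finset.sum_smul]
          exact Finset.sum_comm
        rw [h1, Matrix.nonsing_inv_mul _ hu]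
        simp [Matrix.one_apply, ite_smul]
      rw [hX]
      refine Subalgebra.sum_mem _ fun k _ => ?_
      by_cases h : a k = a i
      · exact Subalgebra.smul_mem _ (hL k (h.trans hi)) _
      · rw [hB i k h, zero_smul]; exact Subalgebra.zero_mem _
  have htop : R = ⊤ := by
    rw [eq_top_iff, ← adjoin_range_X, Algebra.adjoin_le_iff]
    rintro _ ⟨i, rfl⟩
    exact key _ i rfl
  exact (AlgHom.range_eq_top _).mp htop

lemma noeth_inj {R : Type*} [CommRing R] [IsNoetherianRing R] (f : R →+* R)
    (hf : Function.Surjective f) : Function.Injective f := by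
  have hs : ∀ k, Function.Surjective (f ^ k : R →+* R) := by
    intro k
    rw [RingHom.coe_pow]
    exact hf.iterate k
  let K : ℕ →o Ideal R := ⟨fun k => RingHom.ker (f ^ k : R →+* R), monotone_nat_of_le_succ (by
    intro k x hx
    rw [RingHom.mem_ker] at hx ⊢
    rw [pow_succ', RingHom.mul_def, RingHom.comp_apply, hx, map_zero])⟩
  obtain ⟨n, hn⟩ := monotone_stabilizes_iff_noetherian.2 (inferInstance : IsNoetherian R R) K
  rw [injective_iff_map_eq_zero]
  intro x hx
  obtain ⟨z, rfl⟩ := hs n x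
  have h1 : z ∈ K (n + 1) := by
    show z ∈ RingHom.ker _
    rw [RingHom.mem_ker, pow_succ', RingHom.mul_def, RingHom.comp_apply, hx]
  rw [← hn (n + 1) (Nat.le_succ n)] at h1
  exact h1

lemma wh_comp_hom {N : ℕ} (a : Fin N → ℕ)
    (φ : MvPolynomial (Fin N) ℂ →ₐ[ℂ] MvPolynomial (Fin N) ℂ)
    (h : ∀ i, (φ (X i)).IsWeightedHomogeneous a (a i)) (d : ℕ) (p : MvPolynomial (Fin N) ℂ) :
    weightedHomogeneousComponent a d (φ p) = φ (weightedHomogeneousComponent a d p) := by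
  classical
  induction p using MvPolynomial.induction_on' with
  | add p q hp hq => simp [hp, hq]
  | monomial m c =>
    have h1 : (monomial m c : MvPolynomial (Fin N) ℂ).IsWeightedHomogeneous a (Finsupp.weight a m) :=
      isWeightedHomogeneous_monomial a m c rfl
    have h2 : (φ (monomial m c)).IsWeightedHomogeneous a (Finsupp.weight a m) := by
      rw [monomial_eq, map_mul, ← algebraMap_eq, AlgHom.commutes, algebraMap_eq, Finsupp.prod,
        map_prod, Finsupp.weight_apply, Finsupp.sum]
      refine IsWeightedHomogeneous.C_mul ?_ _
      refine IsWeightedHomogeneous.prod _ _ _ fun i _ => ?_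
      rw [map_pow]
      exact (h i).pow _
    by_cases hd : d = Finsupp.weight a m
    · subst hd
      rw [h1.weightedHomogeneousComponent_same, h2.weightedHomogeneousComponent_same]
    · rw [h1.weightedHomogeneousComponent_ne _ hd, h2.weightedHomogeneousComponent_ne _ hd, map_zero]

lemma graded_X {n : ℕ} {a : Fin (n + 2) → ℕ}
    {φ : MvPolynomial (Fin (n + 2)) ℂ ≃ₐ[ℂ] MvPolynomial (Fin (n + 2)) ℂ}
    (h : IsGradedAut a φ) (i) : (φ (X i)).IsWeightedHomogeneous a (a i) :=
  (h _ _).mp (isWeightedHomogeneous_X ℂ a i)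

lemma isGraded_of_X {n : ℕ} {a : Fin (n + 2) → ℕ}
    {φ : MvPolynomial (Fin (n + 2)) ℂ ≃ₐ[ℂ] MvPolynomial (Fin (n + 2)) ℂ}
    (h : ∀ i, (φ (X i)).IsWeightedHomogeneous a (a i)) : IsGradedAut a φ := by
  intro d f
  have hc := wh_comp_hom a (φ : _ →ₐ[ℂ] _) h d f
  simp only [AlgEquiv.coe_toAlgHom] at hc
  constructor
  · intro hf
    rw [hf.weightedHomogeneousComponent_same] at hc
    rw [← hc]
    exact weightedHomogeneousComponent_isWeightedHomogeneous _ _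
  · intro hf
    rw [hf.weightedHomogeneousComponent_same] at hc
    rw [φ.injective hc]
    exact weightedHomogeneousComponent_isWeightedHomogeneous _ _

/-- coordinate change -/
lemma exists_coord {n : ℕ} (a : Fin (n + 2) → ℕ) (ha : ∀ i, 0 < a i)
    (y : Fin (n + 2) → MvPolynomial (Fin (n + 2)) ℂ)
    (hy : ∀ i, (y i).IsWeightedHomogeneous a (a i)) (hdet : (linPart y).det ≠ 0) :
    ∃ Φ : MvPolynomial (Fin (n + 2)) ℂ ≃ₐ[ℂ] MvPolynomial (Fin (n + 2)) ℂ,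
      IsGradedAut a Φ ∧ ∀ i, Φ (X i) = y i := by
  have hs := aeval_surj a ha y hy hdet
  have hi := noeth_inj (aeval y : _ →ₐ[ℂ] MvPolynomial (Fin (n + 2)) ℂ).toRingHom hs
  let Φ := AlgEquiv.ofBijective (aeval y : _ →ₐ[ℂ] MvPolynomial (Fin (n + 2)) ℂ) ⟨hi, hs⟩
  have h1 : ∀ i, Φ (X i) = y i := fun i => by
    show aeval y (X i) = _
    simp
  exact ⟨Φ, isGraded_of_X (fun i => by rw [h1]; exact hy i), h1⟩

lemma linPart_mul {n : ℕ} {a : Fin (n + 2) → ℕ} (ha : ∀ i, 0 < a i)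
    {φ ψ : MvPolynomial (Fin (n + 2)) ℂ ≃ₐ[ℂ] MvPolynomial (Fin (n + 2)) ℂ}
    (hφ : IsGradedAut a φ) :
    linPart (fun i => (φ * ψ) (X i)) = linPart (fun i => ψ (X i)) * linPart (fun i => φ (X i)) := by
  ext i j
  rw [Matrix.mul_apply]
  exact coeff_single_hom (φ : _ →ₐ[ℂ] _) (fun k => wh_constantCoeff (ha k) (graded_X hφ k)) (ψ (X i)) j

lemma linPart_X {N : ℕ} : linPart (fun i : Fin N => (X i : MvPolynomial (Fin N) ℂ)) = 1 := by
  classical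
  ext i j
  simp only [linPart, Matrix.of_apply, coeff_X, Matrix.one_apply]
  by_cases h : i = j
  · simp [h]
  · rw [if_neg, if_neg h]
    intro h'
    exact h (Finsupp.single_left_injective one_ne_zero h')

/-- the linear representation -/
def linRep {n : ℕ} {a : Fin (n + 2) → ℕ} (ha : ∀ i, 0 < a i) {G : Type} [Group G]
    (θ : G →* (MvPolynomial (Fin (n + 2)) ℂ ≃ₐ[ℂ] MvPolynomial (Fin (n + 2)) ℂ))
    (hθ : ∀ g, IsGradedAut a (θ g)) : G →* Matrix (Fin (n + 2)) (Fin (n + 2)) ℂ where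
  toFun g := (linPart (fun i => θ g (X i))).transpose
  map_one' := by
    simp only [map_one, AlgEquiv.one_apply, linPart_X, Matrix.transpose_one]
  map_mul' g h := by
    rw [map_mul, linPart_mul ha (hθ g), Matrix.transpose_mul]

lemma linRep_inj {n : ℕ} {a : Fin (n + 2) → ℕ} (ha : ∀ i, 0 < a i) {G : Type} [Group G] [Finite G]
    (θ : G →* (MvPolynomial (Fin (n + 2)) ℂ ≃ₐ[ℂ] MvPolynomial (Fin (n + 2)) ℂ))
    (hθ : ∀ g, IsGradedAut a (θ g)) (hinj : Function.Injective θ) :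
    Function.Injective (linRep ha θ hθ) := by
  classical
  rw [injective_iff_map_eq_one]
  intro g hg
  apply hinj
  rw [map_one]
  set k := orderOf g with hk
  have hkpos : 0 < k := orderOf_pos g
  let y : Fin (n + 2) → MvPolynomial (Fin (n + 2)) ℂ := fun i => ∑ l ∈ Finset.range k, θ (g ^ l) (X i)
  have hy : ∀ i, (y i).IsWeightedHomogeneous a (a i) := fun i =>
    IsWeightedHomogeneous.sum _ _ _ fun l _ => graded_X (hθ _) i
  have hlin : linPart y = (k : ℂ) • (1 : Matrix (Fin (n + 2)) (Fin (n + 2)) ℂ) := by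
    have h1 : ∀ l, linPart (fun i => θ (g ^ l) (X i)) = 1 := by
      intro l
      have : linRep ha θ hθ (g ^ l) = 1 := by rw [map_pow, hg, one_pow]
      have := congrArg Matrix.transpose this
      simpa [linRep] using this
    ext i j
    have h2 : linPart y i j = ∑ l ∈ Finset.range k, linPart (fun i => θ (g ^ l) (X i)) i j := by
      simp [linPart, y, coeff_sum]
    rw [h2, Finset.sum_congr rfl (fun l _ => by rw [h1 l]), Finset.sum_const, Finset.card_range,
      nsmul_eq_mul, Matrix.smul_apply, smul_eq_mul]
  have hdet : (linPart y).det ≠ 0 := by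
    rw [hlin, Matrix.det_smul, Matrix.det_one, mul_one]
    exact pow_ne_zero _ (by exact_mod_cast hkpos.ne')
  have hgy : ∀ i, θ g (y i) = y i := by
    intro i
    simp only [y, map_sum]
    have h1 : ∀ l, θ g (θ (g ^ l) (X i)) = θ (g ^ (l + 1)) (X i) := fun l => by
      rw [pow_succ', map_mul, AlgEquiv.mul_apply]
    simp only [h1]
    have h2 := Finset.sum_range_succ (fun l => θ (g ^ l) (X i)) k
    have h3 := Finset.sum_range_succ' (fun l => θ (g ^ l) (X i)) k
    rw [h2, hk, pow_orderOf_eq_one, pow_zero] at h3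
    exact (add_right_cancel h3).symm
  have hs := aeval_surj a ha y hy hdet
  have hcomp : ((θ g : _ →ₐ[ℂ] _) : MvPolynomial (Fin (n + 2)) ℂ →ₐ[ℂ] _).comp (aeval y) = aeval y := by
    apply MvPolynomial.algHom_ext
    intro i
    simpa using hgy i
  ext1 p
  obtain ⟨q, rfl⟩ := hs p
  exact DFunLike.congr_fun hcomp q

lemma exists_eig_coords {n : ℕ} {a : Fin (n + 2) → ℕ} {H : Type} [CommGroup H]
    [Finite H] (θ : H →* (MvPolynomial (Fin (n + 2)) ℂ ≃ₐ[ℂ] MvPolynomial (Fin (n + 2)) ℂ))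
    (hθ : ∀ g, IsGradedAut a (θ g)) :
    ∃ (y : Fin (n + 2) → MvPolynomial (Fin (n + 2)) ℂ) (χ : Fin (n + 2) → (H →* ℂˣ)),
      (∀ i, (y i).IsWeightedHomogeneous a (a i)) ∧ (linPart y).det ≠ 0 ∧
      ∀ h i, θ h (y i) = ((χ i h : ℂˣ) : ℂ) • y i := by
  classical
  let _ : Fintype H := Fintype.ofFinite H
  have : Finite (H →* ℂˣ) := Nat.finite_of_card_ne_zero (by
    rw [CommGroup.card_monoidHom_of_hasEnoughRootsOfUnity H ℂ]; exact Nat.card_pos.ne')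
  let _ : Fintype (H →* ℂˣ) := Fintype.ofFinite _
  let tol : (MvPolynomial (Fin (n + 2)) ℂ ≃ₐ[ℂ] MvPolynomial (Fin (n + 2)) ℂ) →*
      Module.End ℂ (MvPolynomial (Fin (n + 2)) ℂ) :=
    { toFun := fun T => T.toLinearMap, map_one' := rfl, map_mul' := fun _ _ => rfl }
  let ρ := tol.comp θ
  have hρ : ∀ h p, ρ h p = θ h p := fun _ _ => rfl
  let e : Fin (n + 2) → (H →* ℂˣ) → MvPolynomial (Fin (n + 2)) ℂ := fun i χ => eigProj ρ χ (X i)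
  have hsum : ∀ i, ∑ χ, e i χ = X i := fun i => eigProj_sum ρ (X i)
  have hwh : ∀ i χ, (e i χ).IsWeightedHomogeneous a (a i) := by
    intro i χ
    simp only [e, eigProj]
    rw [smul_eq_C_mul]
    refine IsWeightedHomogeneous.C_mul (IsWeightedHomogeneous.sum _ _ _ fun h _ => ?_) _
    rw [smul_eq_C_mul]
    exact (graded_X (hθ h) i).C_mul _
  have hdet : ∑ r : Fin (n + 2) → (H →* ℂˣ), (linPart fun i => e i (r i)).det ≠ 0 := by
    have h1 := (Matrix.detRowAlternating (n := Fin (n + 2)) (R := ℂ)).toMultilinearMap.map_sum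
      (fun i χ => fun j => coeff (Finsupp.single j 1) (e i χ))
    have h2 : (fun i => ∑ χ, (fun j => coeff (Finsupp.single j 1) (e i χ)) : Fin (n + 2) → Fin (n + 2) → ℂ)
        = (1 : Matrix (Fin (n + 2)) (Fin (n + 2)) ℂ) := by
      rw [← linPart_X]
      funext i j
      rw [Finset.sum_apply, ← coeff_sum, hsum]; rfl
    rw [h2] at h1
    have h3 : (1 : Matrix (Fin (n + 2)) (Fin (n + 2)) ℂ).det =
      ∑ r : Fin (n + 2) → (H →* ℂˣ), (linPart fun i => e i (r i)).det := h1
    rw [← h3, Matrix.det_one]; exact one_ne_zero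
  obtain ⟨r, -, hr⟩ := Finset.exists_ne_zero_of_sum_ne_zero hdet
  exact ⟨fun i => e i (r i), r, fun i => hwh i _, hr, fun h i => eigProj_eig ρ (r i) (X i) h⟩

/-- diagonal automorphism -/
def diagAut {N : ℕ} (t : Fin N → ℂˣ) : MvPolynomial (Fin N) ℂ ≃ₐ[ℂ] MvPolynomial (Fin N) ℂ :=
  AlgEquiv.ofAlgHom (aeval fun i => ((t i : ℂˣ) : ℂ) • X i) (aeval fun i => (((t i)⁻¹ : ℂˣ) : ℂ) • X i)
    (by apply MvPolynomial.algHom_ext; intro i; simp [smul_smul])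
    (by apply MvPolynomial.algHom_ext; intro i; simp [smul_smul])

lemma diagAut_X {N : ℕ} (t : Fin N → ℂˣ) (i : Fin N) :
    diagAut t (X i) = ((t i : ℂˣ) : ℂ) • X i := by
  show aeval _ (X i) = _
  simp

lemma diagAut_coeff {N : ℕ} (t : Fin N → ℂˣ) (p : MvPolynomial (Fin N) ℂ) (m : Fin N →₀ ℕ) :
    coeff m (diagAut t p) = ((∏ i, t i ^ m i : ℂˣ) : ℂ) * coeff m p := by
  classical
  induction p using MvPolynomial.induction_on' with
  | add p q hp hq => simp [hp, hq, mul_add]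
  | monomial m' c =>
    have h1 : diagAut t (monomial m' c) = ((∏ i, t i ^ m' i : ℂˣ) : ℂ) • monomial m' c := by
      rw [monomial_eq, Finsupp.prod_fintype _ _ (by simp), map_mul, map_prod]
      simp only [map_pow, diagAut_X, smul_pow, smul_eq_C_mul, Finset.prod_mul_distrib,
        Units.coe_prod, Units.val_pow_eq_pow_val, map_prod]
      have : diagAut t (C c) = C c := by
        rw [← algebraMap_eq, AlgEquiv.commutes]
      rw [this]
      simp only [mul_pow, Finset.prod_mul_distrib, ← map_pow, ← map_prod]
      ring
    rw [h1, coeff_smul, smul_eq_mul, coeff_monomial]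
    by_cases h : m' = m
    · subst h; rfl
    · simp [h]

lemma diagAut_inj {N : ℕ} : Function.Injective (diagAut (N := N)) := by
  intro t s h
  funext i
  have h1 := congrArg (fun φ => φ (X i)) h
  simp only [diagAut_X] at h1
  have := congrArg (coeff (Finsupp.single i 1)) h1
  simp only [coeff_smul, coeff_X] at this
  simpa [Units.ext_iff] using this

lemma diagAut_fix {N : ℕ} (t : Fin N → ℂˣ) (p : MvPolynomial (Fin N) ℂ) :
    diagAut t p = p ↔ ∀ m ∈ (p.support : Set (Fin N →₀ ℕ)), ∏ i, t i ^ m i = 1 := by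
  constructor
  · intro h m hm
    have h1 := diagAut_coeff t p m
    rw [h] at h1
    have hm' : coeff m p ≠ 0 := mem_support_iff.mp hm
    have h2 := mul_right_cancel₀ hm' ((one_mul _).trans h1)
    exact Units.ext h2.symm
  · intro h
    ext m
    rw [diagAut_coeff]
    by_cases hm : coeff m p = 0
    · rw [hm, mul_zero]
    · rw [h m (mem_support_iff.mpr hm)]; simp

lemma diagAut_graded {n : ℕ} (a : Fin (n + 2) → ℕ) (t : Fin (n + 2) → ℂˣ) :
    IsGradedAut a (diagAut t) :=
  isGraded_of_X fun i => by
    rw [diagAut_X, smul_eq_C_mul]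
    exact (isWeightedHomogeneous_X ℂ a i).C_mul _

/-- exact stabilizer of `f`. -/
def stab {n : ℕ} (a : Fin (n + 2) → ℕ) (f : MvPolynomial (Fin (n + 2)) ℂ) :
    Subgroup (MvPolynomial (Fin (n + 2)) ℂ ≃ₐ[ℂ] MvPolynomial (Fin (n + 2)) ℂ) where
  carrier := {φ | IsGradedAut a φ ∧ φ f = f}
  one_mem' := ⟨IsGradedAut.one a, rfl⟩
  mul_mem' := by
    rintro φ ψ ⟨hφ, h1⟩ ⟨hψ, h2⟩
    exact ⟨hφ.mul hψ, by rw [AlgEquiv.mul_apply, h2, h1]⟩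
  inv_mem' := by
    rintro φ ⟨hφ, h1⟩
    refine ⟨hφ.inv, ?_⟩
    show φ.symm f = f
    rw [AlgEquiv.symm_apply_eq, h1]

lemma abelian_bound {n : ℕ} {a : Fin (n + 2) → ℕ} (ha : ∀ i, 0 < a i) {d : ℕ}
    {f : MvPolynomial (Fin (n + 2)) ℂ} (hf : f.IsWeightedHomogeneous a d) [Finite (stab a f)]
    {H : Type} [CommGroup H] (θ : H →* stab a f) (hinj : Function.Injective θ) :
    Nat.card H * ∏ i, a i ≤ d ^ (n + 2) := by
  classical
  have : Finite H := Finite.of_injective θ hinj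
  let θ' := (stab a f).subtype.comp θ
  have hθ' : ∀ h, IsGradedAut a (θ' h) := fun h => (θ h).2.1
  obtain ⟨y, χ, hy, hdet, heig⟩ := exists_eig_coords θ' hθ'
  obtain ⟨Φ, hΦ, hΦX⟩ := exists_coord a ha y hy hdet
  set f' := Φ⁻¹ f with hf'
  have hΦf' : Φ f' = f := Φ.apply_symm_apply f
  have hf'h : f'.IsWeightedHomogeneous a d := (hΦ.inv d f).mp hf
  let T : Set (Fin (n + 2) → ℂˣ) :=
    {t | ∀ m ∈ (f'.support : Set (Fin (n + 2) →₀ ℕ)), ∏ i, t i ^ m i = 1}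
  have hTfin : T.Finite := by
    let F : T → stab a f := fun t => ⟨Φ * diagAut t.1 * Φ⁻¹,
      (hΦ.mul (diagAut_graded a t.1)).mul hΦ.inv, by
        rw [AlgEquiv.mul_apply, AlgEquiv.mul_apply, ← hf', (diagAut_fix t.1 f').mpr t.2, hΦf']⟩
    have hF : Function.Injective F := by
      intro t s hts
      have h1 : Φ * diagAut t.1 * Φ⁻¹ = Φ * diagAut s.1 * Φ⁻¹ := congrArg Subtype.val hts
      exact Subtype.ext (diagAut_inj (mul_left_cancel (mul_right_cancel h1)))
    have hft : Finite T := Finite.of_injective F hF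
    exact Set.toFinite T
  have hT := torus_bound (f'.support : Set (Fin (n + 2) →₀ ℕ)) a d (by
    intro m hm
    have := hf'h (mem_support_iff.mp hm)
    rw [Finsupp.weight_apply, Finsupp.sum_fintype _ _ (by simp)] at this
    simpa using this) hTfin
  have hconj : ∀ h, θ' h * Φ = Φ * diagAut (fun i => χ i h) := by
    intro h
    apply AlgEquiv.coe_toAlgHom_injective
    apply MvPolynomial.algHom_ext
    intro i
    show θ' h (Φ (X i)) = Φ (diagAut _ (X i))
    rw [hΦX, diagAut_X, map_smul, hΦX, heig]
  have hmem : ∀ h, (fun i => χ i h) ∈ T := by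
    intro h
    apply (diagAut_fix _ f').mp
    apply Φ.injective
    have := DFunLike.congr_fun (hconj h) f'
    rw [AlgEquiv.mul_apply, AlgEquiv.mul_apply, hΦf'] at this
    rw [← this, hΦf']
    exact (θ h).2.2
  have : Finite T := hTfin
  have hle : Nat.card H ≤ Nat.card T := by
    refine Nat.card_le_card_of_injective (fun h => (⟨_, hmem h⟩ : T)) ?_
    intro g h hgh
    have h1 : (fun i => χ i g) = (fun i => χ i h) := congrArg Subtype.val hgh
    have h2 : θ' g * Φ = θ' h * Φ := by rw [hconj, hconj, h1]
    exact hinj (Subtype.ext (mul_right_cancel h2))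
  exact (Nat.mul_le_mul_right _ hle).trans hT

lemma stab_bound (n : ℕ) : ∃ J : ℕ, ∀ (a : Fin (n + 2) → ℕ), (∀ i, 0 < a i) → ∀ (d : ℕ)
    (f : MvPolynomial (Fin (n + 2)) ℂ), f.IsWeightedHomogeneous a d → Finite (stab a f) →
      Nat.card (stab a f) * ∏ i, a i ≤ J * d ^ (n + 2) := by
  obtain ⟨J, hJ⟩ := jordan_matrix (n + 2)
  refine ⟨J, fun a ha d f hf hfin => ?_⟩
  obtain ⟨A, hcomm, hidx⟩ := hJ (stab a f)
    (linRep ha (stab a f).subtype (fun g => g.2.1))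
    (linRep_inj ha _ _ Subtype.val_injective)
  let _ : CommGroup A := { (inferInstance : Group A) with
    mul_comm := fun x y => Subtype.ext (hcomm x x.2 y y.2) }
  have h1 := abelian_bound ha hf A.subtype Subtype.val_injective
  rw [← A.card_mul_index]
  calc Nat.card A * A.index * ∏ i, a i = A.index * (Nat.card A * ∏ i, a i) := by ring
    _ ≤ J * d ^ (n + 2) := Nat.mul_le_mul hidx h1

lemma pow_gcd_one {N : ℕ} (a : Fin N → ℕ) (s : Finset (Fin N)) (hs : s.gcd a = 1) {t : ℂˣ}
    (ht : ∀ i ∈ s, t ^ a i = 1) : t = 1 := by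
  have h : orderOf t ∣ s.gcd a := Finset.dvd_gcd fun i hi => orderOf_dvd_of_pow_eq_one (ht i hi)
  rw [hs] at h
  exact orderOf_eq_one_iff.mp (Nat.dvd_one.mp h)

/-- the scalar automorphism with parameter `t` -/
def scal {n : ℕ} (a : Fin (n + 2) → ℕ) (t : ℂˣ) :
    MvPolynomial (Fin (n + 2)) ℂ ≃ₐ[ℂ] MvPolynomial (Fin (n + 2)) ℂ :=
  diagAut fun i => t ^ a i

lemma scal_mem {n : ℕ} (a : Fin (n + 2) → ℕ) (t : ℂˣ) : scal a t ∈ diagSubgroup a :=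
  ⟨t, fun i => by rw [scal, diagAut_X, Units.val_pow_eq_pow_val]⟩

lemma mem_diag {n : ℕ} {a : Fin (n + 2) → ℕ}
    {φ : MvPolynomial (Fin (n + 2)) ℂ ≃ₐ[ℂ] MvPolynomial (Fin (n + 2)) ℂ}
    (h : φ ∈ diagSubgroup a) : ∃ t, φ = scal a t := by
  obtain ⟨t, ht⟩ := h
  refine ⟨t, ?_⟩
  apply AlgEquiv.coe_toAlgHom_injective
  apply MvPolynomial.algHom_ext
  intro i
  show φ (X i) = scal a t (X i)
  rw [ht, scal, diagAut_X, Units.val_pow_eq_pow_val]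

lemma scal_inj {n : ℕ} {a : Fin (n + 2) → ℕ} (hw : WellFormed a) :
    Function.Injective (scal a) := by
  intro t s h
  have h1 := diagAut_inj h
  rw [← div_eq_one]
  refine pow_gcd_one a _ (hw 0) fun i _ => ?_
  rw [div_pow, div_eq_one]
  exact congrFun h1 i

lemma scal_apply {n : ℕ} {a : Fin (n + 2) → ℕ} {d : ℕ} {f : MvPolynomial (Fin (n + 2)) ℂ}
    (hf : f.IsWeightedHomogeneous a d) (t : ℂˣ) : scal a t f = ((t ^ d : ℂˣ) : ℂ) • f := by
  ext m
  rw [scal, diagAut_coeff, coeff_smul, smul_eq_mul]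
  by_cases hm : coeff m f = 0
  · rw [hm, mul_zero, mul_zero]
  · have h := hf hm
    rw [Finsupp.weight_apply, Finsupp.sum_fintype _ _ (by simp)] at h
    rw [← h]
    simp only [← pow_mul, Finset.prod_pow_eq_pow_sum, smul_eq_mul, mul_comm]

lemma lin_card {n : ℕ} {a : Fin (n + 2) → ℕ} (hw : WellFormed a) {d : ℕ} (hd : d ≠ 0)
    {f : MvPolynomial (Fin (n + 2)) ℂ} (hf0 : f ≠ 0) (hf : f.IsWeightedHomogeneous a d)
    (hfin : Finite (linGroup a f ⧸ (diagSubgroup a).subgroupOf (linGroup a f))) :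
    Finite (stab a f) ∧ Nat.card (stab a f) =
      Nat.card (linGroup a f ⧸ (diagSubgroup a).subgroupOf (linGroup a f)) * d := by
  classical
  have : NeZero d := ⟨hd⟩
  have hsl : ∀ φ, φ ∈ stab a f → φ ∈ linGroup a f := fun φ h =>
    ⟨h.1, 1, by rw [h.2]; simp⟩
  have hrep : ∀ q : linGroup a f ⧸ (diagSubgroup a).subgroupOf (linGroup a f),
      ∃ r : stab a f, QuotientGroup.mk (⟨r.1, hsl _ r.2⟩ : linGroup a f) = q := by
    intro q
    obtain ⟨⟨φ, hφ, c, hc⟩, rfl⟩ := QuotientGroup.mk_surjective q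
    obtain ⟨z, hz⟩ := IsAlgClosed.exists_pow_nat_eq ((c⁻¹ : ℂˣ) : ℂ) (Nat.pos_of_ne_zero hd)
    have hz0 : z ≠ 0 := by
      rintro rfl
      rw [zero_pow hd] at hz
      exact (c⁻¹).ne_zero hz.symm
    have ht : (Units.mk0 z hz0) ^ d = c⁻¹ := Units.ext (by simpa using hz)
    refine ⟨⟨φ * scal a (Units.mk0 z hz0), hφ.mul (diagAut_graded a _), ?_⟩, ?_⟩
    · rw [AlgEquiv.mul_apply, scal_apply hf, ht, map_smul, hc, smul_smul]
      simp
    · rw [eq_comm, QuotientGroup.eq, Subgroup.mem_subgroupOf]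
      show φ⁻¹ * (φ * _) ∈ _
      rw [inv_mul_cancel_left]
      exact scal_mem a _
  choose r hr using hrep
  have hst : ∀ t : ℂˣ, scal a t ∈ stab a f ↔ t ^ d = 1 := by
    intro t
    constructor
    · intro h
      have h1 := h.2
      rw [scal_apply hf] at h1
      have h2 : (((t ^ d : ℂˣ) : ℂ) - 1) • f = 0 := by rw [sub_smul, one_smul, h1, sub_self]
      rcases smul_eq_zero.mp h2 with h3 | h3
      · exact Units.ext (sub_eq_zero.mp h3)
      · exact absurd h3 hf0
    · intro h
      exact ⟨diagAut_graded a _, by rw [scal_apply hf, h]; simp⟩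
  let Ψ : (linGroup a f ⧸ (diagSubgroup a).subgroupOf (linGroup a f)) × rootsOfUnity d ℂ →
      stab a f := fun p => r p.1 * ⟨scal a p.2.1, (hst _).mpr p.2.2⟩
  have hΨ : Function.Bijective Ψ := by
    constructor
    · rintro ⟨q, z⟩ ⟨q', z'⟩ h
      have h0 : (r q).1 * scal a z.1 = (r q').1 * scal a z'.1 := congrArg Subtype.val h
      have hq : q = q' := by
        rw [← hr q, ← hr q', QuotientGroup.eq, Subgroup.mem_subgroupOf]
        show (r q).1⁻¹ * (r q').1 ∈ _
        have : (r q).1⁻¹ * (r q').1 = scal a z.1 * (scal a z'.1)⁻¹ := by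
          rw [inv_mul_eq_iff_eq_mul, ← mul_assoc, h0, mul_inv_cancel_right]
        rw [this]
        exact mul_mem (scal_mem a _) (inv_mem (scal_mem a _))
      subst hq
      have hz := scal_inj hw (mul_left_cancel h0)
      rw [Subtype.ext hz]
    · intro φ
      let q : linGroup a f ⧸ (diagSubgroup a).subgroupOf (linGroup a f) :=
        QuotientGroup.mk ⟨φ.1, hsl _ φ.2⟩
      have h1 := hr q
      rw [QuotientGroup.eq, Subgroup.mem_subgroupOf] at h1
      obtain ⟨t, ht⟩ := mem_diag h1
      have ht' : (r q).1⁻¹ * φ.1 = scal a t := ht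
      have h2 : scal a t ∈ stab a f := by
        rw [← ht']
        exact mul_mem (inv_mem (r q).2) φ.2
      refine ⟨⟨q, ⟨t, (hst t).mp h2⟩⟩, Subtype.ext ?_⟩
      show (r q).1 * scal a t = φ.1
      rw [← ht', mul_inv_cancel_left]
  refine ⟨Finite.of_surjective Ψ hΨ.2, ?_⟩
  rw [← Nat.card_congr (Equiv.ofBijective Ψ hΨ), Nat.card_prod]
  congr 1
  exact Complex.card_rootsOfUnity d

lemma lin_infinite {n : ℕ} {a : Fin (n + 2) → ℕ} (ha : ∀ i, 0 < a i) (hw : WellFormed a)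
    {f : MvPolynomial (Fin (n + 2)) ℂ} (hf : f.IsWeightedHomogeneous a 0)
    (hfin : Finite (linGroup a f ⧸ (diagSubgroup a).subgroupOf (linGroup a f))) : False := by
  classical
  have hfix : ∀ t : Fin (n + 2) → ℂˣ, diagAut t f = f := by
    intro t
    rw [diagAut_fix]
    intro m hm
    have h := hf (mem_support_iff.mp hm)
    rw [Finsupp.weight_apply, Finsupp.sum_fintype _ _ (by simp), Finset.sum_eq_zero_iff] at h
    refine Finset.prod_eq_one fun i hi => ?_
    have h2 := h i hi
    rw [smul_eq_mul, mul_eq_zero] at h2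
    rw [h2.resolve_right (ha i).ne', pow_zero]
  let g : ℂˣ → Fin (n + 2) → ℂˣ := fun s => Function.update 1 0 s
  let F : ℂˣ → linGroup a f ⧸ (diagSubgroup a).subgroupOf (linGroup a f) := fun s =>
    QuotientGroup.mk ⟨diagAut (g s), diagAut_graded a _, 1, by rw [hfix]; simp⟩
  have hF : Function.Injective F := by
    intro s s' h
    rw [QuotientGroup.eq, Subgroup.mem_subgroupOf] at h
    obtain ⟨t, ht⟩ := mem_diag h
    have ht' : (diagAut (g s))⁻¹ * diagAut (g s') = scal a t := ht
    rw [inv_mul_eq_iff_eq_mul] at ht'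
    have h3 : diagAut (g s') = diagAut (fun i => g s i * t ^ a i) := by
      rw [ht']
      apply AlgEquiv.coe_toAlgHom_injective
      apply MvPolynomial.algHom_ext
      intro i
      show diagAut (g s) (scal a t (X i)) = diagAut _ (X i)
      rw [scal, diagAut_X, map_smul, diagAut_X, diagAut_X, smul_smul, mul_comm, Units.val_mul]
    have h4 := diagAut_inj h3
    have ht1 : t = 1 := by
      refine pow_gcd_one a _ (hw 0) fun i hi => ?_
      have h5 := congrFun h4 i
      have hi0 : i ≠ 0 := Finset.ne_of_mem_erase hi
      simpa [g, Function.update_of_ne hi0] using h5.symm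
    have h6 := congrFun h4 0
    simpa [g, ht1] using h6.symm
  have h1 : Finite ℂˣ := Finite.of_injective F hF
  have h2 : Infinite ℂˣ := by
    refine Infinite.of_injective (fun k : ℕ => (Units.mk0 (2 : ℂ) two_ne_zero) ^ k) ?_
    intro k l h
    have h3 := congrArg (fun u : ℂˣ => (u : ℂ)) h
    simp only [Units.val_pow_eq_pow_val, Units.val_mk0] at h3
    exact Nat.pow_right_injective le_rfl (by exact_mod_cast h3)
  exact not_finite ℂˣ

/-- For every positive integer `n` there is a constant `C_n`, depending only
on `n`, such that every well-formed quasismooth weighted projective hypersurface of dimension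
`n` and degree `d` with finite linear automorphism group satisfies
`|Lin(X)| ≤ C_n · d^{n+1}/(a_0⋯a_{n+1})`. -/
theorem lin_uniform_bound (n : ℕ) (hn : 1 ≤ n) :
    ∃ C : ℝ, 0 < C ∧
      ∀ (a : Fin (n + 2) → ℕ), (∀ i, 0 < a i) → WellFormed a →
        ∀ (d : ℕ) (f : MvPolynomial (Fin (n + 2)) ℂ), f ≠ 0 →
          f.IsWeightedHomogeneous a d → Quasismooth f →
          Finite (linGroup a f ⧸ (diagSubgroup a).subgroupOf (linGroup a f)) →
          (Nat.card (linGroup a f ⧸ (diagSubgroup a).subgroupOf (linGroup a f)) : ℝ)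
            ≤ C * (d : ℝ) ^ (n + 1) / ∏ i, (a i : ℝ) := by
  obtain ⟨J, hJ⟩ := stab_bound n
  refine ⟨(J : ℝ) + 1, by positivity, fun a ha hw d f hf0 hf _ hfin => ?_⟩
  rcases Nat.eq_zero_or_pos d with rfl | hd
  · exact (lin_infinite ha hw hf hfin).elim
  obtain ⟨h1, h2⟩ := lin_card hw hd.ne' hf0 hf hfin
  have h3 := hJ a ha d f hf h1
  rw [h2] at h3
  have hprod : (0 : ℝ) < ∏ i, (a i : ℝ) :=
    Finset.prod_pos fun i _ => by exact_mod_cast ha i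
  rw [le_div_iff₀ hprod]
  have h4 : Nat.card (linGroup a f ⧸ (diagSubgroup a).subgroupOf (linGroup a f)) * ∏ i, a i
      ≤ J * d ^ (n + 1) := by
    refine le_of_mul_le_mul_left (a := d) ?_ hd
    calc _ = _ := by ring
      _ ≤ _ := h3
      _ = _ := by ring
  have h5 : (Nat.card (linGroup a f ⧸ (diagSubgroup a).subgroupOf (linGroup a f)) : ℝ) *
      ∏ i, (a i : ℝ) ≤ J * (d : ℝ) ^ (n + 1) := by exact_mod_cast h4
  refine h5.trans ?_
  gcongr
  linarith

end
end

section
/- Suppose n ≥ 1, d ≥ 5·max{a_0,…,a_{n+1}}, the weighted projective space ℙ(a_0,…,a_{n+1}) is well-formed, and there exists at least one quasismooth weighted-homogeneous polynomial of degree d in S. Then there exists a countable family of proper Zariski-closed subsets of the finite-dimensional vector space S_d of weighted-homogeneous polynomials of degree d such that for every f ∈ S_d outside the union of this family: f is quasismooth, and every graded automorphism φ ∈ Aut(S) with φ(f) = c·f for some c ∈ ℂ^× lies in the center of Aut(S); in particular, the linear automorphism group Lin(X) = G_f/Δ is abelian. -/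
open MvPolynomial

noncomputable section

set_option linter.unusedSectionVars false
noncomputable section

section Comb
variable {σ : Type*} [Fintype σ] [DecidableEq σ]

/-- finset of monomials of weight `e` -/
def mons (a : σ → ℕ) (ha : ∀ i, 0 < a i) (e : ℕ) : Finset (σ →₀ ℕ) :=
  (Finsupp.finite_of_nat_weight_eq a (fun i => (ha i).ne') e).toFinset

lemma mem_mons {a : σ → ℕ} {ha : ∀ i, 0 < a i} {e : ℕ} {m : σ →₀ ℕ} :
    m ∈ mons a ha e ↔ Finsupp.weight a m = e := by
  simp [mons]

lemma wt_single (a : σ → ℕ) (i : σ) (k : ℕ) :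
    Finsupp.weight a (Finsupp.single i k) = k * a i := by
  simp [Finsupp.weight_single]

lemma wt_ge (a : σ → ℕ) (m : σ →₀ ℕ) (i : σ) : m i * a i ≤ Finsupp.weight a m := by
  rw [Finsupp.weight_eq_sum]
  exact Finset.single_le_sum (f := fun i => m i • a i) (fun _ _ => Nat.zero_le _) (Finset.mem_univ i)

lemma wt_ge2 (a : σ → ℕ) (m : σ →₀ ℕ) (i j : σ) (h : i ≠ j) :
    m i * a i + m j * a j ≤ Finsupp.weight a m := by
  rw [Finsupp.weight_eq_sum]
  have := Finset.sum_le_sum_of_subset (f := fun i => m i • a i) (Finset.subset_univ {i, j})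
  rw [Finset.sum_pair h] at this
  exact this

/-- a monomial of weight `a i` containing `x i` is `x i` -/
lemma eq_single_of_wt {a : σ → ℕ} (ha : ∀ i, 0 < a i) {m : σ →₀ ℕ} {i : σ}
    (hw : Finsupp.weight a m = a i) (hi : m i ≠ 0) : m = Finsupp.single i 1 := by
  have h1 : m i = 1 := by
    have := wt_ge a m i
    rw [hw] at this
    have := Nat.le_of_mul_le_mul_right (this.trans_eq (one_mul (a i)).symm) (ha i)
    omega
  ext j
  by_cases hj : i = j
  · subst hj; simpa using h1
  · have := wt_ge2 a m i j hj
    rw [hw, h1] at this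
    have hz : m j * a j = 0 := by omega
    have := ha j
    rw [Finsupp.single_eq_of_ne' hj]
    rcases Nat.mul_eq_zero.mp hz with h | h <;> omega

/-- the combinatorial data -/
structure QData (a : σ → ℕ) (d : ℕ) (k : σ → ℕ) (Q : σ → σ →₀ ℕ) : Prop where
  ha : ∀ i, 0 < a i
  hd : ∀ i, 5 * a i ≤ d
  hQ : ∀ i, Q i = 0 ∨ ∃ j, j ≠ i ∧ Q i = Finsupp.single j 1
  hw : ∀ i, k i * a i + Finsupp.weight a (Q i) = d

variable {a : σ → ℕ} {d : ℕ} {k : σ → ℕ} {Q : σ → σ →₀ ℕ}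

lemma QData.hQ5 (h : QData a d k Q) (i : σ) : 5 * Finsupp.weight a (Q i) ≤ d := by
  rcases h.hQ i with h0 | ⟨j, _, h0⟩
  · simp [h0]
  · rw [h0, wt_single]; have := h.hd j; omega

lemma QData.k4 (h : QData a d k Q) (i : σ) : 4 ≤ k i := by
  have h1 := h.hQ5 i
  have h2 := h.hw i
  have h3 := h.hd i
  have h4 := h.ha i
  by_contra hk
  have : k i * a i ≤ 3 * a i := Nat.mul_le_mul_right _ (by omega)
  omega

lemma QData.Qself (h : QData a d k Q) (i : σ) : Q i i = 0 := by
  rcases h.hQ i with h0 | ⟨j, hj, h0⟩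
  · simp [h0]
  · rw [h0]; simp [hj]

lemma QData.Qle (h : QData a d k Q) (i l : σ) : Q i l ≤ 1 := by
  rcases h.hQ i with h0 | ⟨j, hj, h0⟩
  · simp [h0]
  · rw [h0, Finsupp.single_apply]; split_ifs <;> simp

lemma QData.Qeq (h : QData a d k Q) {i l : σ} (hl : Q i l ≠ 0) : Q i = Finsupp.single l 1 := by
  rcases h.hQ i with h0 | ⟨j, hj, h0⟩
  · simp [h0] at hl
  · rw [h0, Finsupp.single_apply] at hl
    rw [h0]; congr 1; by_contra hne; simp [hne] at hl

/-- dominance: two different dominated variables cannot occur -/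
lemma QData.dom (h : QData a d k Q) {u : σ →₀ ℕ} (hu : Finsupp.weight a u = d) {i i' : σ}
    (h1 : k i - 1 ≤ u i) (h2 : k i' - 1 ≤ u i') : i = i' := by
  by_contra hne
  have := wt_ge2 a u i i' hne
  have e1 := Nat.mul_le_mul_right (a i) h1
  have e2 := Nat.mul_le_mul_right (a i') h2
  rw [Nat.sub_mul] at e1 e2
  have := h.hw i; have := h.hw i'; have := h.hQ5 i; have := h.hQ5 i'
  have := h.hd i; have := h.hd i'; have := h.ha i
  omega

/-- the map `(i,m) ↦ m * x_i^(k_i-1) * Q_i` -/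
def FF (k : σ → ℕ) (Q : σ → σ →₀ ℕ) (i : σ) (m : σ →₀ ℕ) : σ →₀ ℕ :=
  m + Finsupp.single i (k i - 1) + Q i

lemma QData.wFF (h : QData a d k Q) {i : σ} {m : σ →₀ ℕ} (hm : Finsupp.weight a m = a i) :
    Finsupp.weight a (FF k Q i m) = d := by
  have := h.hw i
  have h4 := h.k4 i
  rw [FF, map_add, map_add, wt_single, hm]
  obtain ⟨t, ht⟩ : ∃ t, k i = t + 1 := ⟨k i - 1, by omega⟩
  rw [ht] at this ⊢
  rw [add_mul] at this
  simp; omega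

lemma QData.FF_inj (h : QData a d k Q) {i i' : σ} {m m' : σ →₀ ℕ}
    (hm : Finsupp.weight a m = a i)
    (he : FF k Q i m = FF k Q i' m') : i = i' ∧ m = m' := by
  have hi : i = i' := by
    apply h.dom (h.wFF hm)
    · simp [FF]; omega
    · rw [he]; simp [FF]; omega
  subst hi
  refine ⟨rfl, ?_⟩
  simpa [FF] using he

/-- the character -/
def chi (lam : σ → ℂ) (m : σ →₀ ℕ) : ℂ := ∏ i, lam i ^ m i

lemma chi_add (lam : σ → ℂ) (m m' : σ →₀ ℕ) : chi lam (m + m') = chi lam m * chi lam m' := by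
  simp [chi, pow_add, Finset.prod_mul_distrib]

lemma chi_zero (lam : σ → ℂ) : chi lam 0 = 1 := by simp [chi]

lemma chi_single (lam : σ → ℂ) (i : σ) (k : ℕ) : chi lam (Finsupp.single i k) = lam i ^ k := by
  rw [chi, Finset.prod_eq_single i]
  · simp
  · intro j _ hj; rw [Finsupp.single_eq_of_ne hj]; simp
  · simp

lemma chi_nsmul (lam : σ → ℂ) (s : ℕ) (m : σ →₀ ℕ) : chi lam (s • m) = chi lam m ^ s := by
  simp only [chi, ← Finset.prod_pow]
  refine Finset.prod_congr rfl fun i _ => ?_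
  simp [← pow_mul, mul_comm]

lemma chi_ne {lam : σ → ℂ} (hl : ∀ i, lam i ≠ 0) (m : σ →₀ ℕ) : chi lam m ≠ 0 :=
  Finset.prod_ne_zero_iff.mpr fun i _ => pow_ne_zero _ (hl i)

lemma QData.extra (h : QData a d k Q) {lam : σ → ℂ} (hl : ∀ i, lam i ≠ 0) {c : ℂ}
    (hc : ∀ i, lam i ^ k i * chi lam (Q i) = c)
    {i : σ} {q : σ →₀ ℕ} (hq : Finsupp.weight a q = a i) (hne : chi lam q ≠ lam i) :
    ∃ u, Finsupp.weight a u = d ∧ chi lam u ≠ c ∧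
      ∀ i' m', Finsupp.weight a m' = a i' → u ≠ FF k Q i' m' := by
  by_cases hJ : ∃ i j, Q i = Finsupp.single j 1 ∧ a j = a i ∧ lam j ≠ lam i
  · obtain ⟨i, j, hQ, haj, hlj⟩ := hJ
    refine ⟨Finsupp.single i (k i + 1), ?_, ?_, ?_⟩
    · have := h.hw i
      rw [hQ, wt_single] at this
      rw [wt_single, add_mul]; omega
    · rw [chi_single, ← hc i, hQ, chi_single, pow_succ, pow_one]
      intro he
      exact hlj (mul_left_cancel₀ (pow_ne_zero _ (hl i)) he).symm
    · intro i' m' _ he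
      have hji : i ≠ j := by
        rintro rfl
        have := h.Qself i
        rw [hQ] at this; simp at this
      by_cases hi : i' = i
      · subst hi
        have := DFunLike.congr_fun he j
        simp [FF, hQ, Finsupp.single_eq_of_ne' hji] at this
      · have := DFunLike.congr_fun he i'
        have h4 := h.k4 i'
        simp [FF, Finsupp.single_eq_of_ne hi] at this
        omega
  push Not at hJ
  have hqi : q i = 0 := by
    by_contra hqi
    apply hne
    rw [eq_single_of_wt h.ha hq hqi, chi_single, pow_one]
  obtain ⟨s, hs2, hs3, hs⟩ : ∃ s, 2 ≤ s ∧ s ≤ 3 ∧ chi lam q ^ s ≠ lam i ^ s := by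
    by_cases h2 : chi lam q ^ 2 = lam i ^ 2
    · refine ⟨3, by omega, le_rfl, fun h3 => hne ?_⟩
      rw [pow_succ, pow_succ (lam i), h2] at h3
      exact mul_left_cancel₀ (pow_ne_zero _ (hl i)) h3
    · exact ⟨2, le_rfl, by omega, h2⟩
  have h4 := h.k4 i
  refine ⟨Finsupp.single i (k i - s) + s • q + Q i, ?_, ?_, ?_⟩
  · rw [map_add, map_add, wt_single, map_nsmul, hq, smul_eq_mul, ← add_mul,
      Nat.sub_add_cancel (by omega), h.hw i]
  · rw [chi_add, chi_add, chi_single, chi_nsmul, ← hc i]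
    intro he
    have he := mul_right_cancel₀ (chi_ne hl _) he
    have hk : k i = (k i - s) + s := by omega
    conv_rhs at he => rw [hk, pow_add]
    exact hs (mul_left_cancel₀ (pow_ne_zero _ (hl i)) he)
  · intro l m' hm' he
    have h4' := h.k4 l
    have hev : ∀ j, (Finsupp.single i (k i - s)) j + s * q j + Q i j =
        m' j + (Finsupp.single l (k l - 1)) j + Q l j := by
      intro j
      simpa [FF] using DFunLike.congr_fun he j
    by_cases hil : l = i
    · subst hil
      have := hev l
      simp [hqi] at this
      omega
    have hil' : i ≠ l := fun e => hil e.symm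
    have evi := hev i
    have evl := hev l
    simp only [Finsupp.single_eq_same, Finsupp.single_eq_of_ne hil, Finsupp.single_eq_of_ne hil',
      hqi, h.Qself] at evi evl
    have hql : q l ≠ 0 := by
      intro h0
      have := h.Qle i l
      rw [h0] at evl
      omega
    have hal : a l ≤ a i := by
      have := wt_ge a q l
      rw [hq] at this
      exact le_trans (Nat.le_mul_of_pos_left _ (by omega)) this
    -- consequences of `k i = 4`
    have hk4 : k i = 4 → ∃ j, Q i = Finsupp.single j 1 ∧ a j = a i ∧ d = 5 * a i := by
      intro hk
      have hwi := h.hw i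
      have hdi := h.hd i
      have hai := h.ha i
      rcases h.hQ i with h0 | ⟨j, hj, h0⟩
      · rw [hk, h0] at hwi; simp at hwi; omega
      · rw [hk, h0, wt_single] at hwi
        have := h.hd j
        exact ⟨j, h0, by omega, by omega⟩
    by_cases hmi : m' i = 0
    · have := h.Qle l i
      have hk : k i = 4 := by omega
      have hs' : s = 3 := by omega
      have hQl : Q l = Finsupp.single i 1 := h.Qeq (by omega)
      obtain ⟨j, hQi, haj, hd5⟩ := hk4 hk
      by_cases hae : a l = a i
      · have := hJ l i hQl hae.symm
        apply hne
        rw [eq_single_of_wt h.ha (hq.trans hae.symm) hql, chi_single, pow_one, this]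
      · have hQil : Q i l = 0 := by
          by_contra h0
          have h1 := h.Qeq h0
          rw [h1] at hQi
          have := Finsupp.single_left_injective one_ne_zero hQi
          subst this; exact hae haj
        have hwl := h.hw l
        rw [hQl, wt_single] at hwl
        have e1 := wt_ge a q l
        rw [hq] at e1
        have e2 : (k l - 1) * a l ≤ (3 * q l) * a l := Nat.mul_le_mul_right _ (by subst hs'; omega)
        rw [Nat.sub_mul, mul_assoc] at e2
        have := h.ha l
        omega
    · have hai : a i ≤ a l := by
        have := wt_ge a m' i
        rw [hm'] at this
        exact le_trans (Nat.le_mul_of_pos_left _ (by omega)) this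
      have hae : a l = a i := le_antisymm hal hai
      have hq1 := eq_single_of_wt h.ha (hq.trans hae.symm) hql
      have hm1 := eq_single_of_wt h.ha (hm'.trans hae) hmi
      have hll : lam l ≠ lam i := by
        intro e; apply hne; rw [hq1, chi_single, pow_one, e]
      have hQli : Q l i = 0 := by
        by_contra h0
        exact hll (hJ l i (h.Qeq h0) hae.symm).symm
      have hQil : Q i l = 0 := by
        by_contra h0
        exact hll (hJ i l (h.Qeq h0) hae)
      rw [hQli, hm1] at evi
      rw [hQil, hm1, hq1] at evl
      simp [Finsupp.single_eq_of_ne' hil'] at evi evl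
      have hs' : s = 3 := by omega
      have hk : k i = 4 := by omega
      obtain ⟨j, hQi, haj, hd5⟩ := hk4 hk
      have hkl : k l = 4 := by omega
      have hji : Q l = Q i := by
        ext x
        have := hev x
        rw [hm1, hq1, hs', hk, hkl] at this
        by_cases hxi : x = i
        · subst hxi; rw [h.Qself, hQli]
        · by_cases hxl : x = l
          · subst hxl; rw [h.Qself, hQil]
          · simp [Finsupp.single_eq_of_ne hxi, Finsupp.single_eq_of_ne hxl] at this
            exact this.symm
      have e1 := hJ i j hQi haj
      have e2 := hJ l j (hji.trans hQi) (haj.trans hae.symm)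
      exact hll (e2.symm.trans e1)

lemma QData.card_lt (h : QData a d k Q) {lam : σ → ℂ} (hl : ∀ i, lam i ≠ 0) {c : ℂ}
    (hc : ∀ i, lam i ^ k i * chi lam (Q i) = c)
    {i : σ} {q : σ →₀ ℕ} (hq : Finsupp.weight a q = a i) (hne : chi lam q ≠ lam i) :
    ∑ i, ((mons a h.ha (a i)).filter (fun m => chi lam m ≠ lam i)).card
      < ((mons a h.ha d).filter (fun m => chi lam m ≠ c)).card := by
  classical
  obtain ⟨u, hu, huc, hun⟩ := h.extra hl hc hq hne
  rw [← Finset.card_sigma]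
  set R := Finset.univ.sigma (fun i => (mons a h.ha (a i)).filter (fun m => chi lam m ≠ lam i))
    with hR
  have hRm : ∀ p ∈ R, Finsupp.weight a p.2 = a p.1 ∧ chi lam p.2 ≠ lam p.1 := by
    intro p hp
    simpa [hR, mem_mons] using hp
  have h1 : (R.image (fun p => FF k Q p.1 p.2)).card = R.card := by
    apply Finset.card_image_of_injOn
    rintro ⟨i, m⟩ hp ⟨i', m'⟩ hp' he
    obtain ⟨rfl, rfl⟩ := h.FF_inj (hRm _ hp).1 he
    rfl
  rw [← h1]
  apply Finset.card_lt_card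
  refine Finset.ssubset_iff_of_subset ?_ |>.mpr ⟨u, ?_, ?_⟩
  · intro v hv
    obtain ⟨p, hp, rfl⟩ := Finset.mem_image.mp hv
    obtain ⟨hp1, hp2⟩ := hRm p hp
    rw [Finset.mem_filter, mem_mons]
    refine ⟨h.wFF hp1, ?_⟩
    have h4 := h.k4 p.1
    rw [FF, chi_add, chi_add, chi_single, ← hc p.1]
    intro he
    have he := mul_right_cancel₀ (chi_ne hl _) he
    have hk : k p.1 = (k p.1 - 1) + 1 := by omega
    conv_rhs at he => rw [hk, pow_succ']
    exact hp2 (mul_right_cancel₀ (pow_ne_zero _ (hl _)) he)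
  · rw [Finset.mem_filter, mem_mons]; exact ⟨hu, huc⟩
  · intro hu'
    obtain ⟨p, hp, he⟩ := Finset.mem_image.mp hu'
    exact hun _ _ (hRm p hp).1 he.symm

end Comb
end

noncomputable section

section Lin

/-- echelon lemma -/
lemma echelon {K V ι : Type*} [Field K] [AddCommGroup V] [Module K V] [Fintype ι]
    (E : Submodule K V) [FiniteDimensional K E] (co : ι → Module.Dual K V)
    (hsep : ∀ v ∈ E, (∀ m, co m v = 0) → v = 0) :
    E ≤ Submodule.span K {v | v ∈ E ∧ ∃ Z : Finset ι, Module.finrank K E ≤ Z.card ∧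
      ∀ m ∈ Z, co m v = 0 ∨ co m v = 1} := by
  classical
  let cE : ι → Module.Dual K E := fun m => (co m).comp E.subtype
  have hspan : Submodule.span K (Set.range cE) = ⊤ := by
    by_contra hne
    obtain ⟨v, hv, hv0⟩ : ∃ v : E, v ≠ 0 ∧ ∀ m, cE m v = 0 := by
      have h1 : (Submodule.span K (Set.range cE)).dualCoannihilator ≠ ⊥ := by
        intro hb
        apply hne
        rw [← Subspace.dualCoannihilator_dualAnnihilator_eq (W := Submodule.span K (Set.range cE)),
          hb, Submodule.dualAnnihilator_bot]
      obtain ⟨v, hv, hv0⟩ := Submodule.exists_mem_ne_zero_of_ne_bot h1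
      refine ⟨v, hv0, fun m => ?_⟩
      rw [Submodule.mem_dualCoannihilator] at hv
      exact hv _ (Submodule.subset_span ⟨m, rfl⟩)
    apply hv
    exact Subtype.ext (hsep v v.2 hv0)
  obtain ⟨κ, f, hf, hsp, hli⟩ := exists_linearIndependent' K cE
  let b : Module.Basis κ K (Module.Dual K E) := Module.Basis.mk hli (by rw [hsp, hspan])
  have : Finite κ := Finite.of_injective f hf
  have := Fintype.ofFinite κ
  -- predual basis
  let b' : Module.Basis κ K E := b.dualBasis.map (Module.evalEquiv K E).symm
  have hb' : ∀ s t, cE (f t) (b' s) = if t = s then 1 else 0 := by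
    intro s t
    have h1 : cE (f t) = b t := by simp [b]
    rw [h1]
    have : (b t) (b' s) = Module.evalEquiv K E (b' s) (b t) := by simp
    rw [this]
    simp [b', Finsupp.single_apply]
  have hcard : Module.finrank K E = Fintype.card κ := Module.finrank_eq_card_basis b'
  intro v hv
  have hrep := b'.sum_repr ⟨v, hv⟩
  have hrep' : v = ∑ s, b'.repr ⟨v, hv⟩ s • (b' s : V) := by
    have := congrArg E.subtype hrep
    rw [map_sum] at this
    simpa only [map_smul, Submodule.subtype_apply] using this.symm
  rw [hrep']
  refine Submodule.sum_mem _ fun s _ => Submodule.smul_mem _ _ (Submodule.subset_span ?_)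
  refine ⟨(b' s).2, Finset.univ.image f, ?_, ?_⟩
  · rw [Finset.card_image_of_injective _ hf, hcard, Finset.card_univ]
  · intro m hm
    obtain ⟨t, _, rfl⟩ := Finset.mem_image.mp hm
    have := hb' s t
    by_cases hts : t = s
    · right; rw [if_pos hts] at this; exact this
    · left; rw [if_neg hts] at this; exact this

/-- selection of a basis from a spanning set -/
lemma select_basis {K V I : Type*} [Field K] [AddCommGroup V] [Module K V] [Fintype I]
    (p : V →ₗ[K] (I → K)) (s : Set V) (hs : Submodule.map p (Submodule.span K s) = ⊤) :
    ∃ y : I → V, (∀ i, y i ∈ s) ∧ Submodule.span K (Set.range (p ∘ y)) = ⊤ := by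
  classical
  obtain ⟨κ, f, hf, hsp, hli⟩ := exists_linearIndependent' K (fun x : s => p x)
  have htop : Submodule.span K (Set.range fun x : s => p x) = ⊤ := by
    rw [← hs, Submodule.map_span]
    congr 1
    ext v; simp
  let b : Module.Basis κ K (I → K) := Module.Basis.mk hli (by rw [hsp, htop])
  have : Finite κ := Module.Finite.finite_basis b
  have := Fintype.ofFinite κ
  have hc : Fintype.card I = Fintype.card κ := by
    rw [← Module.finrank_eq_card_basis b, Module.finrank_fintype_fun_eq_card]
  let e : I ≃ κ := Fintype.equivOfCardEq hc
  refine ⟨fun i => f (e i), fun i => (f (e i)).2, ?_⟩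
  rw [← htop, ← hsp]
  congr 1
  have : (p ∘ fun i => ((f (e i) : s) : V)) = ((fun x : s => p x) ∘ f) ∘ e := rfl
  rw [this, e.surjective.range_comp]

/-- generic injectivity -/
lemma generic_inj {σ V W : Type*} [AddCommGroup V] [Module ℂ V] [FiniteDimensional ℂ V]
    [AddCommGroup W] [Module ℂ W] (A : MvPolynomial σ ℂ →ₗ[ℂ] V →ₗ[ℂ] W)
    (M : Finset (σ →₀ ℕ)) (g : MvPolynomial σ ℂ) (hg : g.support ⊆ M)
    (hinj : Function.Injective (A g)) :
    ∃ T : MvPolynomial (σ →₀ ℕ) ℂ, eval (fun m => coeff m g) T ≠ 0 ∧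
      ∀ f : MvPolynomial σ ℂ, f.support ⊆ M → eval (fun m => coeff m f) T ≠ 0 →
        Function.Injective (A f) := by
  classical
  obtain ⟨B, hB⟩ := LinearMap.exists_leftInverse_of_injective (A g) (LinearMap.ker_eq_bot.mpr hinj)
  let b := Module.finBasis ℂ V
  let Tm : Matrix _ _ (MvPolynomial (σ →₀ ℕ) ℂ) :=
    ∑ m ∈ M, (X m : MvPolynomial (σ →₀ ℕ) ℂ) •
      (LinearMap.toMatrix b b (B ∘ₗ A (monomial m 1))).map C
  have key : ∀ f : MvPolynomial σ ℂ, f.support ⊆ M →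
      eval (fun m => coeff m f) Tm.det = LinearMap.det (B ∘ₗ A f) := by
    intro f hf
    rw [← LinearMap.det_toMatrix b, RingHom.map_det]
    congr 1
    have hfs : f = ∑ m ∈ M, coeff m f • monomial m (1 : ℂ) := by
      conv_lhs => rw [f.as_sum]
      rw [← Finset.sum_subset hf]
      · refine Finset.sum_congr rfl fun m _ => ?_
        rw [smul_monomial, smul_eq_mul, mul_one]
      · intro m _ hm
        rw [notMem_support_iff.mp hm, zero_smul]
    have h2 : B ∘ₗ A f = ∑ m ∈ M, coeff m f • (B ∘ₗ A (monomial m 1)) := by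
      conv_lhs => rw [hfs]
      ext v
      simp [LinearMap.sum_apply]
    rw [h2, map_sum]
    ext i j
    simp [Tm, Matrix.sum_apply]
  refine ⟨Tm.det, ?_, ?_⟩
  · rw [key g hg, hB]; simp
  · intro f hf hne
    rw [key f hf] at hne
    have hu : IsUnit (B ∘ₗ A f) := (LinearMap.isUnit_iff_isUnit_det _).mpr hne.isUnit
    have := ((Module.End.isUnit_iff _).mp hu).1
    exact Function.Injective.of_comp (f := B) (by simpa using this)

/-- transcendence degree bound -/
lemma algIndep_card_le {ι : Type} [Fintype ι] {x : ι → ℂ} (hx : AlgebraicIndependent ℚ x)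
    (G : Finset ℂ) (hG : ∀ i, x i ∈ Algebra.adjoin ℚ (G : Set ℂ)) :
    Fintype.card ι ≤ G.card := by
  let A := Algebra.adjoin ℚ (G : Set ℂ)
  let y : ι → A := fun i => ⟨x i, hG i⟩
  have hy : AlgebraicIndependent ℚ y := by
    apply AlgebraicIndependent.of_comp A.val
    exact hx
  have h1 := hy.cardinalMk_le_trdeg
  let π : MvPolynomial G ℚ →ₐ[ℚ] A := aeval (fun g => ⟨g, Algebra.subset_adjoin g.2⟩)
  have hπ : Function.Surjective π := by
    rintro ⟨z, hz⟩
    have : z ∈ (MvPolynomial.aeval (R := ℚ) (fun g : G => (g : ℂ))).range := by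
      have h3 := Algebra.adjoin_eq_range ℚ (G : Set ℂ)
      have hz' : z ∈ Algebra.adjoin ℚ (G : Set ℂ) := hz
      rw [h3] at hz'
      exact hz'
    obtain ⟨p, hp⟩ := this
    refine ⟨p, Subtype.ext ?_⟩
    refine Eq.trans ?_ hp
    have h4 : A.val.comp π = aeval (fun g : G => (g : ℂ)) := by
      ext g; simp [π]
    exact DFunLike.congr_fun h4 p
  have h2 := _root_.trdeg_le_of_surjective π hπ
  rw [MvPolynomial.trdeg_of_isDomain] at h2
  have h3 := h1.trans h2
  simpa using h3

end Lin
end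

noncomputable section

section QSm
variable {σ : Type} [Fintype σ] [DecidableEq σ]

/-- only common zero of partials is the origin -/
def QS (f : MvPolynomial σ ℂ) : Prop :=
  ∀ x : σ → ℂ, (∀ i, eval x (pderiv i f) = 0) → x = 0

/-- jacobian ideal -/
def Jac (f : MvPolynomial σ ℂ) : Ideal (MvPolynomial σ ℂ) :=
  Ideal.span (Set.range fun i => pderiv i f)

lemma Jac_comp {a : σ → ℕ} {d : ℕ} (hd : ∀ i, a i ≤ d) {f : MvPolynomial σ ℂ}
    (hf : f.IsWeightedHomogeneous a d) (e : ℕ) {u : MvPolynomial σ ℂ} (hu : u ∈ Jac f) :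
    weightedHomogeneousComponent a e u ∈ Jac f := by
  letI := weightedGradedAlgebra ℂ a
  have h1 : (Jac f).IsHomogeneous (weightedHomogeneousSubmodule ℂ a) := by
    apply Ideal.homogeneous_span
    rintro _ ⟨i, rfl⟩
    refine ⟨d - a i, ?_⟩
    exact hf.pderiv (Nat.sub_add_cancel (hd i))
  have h2 := h1 e hu
  have h3 := weightedDecomposition.decompose'_apply (R := ℂ) (w := a) u e
  rw [← h3]
  exact h2

lemma Jac_pow {f : MvPolynomial σ ℂ} (hf : QS f) : ∃ N, ∀ i, (X i : MvPolynomial σ ℂ) ^ N ∈ Jac f := by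
  have h : ∀ i, ∃ N, (X i : MvPolynomial σ ℂ) ^ N ∈ Jac f := by
    intro i
    have : (X i : MvPolynomial σ ℂ) ∈ (Jac f).radical := by
      rw [← vanishingIdeal_zeroLocus_eq_radical (K := ℂ) (Jac f), mem_vanishingIdeal_iff]
      intro x hx
      rw [mem_zeroLocus_iff] at hx
      have : x = 0 := by
        apply hf
        intro j
        have := hx (pderiv j f) (Ideal.subset_span ⟨j, rfl⟩)
        simpa [aeval_eq_eval] using this
      simp [this]
    exact this
  choose N hN using h
  refine ⟨∑ i, N i, fun i => ?_⟩
  have : N i ≤ ∑ i, N i := Finset.single_le_sum (fun _ _ => Nat.zero_le _) (Finset.mem_univ i)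
  exact Ideal.mem_of_dvd _ (pow_dvd_pow _ this) (hN i)

lemma QS_of_Jac {f : MvPolynomial σ ℂ} {N : σ → ℕ}
    (h : ∀ i, (X i : MvPolynomial σ ℂ) ^ N i ∈ Jac f) : QS f := by
  intro x hx
  funext i
  have h1 : Jac f ≤ RingHom.ker (eval x) := by
    rw [Jac, Ideal.span_le]
    rintro _ ⟨j, rfl⟩
    exact hx j
  have := h1 (h i)
  rw [RingHom.mem_ker] at this
  simp at this
  simpa using this.1

lemma QS_generic {a : σ → ℕ} (ha : ∀ i, 0 < a i) {d : ℕ} (hd : ∀ i, a i ≤ d) {g : MvPolynomial σ ℂ}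
    (hg : g.IsWeightedHomogeneous a d) (hgQ : QS g) :
    ∃ T : MvPolynomial (σ →₀ ℕ) ℂ, eval (fun m => coeff m g) T ≠ 0 ∧
      ∀ f : MvPolynomial σ ℂ, f.IsWeightedHomogeneous a d → eval (fun m => coeff m f) T ≠ 0 →
        QS f := by
  obtain ⟨N, hN⟩ := Jac_pow hgQ
  obtain ⟨e, he1, he2⟩ : ∃ e : ℕ, (∑ j, N * a j) < e ∧ ∀ i, a i ∣ e := by
    refine ⟨(∑ j, N * a j + 1) * ∏ i, a i, ?_, fun i => ?_⟩
    · have : 0 < ∏ i, a i := Finset.prod_pos fun i _ => ha i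
      exact lt_of_lt_of_le (Nat.lt_succ_self _) (Nat.le_mul_of_pos_right _ this)
    · exact Dvd.dvd.mul_left (Finset.dvd_prod_of_mem a (Finset.mem_univ i)) _
  have hmon : ∀ m : mons a ha e, monomial m.1 (1 : ℂ) ∈ Jac g := by
    rintro ⟨m, hm⟩
    rw [mem_mons] at hm
    obtain ⟨j, hj⟩ : ∃ j, N ≤ m j := by
      by_contra hcon
      push Not at hcon
      rw [Finsupp.weight_eq_sum] at hm
      have : ∑ i, m i • a i ≤ ∑ j, N * a j :=
        Finset.sum_le_sum fun i _ => Nat.mul_le_mul_right _ (hcon i).le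
      omega
    have : monomial m (1 : ℂ) = monomial (m - Finsupp.single j N) 1 * X j ^ N := by
      rw [X_pow_eq_monomial, monomial_mul, mul_one, tsub_add_cancel_of_le]
      simpa using hj
    rw [this]
    exact Ideal.mul_mem_left _ _ (hN j)
  have hq : ∀ m : mons a ha e, ∃ q : σ → MvPolynomial σ ℂ,
      ∑ j, q j * pderiv j g = monomial m.1 (1 : ℂ) := by
    intro m
    have := hmon m
    rw [Jac, Ideal.mem_span_range_iff_exists_fun] at this
    exact this
  choose q hq using hq
  let A : MvPolynomial σ ℂ →ₗ[ℂ] (mons a ha e → ℂ) →ₗ[ℂ] (mons a ha e → ℂ) :=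
    LinearMap.mk₂ ℂ (fun f b m' => coeff m'.1 (∑ m, b m • ∑ j, q m j * pderiv j f))
      (by intro f f' b; funext m'
          simp [mul_add, Finset.sum_add_distrib, coeff_sum])
      (by intro c f b; funext m'
          simp [coeff_sum, Finset.mul_sum]
          refine Finset.sum_congr rfl fun _ _ => Finset.sum_congr rfl fun _ _ => by ring)
      (by intro f b b'; funext m'
          simp [add_mul, Finset.sum_add_distrib, coeff_sum])
      (by intro c f b; funext m'
          simp [coeff_sum, Finset.mul_sum]
          refine Finset.sum_congr rfl fun _ _ => Finset.sum_congr rfl fun _ _ => by ring)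
  have hAg : Function.Injective (A g) := by
    have : A g = LinearMap.id := by
      refine LinearMap.ext fun b => funext fun m' => ?_
      change coeff m'.1 (∑ m, b m • ∑ j, q m j * pderiv j g) = b m'
      simp only [hq, coeff_sum, coeff_smul, coeff_monomial, smul_eq_mul]
      rw [Finset.sum_eq_single m']
      · simp
      · intro m _ hm
        rw [if_neg (fun h => hm (Subtype.ext h)), mul_zero]
      · simp
    rw [this]; exact Function.injective_id
  have hsup : ∀ f : MvPolynomial σ ℂ, f.IsWeightedHomogeneous a d → f.support ⊆ mons a ha d := by
    intro f hf m hm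
    rw [mem_mons]
    exact hf (mem_support_iff.mp hm)
  obtain ⟨T, hT1, hT2⟩ := generic_inj A (mons a ha d) g (hsup g hg) hAg
  refine ⟨T, hT1, fun f hf hfT => ?_⟩
  have hs := LinearMap.injective_iff_surjective.mp (hT2 f (hsup f hf) hfT)
  apply QS_of_Jac (N := fun i => e / a i)
  intro i
  have hwi : Finsupp.weight a (Finsupp.single i (e / a i)) = e := by
    rw [wt_single, Nat.div_mul_cancel (he2 i)]
  let m₀ : mons a ha e := ⟨Finsupp.single i (e / a i), mem_mons.mpr hwi⟩
  obtain ⟨b, hb⟩ := hs (Pi.single m₀ 1)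
  let u := ∑ m, b m • ∑ j, q m j * pderiv j f
  have hu : u ∈ Jac f := by
    refine Ideal.sum_mem _ fun m _ => ?_
    rw [smul_eq_C_mul]
    refine Ideal.mul_mem_left _ _ (Ideal.sum_mem _ fun j _ => Ideal.mul_mem_left _ _ ?_)
    exact Ideal.subset_span ⟨j, rfl⟩
  have := Jac_comp hd hf e hu
  convert this using 1
  ext m
  rw [coeff_weightedHomogeneousComponent, X_pow_eq_monomial, coeff_monomial]
  by_cases hm : Finsupp.weight a m = e
  · rw [if_pos hm]
    have h2 := congrFun hb ⟨m, mem_mons.mpr hm⟩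
    change coeff m u = _ at h2
    rw [h2, Pi.single_apply]
    congr 1
    simp [m₀, eq_comm]
  · rw [if_neg hm, if_neg]
    rintro rfl
    exact hm hwi

end QSm
end

noncomputable section

section DD
variable {σ : Type} [Fintype σ] [DecidableEq σ]

lemma supp_mons {a : σ → ℕ} (ha : ∀ i, 0 < a i) {d : ℕ} {f : MvPolynomial σ ℂ}
    (hf : f.IsWeightedHomogeneous a d) : f.support ⊆ mons a ha d := by
  intro m hm
  rw [mem_mons]
  exact hf (mem_support_iff.mp hm)

lemma exists_QData {a : σ → ℕ} (ha : ∀ i, 0 < a i) {d : ℕ} (hd : ∀ i, 5 * a i ≤ d)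
    {h : MvPolynomial σ ℂ} (hh : h.IsWeightedHomogeneous a d) (hQ : QS h) :
    ∃ k Q, QData a d k Q ∧ ∀ i, Finsupp.single i (k i) + Q i ∈ h.support := by
  have key : ∀ i, ∃ (k : ℕ) (Q : σ →₀ ℕ), (Q = 0 ∨ ∃ j, j ≠ i ∧ Q = Finsupp.single j 1) ∧
      Finsupp.single i k + Q ∈ h.support := by
    intro i
    obtain ⟨j, hj⟩ : ∃ j, eval (Pi.single i (1 : ℂ)) (pderiv j h) ≠ 0 := by
      by_contra hcon
      push Not at hcon
      have := congrFun (hQ _ hcon) i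
      simp at this
    rw [eval_eq] at hj
    obtain ⟨m, hm, hm0⟩ := Finset.exists_ne_zero_of_sum_ne_zero hj
    have hm1 : m = Finsupp.single i (m i) := by
      ext l
      by_cases hl : l = i
      · subst hl; simp
      · rw [Finsupp.single_eq_of_ne hl]
        by_contra hne
        apply hm0
        rw [Finset.prod_eq_zero (i := l), mul_zero]
        · simpa using hne
        · rw [Pi.single_eq_of_ne hl, zero_pow hne]
    have hm2 : coeff (m + Finsupp.single j 1) h ≠ 0 := by
      rw [mem_support_iff, coeff_pderiv] at hm
      exact left_ne_zero_of_mul hm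
    by_cases hji : j = i
    · subst hji
      refine ⟨m j + 1, 0, Or.inl rfl, ?_⟩
      rw [add_zero, Finsupp.single_add, ← hm1, mem_support_iff]
      exact hm2
    · refine ⟨m i, Finsupp.single j 1, Or.inr ⟨j, hji, rfl⟩, ?_⟩
      rw [← hm1, mem_support_iff]
      exact hm2
  choose k Q h1 h2 using key
  refine ⟨k, Q, ⟨ha, hd, h1, fun i => ?_⟩, h2⟩
  have := hh (mem_support_iff.mp (h2 i))
  rwa [map_add, wt_single] at this

lemma chain_rule {B : Type*} [CommRing B] [Algebra ℂ B] (D : Derivation ℂ B B) (Y : σ → B)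
    (p : MvPolynomial σ ℂ) : D (aeval Y p) = ∑ i, aeval Y (pderiv i p) * D (Y i) := by
  induction p using MvPolynomial.induction_on with
  | C c => simp
  | add p q hp hq => simp [hp, hq, add_mul, Finset.sum_add_distrib]
  | mul_X p j hp =>
    rw [map_mul, aeval_X, D.leibniz, hp]
    simp only [Derivation.leibniz, map_add, smul_eq_mul, map_mul, aeval_X, add_mul,
      Finset.sum_add_distrib, pderiv_X, Finset.mul_sum]
    congr 1
    · rw [Finset.sum_eq_single j]
      · simp
      · intro i _ hi; simp [Pi.single_apply, hi]
      · simp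
    · refine Finset.sum_congr rfl fun i _ => by ring

lemma QS_pullback {a : σ → ℕ} (ha : ∀ i, 0 < a i) (ψ : MvPolynomial σ ℂ ≃ₐ[ℂ] MvPolynomial σ ℂ)
    (hψ : ∀ i, (ψ (X i)).IsWeightedHomogeneous a (a i)) {h : MvPolynomial σ ℂ}
    (hf : QS (ψ h)) : QS h := by
  intro x hx
  let y : σ → ℂ := fun j => aeval x (ψ.symm (X j))
  have hy : ∀ p, aeval y (ψ p) = aeval x p := by
    intro p
    have : aeval y = (aeval x : MvPolynomial σ ℂ →ₐ[ℂ] ℂ).comp (ψ.symm : _ →ₐ[ℂ] _) := by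
      ext j; simp [y]
    rw [this]; simp
  have hψa : ∀ p, ψ p = aeval (fun i => ψ (X i)) p := by
    intro p
    have : (ψ : MvPolynomial σ ℂ →ₐ[ℂ] MvPolynomial σ ℂ) = aeval (fun i => ψ (X i)) := by
      ext j; simp
    rw [← this]; simp
  have hy0 : y = 0 := by
    apply hf
    intro j
    rw [hψa, chain_rule (pderiv j), map_sum]
    refine Finset.sum_eq_zero fun i _ => ?_
    rw [← hψa, map_mul, ← aeval_eq_eval, hy, aeval_eq_eval, hx i, zero_mul]
  funext i
  have h1 := hy (X i)
  rw [aeval_X, hy0] at h1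
  rw [← h1, Pi.zero_apply, show ((0 : σ → ℂ)) = fun _ => 0 from rfl, aeval_zero']
  have : coeff 0 (ψ (X i)) = 0 := by
    apply (hψ i).coeff_eq_zero
    simpa using (ha i).ne
  rw [constantCoeff_eq, this]; simp

/-- special polynomial -/
def gz (k : σ → ℕ) (Q : σ → σ →₀ ℕ) : MvPolynomial σ ℂ :=
  ∑ i, monomial (Finsupp.single i (k i) + Q i) 1

lemma gz_hom {a : σ → ℕ} {d : ℕ} {k : σ → ℕ} {Q : σ → σ →₀ ℕ} (h : QData a d k Q) :
    (gz k Q).IsWeightedHomogeneous a d := by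
  refine Submodule.sum_mem (weightedHomogeneousSubmodule ℂ a d) fun i _ => ?_
  apply isWeightedHomogeneous_monomial
  rw [map_add, wt_single, h.hw]

lemma gz_coeff {a : σ → ℕ} {d : ℕ} {k : σ → ℕ} {Q : σ → σ →₀ ℕ} (h : QData a d k Q)
    (p : σ → MvPolynomial σ ℂ) {i : σ} {m : σ →₀ ℕ} (hm : Finsupp.weight a m = a i) :
    coeff (FF k Q i m) (∑ l, p l * pderiv l (gz k Q)) = 
      k i * coeff m (p i) + (if m = Finsupp.single i 1 then
        ∑ l, Q i l * coeff (Finsupp.single l 1) (p l) else 0) := by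
  have h4 := h.k4
  have e1 : ∑ l, p l * pderiv l (gz k Q) = ∑ i', ∑ l, p l *
      monomial (Finsupp.single i' (k i') + Q i' - Finsupp.single l 1)
        (((Finsupp.single i' (k i') + Q i') l : ℕ) : ℂ) := by
    rw [Finset.sum_comm]
    refine Finset.sum_congr rfl fun l _ => ?_
    rw [gz, map_sum, Finset.mul_sum]
    refine Finset.sum_congr rfl fun i' _ => ?_
    rw [pderiv_monomial, one_mul]
  rw [e1, coeff_sum, Finset.sum_eq_single i]
  · rw [coeff_sum, ← Finset.add_sum_erase _ _ (Finset.mem_univ i)]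
    have e2 : Finsupp.single i (k i) + Q i - Finsupp.single i 1 = Finsupp.single i (k i - 1) + Q i := by
      ext l
      by_cases hl : l = i
      · subst hl; have := h4 l; simp; omega
      · simp [Finsupp.single_eq_of_ne hl]
    congr 1
    · rw [e2, FF, add_assoc, coeff_mul_monomial]
      simp [h.Qself, mul_comm]
    · have e3 : ∀ l ∈ Finset.univ.erase i, coeff (FF k Q i m) (p l *
          monomial (Finsupp.single i (k i) + Q i - Finsupp.single l 1)
          (((Finsupp.single i (k i) + Q i) l : ℕ) : ℂ)) =
          if m = Finsupp.single i 1 then Q i l * coeff (Finsupp.single l 1) (p l) else 0 := by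
        intro l hl
        have hl := Finset.ne_of_mem_erase hl
        have e4 : (Finsupp.single i (k i) + Q i) l = Q i l := by
          simp [Finsupp.single_eq_of_ne hl]
        rw [e4]
        by_cases hq : Q i l = 0
        · simp [hq]
        · have hq' := h.Qeq hq
          rw [hq', add_tsub_cancel_right, coeff_mul_monomial']
          by_cases hmi : m = Finsupp.single i 1
          · have e5 : FF k Q i m = Finsupp.single i (k i) + Q i := by
              rw [FF, hmi, ← Finsupp.single_add]
              congr 2; have := h4 i; omega
            rw [if_pos hmi, e5, if_pos (le_self_add), add_tsub_cancel_left, hq']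
            simp
          · rw [if_neg hmi, if_neg]
            intro hle
            apply hmi
            apply eq_single_of_wt h.ha hm
            intro h0
            have := hle i
            have h44 := h4 i
            simp [FF, h0, h.Qself] at this
            omega
      rw [Finset.sum_congr rfl e3]
      split_ifs with hmi
      · rw [← Finset.add_sum_erase _ _ (Finset.mem_univ i), h.Qself]; simp
      · simp
  · intro i' _ hi'
    rw [coeff_sum]
    refine Finset.sum_eq_zero fun l _ => ?_
    rw [coeff_mul_monomial']
    split_ifs with hle
    · by_cases hs : (Finsupp.single i' (k i') + Q i') l = 0
      · rw [hs]; simp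
      · exfalso
        apply hi'
        refine (h.dom (h.wFF hm) ?_ ?_).symm
        · simp [FF]; omega
        · refine le_trans ?_ (hle i')
          have : (Finsupp.single l 1 : σ →₀ ℕ) i' ≤ 1 := by
            rw [Finsupp.single_apply]; split_ifs <;> simp
          simp; omega
    · rfl
  · simp

lemma gz_inj {a : σ → ℕ} {d : ℕ} {k : σ → ℕ} {Q : σ → σ →₀ ℕ} (h : QData a d k Q)
    (p : σ → MvPolynomial σ ℂ) (hp : ∀ i, (p i).IsWeightedHomogeneous a (a i))
    (h0 : ∑ l, p l * pderiv l (gz k Q) = 0) : ∀ i, p i = 0 := by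
  have h4 := h.k4
  have hk : ∀ i, (k i : ℂ) ≠ 0 := fun i => by
    have := h4 i
    exact_mod_cast (by omega : k i ≠ 0)
  have hdiag : ∀ i, coeff (Finsupp.single i 1) (p i) = 0 := by
    rcases isEmpty_or_nonempty σ with he | he
    · intro i; exact he.elim i
    obtain ⟨i, hi⟩ := Finite.exists_max (fun i => ‖coeff (Finsupp.single i 1) (p i)‖)
    have e1 := gz_coeff h p (i := i) (m := Finsupp.single i 1) (by rw [wt_single, one_mul])
    rw [h0, coeff_zero, if_pos rfl] at e1
    have e2 : ‖∑ l, (Q i l : ℂ) * coeff (Finsupp.single l 1) (p l)‖ ≤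
        ‖coeff (Finsupp.single i 1) (p i)‖ := by
      rcases h.hQ i with hq | ⟨j, hj, hq⟩
      · rw [hq]; simp
      · rw [Finset.sum_eq_single j]
        · rw [hq]; simpa using hi j
        · intro l _ hl; rw [hq, Finsupp.single_eq_of_ne hl]; simp
        · simp
    have e3 : (k i : ℝ) * ‖coeff (Finsupp.single i 1) (p i)‖ =
      ‖∑ l, (Q i l : ℂ) * coeff (Finsupp.single l 1) (p l)‖ := by
      rw [← norm_neg (∑ l, _), ← eq_neg_of_add_eq_zero_left e1.symm]
      simp
    have h5 : (4 : ℝ) ≤ k i := by exact_mod_cast h4 i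
    have h6 : ‖coeff (Finsupp.single i 1) (p i)‖ = 0 := by
      have := norm_nonneg (coeff (Finsupp.single i 1) (p i))
      nlinarith
    intro l
    have := hi l
    simp only [h6] at this
    exact norm_le_zero_iff.mp this
  intro i
  ext m
  rw [coeff_zero]
  by_cases hm : Finsupp.weight a m = a i
  · have e1 := gz_coeff h p hm
    rw [h0, coeff_zero] at e1
    simp only [hdiag, mul_zero, Finset.sum_const_zero, ite_self, add_zero] at e1
    exact (mul_eq_zero.mp e1.symm).resolve_left (hk i)
  · exact (hp i).coeff_eq_zero _ hm

lemma der_generic {a : σ → ℕ} {d : ℕ} {k : σ → ℕ} {Q : σ → σ →₀ ℕ} (h : QData a d k Q) :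
    ∃ T : MvPolynomial (σ →₀ ℕ) ℂ, eval (fun m => coeff m (gz k Q)) T ≠ 0 ∧
      ∀ f : MvPolynomial σ ℂ, f.IsWeightedHomogeneous a d → eval (fun m => coeff m f) T ≠ 0 →
        ∀ p : σ → MvPolynomial σ ℂ, (∀ i, (p i).IsWeightedHomogeneous a (a i)) →
          ∑ l, p l * pderiv l f = 0 → ∀ i, p i = 0 := by
  have : ∀ i, FiniteDimensional ℂ (weightedHomogeneousSubmodule ℂ a (a i)) := fun i =>
    Module.Finite.iff_fg.mpr (weightedHomogeneousSubmodule_fg ℂ a (fun i => (h.ha i).ne') (a i))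
  let A : MvPolynomial σ ℂ →ₗ[ℂ] (∀ i, weightedHomogeneousSubmodule ℂ a (a i)) →ₗ[ℂ]
      MvPolynomial σ ℂ :=
    LinearMap.mk₂ ℂ (fun f p => ∑ l, (p l : MvPolynomial σ ℂ) * pderiv l f)
      (by intro f f' b; simp [mul_add, Finset.sum_add_distrib])
      (by intro c f b; simp [Finset.smul_sum])
      (by intro f b b'; simp [add_mul, Finset.sum_add_distrib])
      (by intro c f b; simp [Finset.smul_sum])
  have hA : Function.Injective (A (gz k Q)) := by
    rw [← LinearMap.ker_eq_bot, LinearMap.ker_eq_bot']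
    intro p hp
    funext i
    exact Subtype.ext (gz_inj h (fun i => (p i : MvPolynomial σ ℂ)) (fun i => (p i).2) hp i)
  obtain ⟨T, hT1, hT2⟩ := generic_inj A (mons a h.ha d) _ (supp_mons h.ha (gz_hom h)) hA
  refine ⟨T, hT1, fun f hf hfT p hp hp0 i => ?_⟩
  have h1 := hT2 f (supp_mons h.ha hf) hfT
  rw [← LinearMap.ker_eq_bot, LinearMap.ker_eq_bot'] at h1
  have := h1 (fun i => ⟨p i, hp i⟩) hp0
  exact congrArg Subtype.val (congrFun this i)

end DD
end

noncomputable section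

section EE

lemma surj_inj {B : Type*} [CommRing B] [Algebra ℂ B] [IsNoetherianRing B] (f : B →ₐ[ℂ] B)
    (hf : Function.Surjective f) : Function.Injective f := by
  have hs : ∀ n : ℕ, Function.Surjective ((f ^ n : B →ₐ[ℂ] B) : B → B) := by
    intro n
    rw [AlgHom.coe_pow]
    exact hf.iterate n
  let K : ℕ →o Ideal B := ⟨fun n => RingHom.ker (f ^ n : B →ₐ[ℂ] B), by
    apply monotone_nat_of_le_succ
    intro n x hx
    rw [RingHom.mem_ker] at hx ⊢
    rw [pow_succ', AlgHom.mul_apply, hx, map_zero]⟩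
  obtain ⟨n, hn⟩ := monotone_stabilizes_iff_noetherian.mpr (inferInstance : IsNoetherian B B) K
  rw [injective_iff_map_eq_zero]
  intro x hx
  obtain ⟨y, rfl⟩ := hs n x
  have h1 : y ∈ K (n + 1) := by
    change y ∈ RingHom.ker (f ^ (n + 1) : B →ₐ[ℂ] B)
    rw [RingHom.mem_ker, pow_succ', AlgHom.mul_apply, hx]
  rw [← hn (n + 1) (Nat.le_succ n)] at h1
  exact h1

/-- generalised eigenspace of an algebra endomorphism -/
abbrev GE {B : Type*} [CommRing B] [Algebra ℂ B] (φ : B →ₐ[ℂ] B) (l : ℂ) : Submodule ℂ B :=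
  Module.End.maxGenEigenspace φ.toLinearMap l

section
variable {B : Type*} [CommRing B] [Algebra ℂ B] (φ : B →ₐ[ℂ] B)

lemma GE_step {l : ℂ} {u : B} (h : φ u - l • u ∈ GE φ l) : u ∈ GE φ l := by
  rw [Module.End.mem_maxGenEigenspace] at h ⊢
  obtain ⟨k, hk⟩ := h
  refine ⟨k + 1, ?_⟩
  rw [pow_succ, Module.End.mul_apply]
  simpa using hk

lemma GE_mul {l m : ℂ} {u v : B} (hu : u ∈ GE φ l) (hv : v ∈ GE φ m) : u * v ∈ GE φ (l * m) := by
  rw [Module.End.mem_maxGenEigenspace] at hu hv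
  obtain ⟨k, hk⟩ := hu
  obtain ⟨k', hk'⟩ := hv
  obtain ⟨N, hN⟩ : ∃ N, k + k' ≤ N := ⟨_, le_rfl⟩
  induction N generalizing k k' u v with
  | zero =>
    have : k = 0 := by omega
    subst this
    have hu0 : u = 0 := by simpa using hk
    rw [hu0, zero_mul]; exact Submodule.zero_mem _
  | succ N ih =>
    rcases k with _ | k
    · have hu0 : u = 0 := by simpa using hk
      rw [hu0, zero_mul]; exact Submodule.zero_mem _
    rcases k' with _ | k'
    · have hu0 : v = 0 := by simpa using hk'
      rw [hu0, mul_zero]; exact Submodule.zero_mem _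
    apply GE_step
    have e : φ (u * v) - (l * m) • (u * v) = (φ u - l • u) * φ v + l • (u * (φ v - m • v)) := by
      rw [map_mul]
      simp only [Algebra.smul_def, map_mul]
      ring
    rw [e]
    refine Submodule.add_mem _ ?_ (Submodule.smul_mem _ _ ?_)
    · refine ih (u := φ u - l • u) (v := φ v) k ?_ (k' + 1) ?_ (by omega)
      · rw [pow_succ, Module.End.mul_apply] at hk
        simpa using hk
      · have hc : Commute ((φ.toLinearMap - m • (1 : Module.End ℂ B)) ^ (k' + 1)) φ.toLinearMap := by
          apply Commute.pow_left
          apply Commute.sub_left (Commute.refl _)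
          exact (Commute.one_left _).smul_left _
        have := congrArg (fun F : Module.End ℂ B => F v) hc.eq
        simp only [Module.End.mul_apply, hk', map_zero] at this
        exact this
    · refine ih (u := u) (v := φ v - m • v) (k + 1) hk k' ?_ (by omega)
      rw [pow_succ, Module.End.mul_apply] at hk'
      simpa using hk'

lemma GE_one : (1 : B) ∈ GE φ 1 := by
  apply GE_step
  simp

lemma GE_pow {l : ℂ} {u : B} (hu : u ∈ GE φ l) (n : ℕ) : u ^ n ∈ GE φ (l ^ n) := by
  induction n with
  | zero => simpa using GE_one φ
  | succ n ih => rw [pow_succ, pow_succ]; exact GE_mul φ ih hu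

end

variable {σ : Type} [Fintype σ] [DecidableEq σ]

lemma GE_monomial (φ : MvPolynomial σ ℂ →ₐ[ℂ] MvPolynomial σ ℂ) {lam : σ → ℂ}
    (h : ∀ i, (X i : MvPolynomial σ ℂ) ∈ GE φ (lam i)) (m : σ →₀ ℕ) :
    monomial m 1 ∈ GE φ (chi lam m) := by
  have e : monomial m (1 : ℂ) = ∏ i, X i ^ m i := by
    rw [monomial_eq, C_1, one_mul, Finsupp.prod_fintype]
    simp
  rw [e, chi]
  have : ∀ s : Finset σ, ∏ i ∈ s, (X i : MvPolynomial σ ℂ) ^ m i ∈ GE φ (∏ i ∈ s, lam i ^ m i) := by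
    intro s
    induction s using Finset.induction_on with
    | empty => simpa using GE_one φ
    | insert i s hi ih =>
      rw [Finset.prod_insert hi, Finset.prod_insert hi]
      exact GE_mul φ (GE_pow φ (h i) _) ih
  exact this _

/-- graded hom -/
def GrHom (a : σ → ℕ) (φ : MvPolynomial σ ℂ →ₐ[ℂ] MvPolynomial σ ℂ) : Prop :=
  ∀ e f, IsWeightedHomogeneous a f e → IsWeightedHomogeneous a (φ f) e

lemma GrHom_of {a : σ → ℕ} {φ : MvPolynomial σ ℂ →ₐ[ℂ] MvPolynomial σ ℂ}
    (h : ∀ i, IsWeightedHomogeneous a (φ (X i)) (a i)) : GrHom a φ := by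
  intro e f hf
  rw [f.as_sum, map_sum]
  refine Submodule.sum_mem (weightedHomogeneousSubmodule ℂ a e) fun m hm => ?_
  rw [mem_weightedHomogeneousSubmodule]
  have hw := hf (mem_support_iff.mp hm)
  rw [monomial_eq, Finsupp.prod_fintype _ _ (by simp), map_mul, map_prod]
  have h1 : IsWeightedHomogeneous a (φ (C (coeff m f))) 0 := by
    have : φ (C (coeff m f)) = C (coeff m f) := φ.commutes _
    rw [this]; exact isWeightedHomogeneous_C a _
  have h2 : IsWeightedHomogeneous a (∏ i, φ (X i ^ m i)) (∑ i, m i • a i) := by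
    apply IsWeightedHomogeneous.prod
    intro i _
    rw [map_pow]
    exact (h i).pow _
  rw [Finsupp.weight_eq_sum] at hw
  have := h1.mul h2
  rwa [zero_add, hw] at this

lemma fd_hom {a : σ → ℕ} (ha : ∀ i, 0 < a i) (e : ℕ) :
    FiniteDimensional ℂ (weightedHomogeneousSubmodule ℂ a e) :=
  Module.Finite.iff_fg.mpr (weightedHomogeneousSubmodule_fg ℂ a (fun i => (ha i).ne') e)

/-- graded generalised eigenspace -/
abbrev EE (a : σ → ℕ) (φ : MvPolynomial σ ℂ →ₐ[ℂ] MvPolynomial σ ℂ) (e : ℕ) (l : ℂ) :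
    Submodule ℂ (MvPolynomial σ ℂ) := weightedHomogeneousSubmodule ℂ a e ⊓ GE φ l

lemma EE_top {a : σ → ℕ} (ha : ∀ i, 0 < a i) {φ : MvPolynomial σ ℂ →ₐ[ℂ] MvPolynomial σ ℂ}
    (hφ : GrHom a φ) (e : ℕ) : weightedHomogeneousSubmodule ℂ a e ≤ ⨆ l, EE a φ e l := by
  have := fd_hom ha e
  let P := weightedHomogeneousSubmodule ℂ a e
  have hP : ∀ x : MvPolynomial σ ℂ, x ∈ P → φ.toLinearMap x ∈ P := fun x hx => hφ e x hx
  have h1 := Module.End.iSup_maxGenEigenspace_eq_top (φ.toLinearMap.restrict hP)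
  have h2 := congrArg (Submodule.map P.subtype) h1
  rw [Submodule.map_iSup, Submodule.map_top, Submodule.range_subtype] at h2
  change P ≤ _
  rw [← h2]
  apply iSup_mono
  intro l
  have h3 := Module.End.genEigenspace_restrict φ.toLinearMap P ⊤ l hP
  change Submodule.map P.subtype (Module.End.genEigenspace (φ.toLinearMap.restrict hP) l ⊤) ≤ _
  rw [h3, Submodule.map_comap_subtype]

end EE
end

noncomputable section

section FFs
variable {σ : Type} [Fintype σ] [DecidableEq σ]

lemma exists_Y {a : σ → ℕ} (ha : ∀ i, 0 < a i) {φ : MvPolynomial σ ℂ →ₐ[ℂ] MvPolynomial σ ℂ}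
    (hφ : GrHom a φ) : ∃ (Y : σ → MvPolynomial σ ℂ) (lam : σ → ℂ) (Z : σ → Finset (σ →₀ ℕ)),
      (∀ i, Y i ∈ EE a φ (a i) (lam i)) ∧ (∀ i, Z i ⊆ mons a ha (a i)) ∧
      (∀ i, Module.finrank ℂ (EE a φ (a i) (lam i)) ≤ (Z i).card) ∧
      (∀ i, ∀ m ∈ Z i, coeff m (Y i) = 0 ∨ coeff m (Y i) = 1) ∧
      (∀ i, ∃ c : σ → ℂ, IsWeightedHomogeneous a (∑ j, c j • Y j) (a i) ∧ 
        ∀ j, coeff (Finsupp.single j 1) (∑ j, c j • Y j) = if i = j then 1 else 0) := by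
  -- one weight at a time
  have step : ∀ w : ℕ, ∃ y : {i // a i = w} → MvPolynomial σ ℂ,
      (∀ i, ∃ l, y i ∈ EE a φ w l ∧ ∃ Z : Finset (σ →₀ ℕ), Z ⊆ mons a ha w ∧
        Module.finrank ℂ (EE a φ w l) ≤ Z.card ∧ ∀ m ∈ Z, coeff m (y i) = 0 ∨ coeff m (y i) = 1) ∧
      Submodule.span ℂ (Set.range ((LinearMap.pi fun i : {i // a i = w} =>
        lcoeff ℂ (Finsupp.single i.1 1)) ∘ y)) = ⊤ := by
    intro w
    let s : Set (MvPolynomial σ ℂ) := {v | ∃ l, v ∈ EE a φ w l ∧ ∃ Z : Finset (σ →₀ ℕ),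
      Z ⊆ mons a ha w ∧ Module.finrank ℂ (EE a φ w l) ≤ Z.card ∧
        ∀ m ∈ Z, coeff m v = 0 ∨ coeff m v = 1}
    have hs : weightedHomogeneousSubmodule ℂ a w ≤ Submodule.span ℂ s := by
      refine (EE_top ha hφ w).trans (iSup_le fun l => ?_)
      have := fd_hom ha w
      have : FiniteDimensional ℂ (EE a φ w l) := Submodule.finiteDimensional_inf_left _ _
      refine (echelon (EE a φ w l) (fun m : mons a ha w => lcoeff ℂ m.1) ?_).trans
        (Submodule.span_mono ?_)
      · intro v hv h0
        ext m
        rw [coeff_zero]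
        by_cases hm : Finsupp.weight a m = w
        · exact h0 ⟨m, mem_mons.mpr hm⟩
        · exact IsWeightedHomogeneous.coeff_eq_zero hv.1 _ hm
      · rintro v ⟨hv, Z, hZ1, hZ2⟩
        refine ⟨l, hv, Z.map (Function.Embedding.subtype _), ?_, ?_, ?_⟩
        · intro m hm
          obtain ⟨m', _, rfl⟩ := Finset.mem_map.mp hm
          exact m'.2
        · rwa [Finset.card_map]
        · intro m hm
          obtain ⟨m', hm', rfl⟩ := Finset.mem_map.mp hm
          exact hZ2 m' hm'
    obtain ⟨y, hy1, hy2⟩ := select_basis (LinearMap.pi fun i : {i // a i = w} =>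
        lcoeff ℂ (Finsupp.single i.1 1)) s (by
      rw [eq_top_iff]
      intro v _
      refine ⟨∑ i : {i // a i = w}, v i • X i.1, ?_, ?_⟩
      · refine Submodule.sum_mem _ fun i _ => Submodule.smul_mem _ _ (hs ?_)
        rw [mem_weightedHomogeneousSubmodule]
        have := isWeightedHomogeneous_X ℂ a i.1
        rwa [i.2] at this
      · funext j
        simp only [LinearMap.pi_apply, map_sum, map_smul]
        rw [Finset.sum_eq_single j]
        · simp [lcoeff]
        · intro i _ hij
          have : (coeff (Finsupp.single j.1 1) (X i.1 : MvPolynomial σ ℂ)) = 0 := by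
            rw [coeff_X', if_neg]
            intro h
            apply hij
            exact Subtype.ext ((Finsupp.single_left_inj one_ne_zero).mp h)
          simp [lcoeff, this]
        · simp)
    exact ⟨y, hy1, hy2⟩
  choose y hy1 hy2 using step
  choose l hl Z hZ1 hZ2 hZ3 using hy1
  refine ⟨fun i => y (a i) ⟨i, rfl⟩, fun i => l (a i) ⟨i, rfl⟩, fun i => Z (a i) ⟨i, rfl⟩,
    fun i => hl _ _, fun i => hZ1 _ _, fun i => hZ2 _ _, fun i => hZ3 _ _, fun i => ?_⟩
  have hmem : (Pi.single (⟨i, rfl⟩ : {j // a j = a i}) (1 : ℂ) : {j // a j = a i} → ℂ) ∈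
      Submodule.span ℂ (Set.range ((LinearMap.pi fun j : {j // a j = a i} =>
        lcoeff ℂ (Finsupp.single j.1 1)) ∘ y (a i))) := by rw [hy2]; trivial
  rw [Submodule.mem_span_range_iff_exists_fun] at hmem
  obtain ⟨c, hc⟩ := hmem
  have hsum : ∑ j, (if h : a j = a i then c ⟨j, h⟩ else 0) • y (a j) ⟨j, rfl⟩ =
      ∑ j : {j // a j = a i}, c j • y (a i) j := by
    have hyy : ∀ (w : ℕ) (j : σ) (hj : a j = w), y (a j) ⟨j, rfl⟩ = y w ⟨j, hj⟩ := by
      intro w j hj; subst hj; rfl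
    rw [← Finset.sum_filter_of_ne (p := fun j => a j = a i)]
    · rw [Finset.sum_subtype (Finset.univ.filter fun j => a j = a i) (p := fun j => a j = a i)
        (by simp)]
      refine Finset.sum_congr rfl fun j _ => ?_
      rw [dif_pos j.2, hyy _ _ j.2]
    · intro j _ hne
      by_contra hj
      rw [dif_neg hj, zero_smul] at hne
      exact hne rfl
  refine ⟨fun j => if h : a j = a i then c ⟨j, h⟩ else 0, ?_, ?_⟩
  · rw [hsum]
    exact Submodule.sum_mem (weightedHomogeneousSubmodule ℂ a (a i)) fun j _ =>
      Submodule.smul_mem _ _ (hl _ _).1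
  · intro j
    rw [hsum]
    by_cases hj : a j = a i
    · have := congrFun hc ⟨j, hj⟩
      rw [Finset.sum_apply] at this
      rw [coeff_sum]
      simp only [coeff_smul]
      refine Eq.trans ?_ (this.trans ?_)
      · rfl
      · rw [Pi.single_apply]
        simp [eq_comm]
    · rw [if_neg (by rintro rfl; exact hj rfl), coeff_sum]
      refine Finset.sum_eq_zero fun j' _ => ?_
      rw [coeff_smul, IsWeightedHomogeneous.coeff_eq_zero (hl (a i) j').1, smul_zero]
      rw [wt_single, one_mul]; exact hj

lemma aeval_surj_s16 {a : σ → ℕ} (ha : ∀ i, 0 < a i) {Y : σ → MvPolynomial σ ℂ}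
    (h : ∀ i, ∃ c : σ → ℂ, IsWeightedHomogeneous a (∑ j, c j • Y j) (a i) ∧ 
        ∀ j, coeff (Finsupp.single j 1) (∑ j, c j • Y j) = if i = j then 1 else 0) :
    Function.Surjective (aeval Y : MvPolynomial σ ℂ →ₐ[ℂ] MvPolynomial σ ℂ) := by
  let R := (aeval Y : MvPolynomial σ ℂ →ₐ[ℂ] MvPolynomial σ ℂ).range
  have key : ∀ e, ∀ m : σ →₀ ℕ, Finsupp.weight a m = e → monomial m (1 : ℂ) ∈ R := by
    intro e
    induction e using Nat.strong_induction_on with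
    | _ e ih =>
    have nonlin : ∀ m : σ →₀ ℕ, Finsupp.weight a m = e → (∀ i, m ≠ Finsupp.single i 1) →
        monomial m (1 : ℂ) ∈ R := by
      intro m hm hs
      by_cases h0 : m = 0
      · subst h0; exact R.one_mem
      · obtain ⟨i, hi⟩ := Finsupp.ne_iff.mp h0
        have hle : Finsupp.single i 1 ≤ m := by
          rw [Finsupp.single_le_iff]; exact Nat.one_le_iff_ne_zero.mpr hi
        have hadd : Finsupp.single i 1 + (m - Finsupp.single i 1) = m := add_tsub_cancel_of_le hle
        have hw := congrArg (Finsupp.weight a) hadd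
        rw [map_add, hm, wt_single, one_mul] at hw
        have hne : m - Finsupp.single i 1 ≠ 0 := by
          intro h0
          rw [h0, add_zero] at hadd
          exact hs i hadd.symm
        have hpos : 0 < Finsupp.weight a (m - Finsupp.single i 1) := by
          obtain ⟨j, hj⟩ := Finsupp.ne_iff.mp hne
          refine lt_of_lt_of_le ?_ (wt_ge a _ j)
          exact Nat.mul_pos (Nat.pos_of_ne_zero hj) (ha j)
        have h1 := ih (a i) (by omega) (Finsupp.single i 1) (by rw [wt_single, one_mul])
        have h2 := ih _ (by have := ha i; omega) (m - Finsupp.single i 1) rfl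
        have := R.mul_mem h1 h2
        rwa [monomial_mul, one_mul, hadd] at this
    intro m hm
    by_cases hs : ∀ i, m ≠ Finsupp.single i 1
    · exact nonlin m hm hs
    push Not at hs
    obtain ⟨i, rfl⟩ := hs
    rw [wt_single, one_mul] at hm
    obtain ⟨c, hc1, hc2⟩ := h i
    set s := ∑ j, c j • Y j with hsdef
    have hsR : s ∈ R := by
      refine R.sum_mem fun j _ => R.smul_mem ?_ _
      exact ⟨X j, by simp⟩
    have hr : s - X i ∈ R := by
      have hhom : IsWeightedHomogeneous a (s - X i) (a i) :=
        Submodule.sub_mem (weightedHomogeneousSubmodule ℂ a (a i)) hc1 (isWeightedHomogeneous_X ℂ a i)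
      rw [MvPolynomial.as_sum (s - X i)]
      refine R.sum_mem fun m' hm' => ?_
      have e1 : monomial m' (coeff m' (s - X i)) = coeff m' (s - X i) • monomial m' (1 : ℂ) := by
        rw [smul_monomial, smul_eq_mul, mul_one]
      rw [e1]
      refine R.smul_mem (nonlin m' ?_ ?_) _
      · rw [← hm]; exact hhom (mem_support_iff.mp hm')
      · rintro j rfl
        rw [mem_support_iff, coeff_sub, hc2, coeff_X'] at hm'
        apply hm'
        by_cases hij : i = j
        · subst hij; simp
        · rw [if_neg hij, if_neg, sub_zero]
          exact fun h => hij ((Finsupp.single_left_inj one_ne_zero).mp h)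
    have := R.sub_mem hsR hr
    rwa [sub_sub_cancel] at this
  intro p
  change p ∈ R
  rw [MvPolynomial.as_sum p]
  refine R.sum_mem fun m _ => ?_
  have e1 : monomial m (coeff m p) = coeff m p • monomial m (1 : ℂ) := by
    rw [smul_monomial, smul_eq_mul, mul_one]
  rw [e1]
  exact R.smul_mem (key _ m rfl) _

lemma exists_coord_s16 {a : σ → ℕ} (ha : ∀ i, 0 < a i) {φ : MvPolynomial σ ℂ →ₐ[ℂ] MvPolynomial σ ℂ}
    (hφ : GrHom a φ) : ∃ (ψ : MvPolynomial σ ℂ ≃ₐ[ℂ] MvPolynomial σ ℂ) (lam : σ → ℂ)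
      (Z : σ → Finset (σ →₀ ℕ)),
      (∀ i, ψ (X i) ∈ EE a φ (a i) (lam i)) ∧ (∀ i, Z i ⊆ mons a ha (a i)) ∧
      (∀ i, Module.finrank ℂ (EE a φ (a i) (lam i)) ≤ (Z i).card) ∧
      (∀ i, ∀ m ∈ Z i, coeff m (ψ (X i)) = 0 ∨ coeff m (ψ (X i)) = 1) := by
  obtain ⟨Y, lam, Z, h1, h2, h3, h4, h5⟩ := exists_Y ha hφ
  have hs := aeval_surj_s16 ha h5
  have hi := surj_inj _ hs
  refine ⟨AlgEquiv.ofBijective (aeval Y) ⟨hi, hs⟩, lam, Z, ?_, h2, h3, ?_⟩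
  · intro i; simpa using h1 i
  · intro i; simpa using h4 i

end FFs
end

noncomputable section

section GG
variable {σ : Type} [Fintype σ] [DecidableEq σ]

lemma monomial_prod (m : σ →₀ ℕ) : monomial m (1 : ℂ) = ∏ i, X i ^ m i := by
  rw [monomial_eq, C_1, one_mul, Finsupp.prod_fintype]
  simp

lemma GE_monomial' (φ ψ : MvPolynomial σ ℂ →ₐ[ℂ] MvPolynomial σ ℂ) {lam : σ → ℂ}
    (h : ∀ i, ψ (X i) ∈ GE φ (lam i)) (m : σ →₀ ℕ) :
    ψ (monomial m 1) ∈ GE φ (chi lam m) := by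
  rw [monomial_prod, chi, map_prod]
  have : ∀ s : Finset σ, ∏ i ∈ s, ψ ((X i : MvPolynomial σ ℂ) ^ m i) ∈ 
      GE φ (∏ i ∈ s, lam i ^ m i) := by
    intro s
    induction s using Finset.induction_on with
    | empty => simpa using GE_one φ
    | insert i s hi ih =>
      rw [Finset.prod_insert hi, Finset.prod_insert hi, map_pow]
      exact GE_mul φ (GE_pow φ (h i) _) ih
  exact this _

lemma supp_chi (φ ψ : MvPolynomial σ ℂ →ₐ[ℂ] MvPolynomial σ ℂ) {lam : σ → ℂ}
    (hi : Function.Injective ψ)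
    (h : ∀ i, ψ (X i) ∈ GE φ (lam i)) {p : MvPolynomial σ ℂ} {c : ℂ} (hp : ψ p ∈ GE φ c) :
    ∀ m ∈ p.support, chi lam m = c := by
  intro m0 hm0
  by_contra hne
  have hmon : ∀ m, ψ (monomial m (coeff m p)) ∈ GE φ (chi lam m) := by
    intro m
    have : monomial m (coeff m p) = coeff m p • monomial m (1 : ℂ) := by
      rw [smul_monomial, smul_eq_mul, mul_one]
    rw [this, map_smul]
    exact Submodule.smul_mem _ _ (GE_monomial' φ ψ h m)
  let q := ∑ m ∈ p.support with chi lam m = chi lam m0, monomial m (coeff m p)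
  let r := ∑ m ∈ p.support with ¬ chi lam m = chi lam m0, monomial m (coeff m p)
  have hqr : q + r = p := by
    rw [Finset.sum_filter_add_sum_filter_not]
    exact p.as_sum.symm
  have hq : ψ q ∈ GE φ (chi lam m0) := by
    rw [map_sum]
    refine Submodule.sum_mem _ fun m hm => ?_
    have := hmon m
    rwa [(Finset.mem_filter.mp hm).2] at this
  have hsup : ∀ l, l ≠ chi lam m0 → ∀ v ∈ GE φ l, v ∈ ⨆ j, ⨆ (_ : j ≠ chi lam m0), GE φ j := by
    intro l hl v hv
    exact Submodule.mem_iSup_of_mem l (Submodule.mem_iSup_of_mem hl hv)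
  have hq2 : ψ q ∈ ⨆ j, ⨆ (_ : j ≠ chi lam m0), GE φ j := by
    have : ψ q = ψ p - ψ r := by rw [← hqr, map_add]; ring
    rw [this]
    refine Submodule.sub_mem _ (hsup c (Ne.symm hne) _ hp) ?_
    rw [map_sum]
    refine Submodule.sum_mem _ fun m hm => ?_
    exact hsup _ (Finset.mem_filter.mp hm).2 _ (hmon m)
  have hd := Module.End.independent_maxGenEigenspace φ.toLinearMap (chi lam m0)
  have h0 := Submodule.disjoint_def.mp hd _ hq hq2
  have hq0 : q = 0 := hi (by rw [h0, map_zero])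
  have : coeff m0 q = coeff m0 p := by
    simp only [q, coeff_sum, coeff_monomial]
    rw [Finset.sum_ite_eq']
    have hmm : m0 ∈ p.support.filter (fun m => chi lam m = chi lam m0) :=
      Finset.mem_filter.mpr (And.intro hm0 (Eq.refl (chi lam m0)))
    rw [if_pos hmm]
  rw [hq0, coeff_zero] at this
  exact mem_support_iff.mp hm0 this.symm

lemma lam_ne (φ : MvPolynomial σ ℂ →ₐ[ℂ] MvPolynomial σ ℂ) (hφ : Function.Injective φ)
    {l : ℂ} {v : MvPolynomial σ ℂ} (hv : v ∈ GE φ l) (hv0 : v ≠ 0) : l ≠ 0 := by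
  rintro rfl
  rw [Module.End.mem_maxGenEigenspace] at hv
  obtain ⟨k, hk⟩ := hv
  rw [zero_smul, sub_zero] at hk
  apply hv0
  rw [Module.End.coe_pow] at hk
  have := hφ.iterate k
  apply this
  refine Eq.trans hk ?_
  have : ∀ k : ℕ, (φ : MvPolynomial σ ℂ → MvPolynomial σ ℂ)^[k] 0 = 0 := by
    intro k
    induction k with
    | zero => rfl
    | succ k ih => rw [Function.iterate_succ_apply', ih, map_zero]
  exact (this k).symm

lemma graded_surj {a : σ → ℕ} (ha : ∀ i, 0 < a i) (ψ : MvPolynomial σ ℂ →ₐ[ℂ] MvPolynomial σ ℂ)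
    (hi : Function.Injective ψ) (hg : GrHom a ψ) {e : ℕ} {f : MvPolynomial σ ℂ}
    (hf : IsWeightedHomogeneous a f e) : ∃ h, IsWeightedHomogeneous a h e ∧ ψ h = f := by
  have := fd_hom ha e
  let P := weightedHomogeneousSubmodule ℂ a e
  have hP : ∀ x : MvPolynomial σ ℂ, x ∈ P → ψ.toLinearMap x ∈ P := fun x hx => hg e x hx
  have hinj : Function.Injective (ψ.toLinearMap.restrict hP) := by
    intro x y hxy
    exact Subtype.ext (hi (congrArg Subtype.val hxy))
  obtain ⟨h, hh⟩ := LinearMap.injective_iff_surjective.mp hinj ⟨f, hf⟩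
  exact ⟨h.1, h.2, congrArg Subtype.val hh⟩

/-- polynomials with coefficients in a subalgebra -/
def coeffSub (A : Subalgebra ℚ ℂ) : Subsemiring (MvPolynomial σ ℂ) where
  carrier := {p | ∀ m, coeff m p ∈ A}
  mul_mem' := by
    intro p q hp hq m
    rw [coeff_mul]
    exact A.sum_mem fun x _ => A.mul_mem (hp _) (hq _)
  one_mem' := by
    intro m
    rw [coeff_one]
    split_ifs
    · exact A.one_mem
    · exact A.zero_mem
  add_mem' := by
    intro p q hp hq m
    rw [coeff_add]
    exact A.add_mem (hp _) (hq _)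
  zero_mem' := by
    intro m
    rw [coeff_zero]
    exact A.zero_mem

lemma coeffSub_C {A : Subalgebra ℚ ℂ} {z : ℂ} (hz : z ∈ A) :
    (C z : MvPolynomial σ ℂ) ∈ coeffSub (σ := σ) A := by
  intro m
  rw [coeff_C]
  split_ifs
  · exact hz
  · exact A.zero_mem

lemma finrank_ge {a : σ → ℕ} (ha : ∀ i, 0 < a i) (φ ψ : MvPolynomial σ ℂ →ₐ[ℂ] MvPolynomial σ ℂ)
    {lam : σ → ℂ} (hi : Function.Injective ψ) (hg : GrHom a ψ)
    (h : ∀ i, ψ (X i) ∈ GE φ (lam i)) (e : ℕ) (l : ℂ) :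
    ((mons a ha e).filter (fun m => chi lam m = l)).card ≤ Module.finrank ℂ (EE a φ e l) := by
  have := fd_hom ha e
  have : FiniteDimensional ℂ (EE a φ e l) := Submodule.finiteDimensional_inf_left _ _
  let B := (mons a ha e).filter (fun m => chi lam m = l)
  let v : B → EE a φ e l := fun m => ⟨ψ (monomial m.1 1), by
    refine ⟨hg e _ (isWeightedHomogeneous_monomial a _ _ ?_), ?_⟩
    · exact mem_mons.mp (Finset.mem_filter.mp m.2).1
    · have := GE_monomial' φ ψ h m.1
      rwa [(Finset.mem_filter.mp m.2).2] at this⟩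
  have hv : LinearIndependent ℂ v := by
    apply LinearIndependent.of_comp (EE a φ e l).subtype
    have h1 := (basisMonomials σ ℂ).linearIndependent.map' ψ.toLinearMap
      (LinearMap.ker_eq_bot.mpr hi)
    have h2 := h1.comp (fun m : B => m.1) Subtype.val_injective
    have he : ((EE a φ e l).subtype ∘ v) = 
        (ψ.toLinearMap ∘ (basisMonomials σ ℂ)) ∘ fun m : B => m.1 := by
      funext m
      simp [v]
    rw [he]
    exact h2
  have := hv.fintype_card_le_finrank
  simpa using this

lemma count_main {a : σ → ℕ} (ha : ∀ i, 0 < a i) {d : ℕ} (hd : ∀ i, 5 * a i ≤ d)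
    {f : MvPolynomial σ ℂ} (hf : IsWeightedHomogeneous a f d) (hQ : QS f)
    (hind : AlgebraicIndependent ℚ (fun m : mons a ha d => coeff m.1 f))
    (φ : MvPolynomial σ ℂ →ₐ[ℂ] MvPolynomial σ ℂ) (hφi : Function.Injective φ)
    (hφ : GrHom a φ) {c : ℂ} (hfc : φ f = c • f) :
    ∃ lam : σ → ℂ, (∀ i, lam i ≠ 0) ∧ ∀ i p, IsWeightedHomogeneous a p (a i) → p ∈ GE φ (lam i) := by
  obtain ⟨ψ, lam, Z, h1, h2, h3, h4⟩ := exists_coord_s16 ha hφ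
  let ψ' : MvPolynomial σ ℂ →ₐ[ℂ] MvPolynomial σ ℂ := ψ
  have hψi : Function.Injective ψ' := ψ.injective
  have hψg : GrHom a ψ' := GrHom_of fun i => (h1 i).1
  have hGE : ∀ i, ψ' (X i) ∈ GE φ (lam i) := fun i => (h1 i).2
  have hl : ∀ i, lam i ≠ 0 := fun i => lam_ne φ hφi (hGE i) (by
    intro h0
    have := hψi (h0.trans (map_zero ψ').symm)
    exact X_ne_zero i this)
  obtain ⟨h, hhom, hh⟩ := graded_surj ha ψ' hψi hψg hf
  have hfGE : f ∈ GE φ c := by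
    apply GE_step
    rw [hfc, sub_self]; exact Submodule.zero_mem _
  have hsupp : ∀ m ∈ h.support, chi lam m = c := supp_chi φ ψ' hψi hGE (by rw [hh]; exact hfGE)
  have hQh : QS h := QS_pullback ha ψ (fun i => (h1 i).1) (by
    have : ψ h = f := hh
    rw [this]; exact hQ)
  obtain ⟨k, Q, hD, hDs⟩ := exists_QData ha hd hhom hQh
  have hc : ∀ i, lam i ^ k i * chi lam (Q i) = c := by
    intro i
    rw [← hsupp _ (hDs i), chi_add, chi_single]
  have hall : ∀ i q, Finsupp.weight a q = a i → chi lam q = lam i := by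
    intro i q hq
    by_contra hne
    have hlt := hD.card_lt hl hc hq hne
    let G1 : Finset ℂ := ((mons a ha d).filter (fun m => chi lam m = c)).image (fun m => coeff m h)
    let G2 : Finset ℂ := Finset.univ.biUnion fun i => 
      ((mons a ha (a i)) \ Z i).image (fun m => coeff m (ψ' (X i)))
    have hG2 : ∀ i, ((mons a ha (a i)) \ Z i).card ≤
        ((mons a ha (a i)).filter (fun m => ¬ chi lam m = lam i)).card := by
      intro i
      have e1 := Finset.card_sdiff_add_card_eq_card (h2 i)
      have e2 := Finset.card_filter_add_card_filter_not (s := mons a ha (a i)) 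
        (fun m => chi lam m = lam i)
      have e3 := (finrank_ge ha φ ψ' hψi hψg hGE (a i) (lam i)).trans (h3 i)
      omega
    have hcard : (G1 ∪ G2).card < (mons a ha d).card := by
      have e2 := Finset.card_filter_add_card_filter_not (s := mons a ha d) (fun m => chi lam m = c)
      have e3 : G1.card ≤ _ := Finset.card_image_le
      have e4 : G2.card ≤ ∑ i, ((mons a ha (a i)).filter (fun m => ¬ chi lam m = lam i)).card :=
        Finset.card_biUnion_le.trans (Finset.sum_le_sum fun i _ => 
          Finset.card_image_le.trans (hG2 i))
      have e5 := Finset.card_union_le G1 G2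
      have hlt' : ∑ i, ((mons a ha (a i)).filter (fun m => ¬ chi lam m = lam i)).card < 
        ((mons a ha d).filter (fun m => ¬ chi lam m = c)).card := hlt
      omega
    have hle := algIndep_card_le hind (G1 ∪ G2) (by
      intro m
      let A := Algebra.adjoin ℚ ((G1 ∪ G2 : Finset ℂ) : Set ℂ)
      have hA1 : ∀ m, coeff m h ∈ A := by
        intro m
        by_cases hm : m ∈ h.support
        · apply Algebra.subset_adjoin
          rw [Finset.mem_coe]
          apply Finset.mem_union_left
          apply Finset.mem_image.mpr
          exact ⟨m, Finset.mem_filter.mpr ⟨supp_mons ha hhom hm, hsupp m hm⟩, rfl⟩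
        · rw [notMem_support_iff.mp hm]; exact A.zero_mem
      have hA2 : ∀ i, ψ' (X i) ∈ coeffSub (σ := σ) A := by
        intro i m
        by_cases hm : m ∈ mons a ha (a i)
        · by_cases hz : m ∈ Z i
          · rcases h4 i m hz with h0 | h0
            · change coeff m (ψ (X i)) ∈ A
              rw [h0]; exact A.zero_mem
            · change coeff m (ψ (X i)) ∈ A
              rw [h0]; exact A.one_mem
          · apply Algebra.subset_adjoin
            rw [Finset.mem_coe]
            apply Finset.mem_union_right
            apply Finset.mem_biUnion.mpr
            exact ⟨i, Finset.mem_univ _, Finset.mem_image.mpr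
              ⟨m, Finset.mem_sdiff.mpr ⟨hm, hz⟩, rfl⟩⟩
        · have : coeff m (ψ' (X i)) = 0 := by
            apply IsWeightedHomogeneous.coeff_eq_zero (h1 i).1
            exact fun h => hm (mem_mons.mpr h)
          rw [this]; exact A.zero_mem
      have hA3 : ψ' h ∈ coeffSub (σ := σ) A := by
        rw [MvPolynomial.as_sum h, map_sum]
        refine Subsemiring.sum_mem _ fun m _ => ?_
        have e1 : monomial m (coeff m h) = C (coeff m h) * monomial m (1 : ℂ) := by
          rw [C_mul_monomial, mul_one]
        rw [e1, monomial_prod, map_mul, map_prod]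
        refine Subsemiring.mul_mem _ ?_ (Subsemiring.prod_mem _ fun i _ => ?_)
        · have : ψ' (C (coeff m h)) = C (coeff m h) := ψ'.commutes _
          rw [this]
          exact coeffSub_C (hA1 m)
        · rw [map_pow]
          exact Subsemiring.pow_mem _ (hA2 i) _
      rw [hh] at hA3
      exact hA3 m.1)
    rw [Fintype.card_coe] at hle
    omega
  refine ⟨lam, hl, fun i p hp => ?_⟩
  obtain ⟨p', hp', rfl⟩ := graded_surj ha ψ' hψi hψg hp
  rw [MvPolynomial.as_sum p', map_sum]
  refine Submodule.sum_mem _ fun m hm => ?_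
  have : monomial m (coeff m p') = coeff m p' • monomial m (1 : ℂ) := by
    rw [smul_monomial, smul_eq_mul, mul_one]
  rw [this, map_smul]
  refine Submodule.smul_mem _ _ ?_
  have h5 := GE_monomial' φ ψ' hGE m
  rwa [hall i m (hp' (mem_support_iff.mp hm))] at h5

end GG
end

noncomputable section

section HH
variable {σ : Type} [Fintype σ] [DecidableEq σ]

lemma exists_P {a : σ → ℕ} {φ : MvPolynomial σ ℂ →ₐ[ℂ] MvPolynomial σ ℂ} (hφ : GrHom a φ)
    {e : ℕ} {l : ℂ} (hl : l ≠ 0) {v : MvPolynomial σ ℂ} (hv : IsWeightedHomogeneous a v e)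
    (hGE : v ∈ GE φ l) : ∃ P : Polynomial (MvPolynomial σ ℂ),
      (∀ j, IsWeightedHomogeneous a (P.coeff j) e) ∧
      ∀ n : ℕ, (φ ^ n : MvPolynomial σ ℂ →ₐ[ℂ] MvPolynomial σ ℂ) v =
        l ^ n • P.eval (n : MvPolynomial σ ℂ) := by
  rw [Module.End.mem_maxGenEigenspace] at hGE
  obtain ⟨K, hK⟩ := hGE
  let N : Module.End ℂ (MvPolynomial σ ℂ) := l⁻¹ • φ.toLinearMap - 1
  have hNK : ∀ k, K ≤ k → (N ^ k) v = 0 := by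
    intro k hk
    have e1 : N = l⁻¹ • (φ.toLinearMap - l • (1 : Module.End ℂ (MvPolynomial σ ℂ))) := by
      rw [smul_sub, smul_smul, inv_mul_cancel₀ hl, one_smul]
    obtain ⟨j, rfl⟩ := Nat.exists_eq_add_of_le' hk
    rw [pow_add, Module.End.mul_apply]
    have : (N ^ K) v = 0 := by rw [e1, smul_pow, LinearMap.smul_apply, hK, smul_zero]
    rw [this, map_zero]
  have hNh : ∀ k, IsWeightedHomogeneous a ((N ^ k) v) e := by
    intro k
    induction k with
    | zero => simpa using hv
    | succ k ih =>
      rw [pow_succ', Module.End.mul_apply]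
      refine Submodule.sub_mem (weightedHomogeneousSubmodule ℂ a e)
        (Submodule.smul_mem _ _ (hφ e _ ih)) ih
  let P : Polynomial (MvPolynomial σ ℂ) := ∑ k ∈ Finset.range K,
    Polynomial.C (((k.factorial : ℂ)⁻¹) • (N ^ k) v) * descPochhammer (MvPolynomial σ ℂ) k
  refine ⟨P, ?_, ?_⟩
  · intro j
    rw [Polynomial.finset_sum_coeff]
    refine Submodule.sum_mem (weightedHomogeneousSubmodule ℂ a e) fun k _ => ?_
    rw [Polynomial.coeff_C_mul, ← descPochhammer_map (Int.castRingHom (MvPolynomial σ ℂ)),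
      Polynomial.coeff_map, mul_comm]
    have : (Int.castRingHom (MvPolynomial σ ℂ)) ((descPochhammer ℤ k).coeff j) *
      ((k.factorial : ℂ)⁻¹ • (N ^ k) v) = ((descPochhammer ℤ k).coeff j) •
      ((k.factorial : ℂ)⁻¹ • (N ^ k) v) := by
      rw [zsmul_eq_mul]; rfl
    rw [this]
    exact zsmul_mem (Submodule.smul_mem _ _ (hNh k)) _
  · intro n
    have e0 : φ.toLinearMap = l • (N + 1) := by
      simp only [N, sub_add_cancel, smul_smul, mul_inv_cancel₀ hl, one_smul]
    have e1 : (φ ^ n : MvPolynomial σ ℂ →ₐ[ℂ] MvPolynomial σ ℂ) v = (φ.toLinearMap ^ n) v := by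
      rw [Module.End.coe_pow, AlgHom.coe_pow]; rfl
    rw [e1, e0, smul_pow, LinearMap.smul_apply]
    congr 1
    rw [Commute.add_pow (Commute.one_right N), LinearMap.sum_apply, Polynomial.eval_finset_sum]
    have e2 : ∀ k, (N ^ k * 1 ^ (n - k) * ((n.choose k : ℕ) : Module.End ℂ (MvPolynomial σ ℂ))) v =
        (n.choose k : ℂ) • (N ^ k) v := by
      intro k
      rw [one_pow, mul_one, Module.End.mul_apply]
      have : ((n.choose k : ℕ) : Module.End ℂ (MvPolynomial σ ℂ)) v = (n.choose k : ℂ) • v := by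
        rw [Module.End.natCast_apply, Nat.cast_smul_eq_nsmul]
      rw [this, map_smul]
    have e3 : ∀ k, Polynomial.eval (n : MvPolynomial σ ℂ)
        (Polynomial.C (((k.factorial : ℂ)⁻¹) • (N ^ k) v) * descPochhammer (MvPolynomial σ ℂ) k) =
        (n.choose k : ℂ) • (N ^ k) v := by
      intro k
      rw [Polynomial.eval_mul, Polynomial.eval_C, descPochhammer_eval_eq_descFactorial,
        Nat.descFactorial_eq_factorial_mul_choose, mul_comm, ← nsmul_eq_mul,
        ← Nat.cast_smul_eq_nsmul ℂ, smul_smul]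
      congr 1
      have : (k.factorial : ℂ) ≠ 0 := by exact_mod_cast k.factorial_ne_zero
      push_cast
      field_simp
    simp only [e2, e3]
    have s1 : ∑ k ∈ Finset.range (n + 1), (n.choose k : ℂ) • (N ^ k) v =
        ∑ k ∈ Finset.range (n + 1 + K), (n.choose k : ℂ) • (N ^ k) v := by
      apply Finset.sum_subset
      · intro k hk; rw [Finset.mem_range] at *; omega
      · intro k _ hk
        rw [Finset.mem_range] at hk
        rw [Nat.choose_eq_zero_of_lt (by omega)]; simp
    have s2 : ∑ k ∈ Finset.range K, (n.choose k : ℂ) • (N ^ k) v =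
        ∑ k ∈ Finset.range (n + 1 + K), (n.choose k : ℂ) • (N ^ k) v := by
      apply Finset.sum_subset
      · intro k hk; rw [Finset.mem_range] at *; omega
      · intro k _ hk
        rw [Finset.mem_range] at hk
        rw [hNK k (by omega), smul_zero]
    rw [s1, s2]

lemma unip {a : σ → ℕ} {φ : MvPolynomial σ ℂ →ₐ[ℂ] MvPolynomial σ ℂ} (hφ : GrHom a φ)
    {lam : σ → ℂ} (hl : ∀ i, lam i ≠ 0) (hX : ∀ i, (X i : MvPolynomial σ ℂ) ∈ GE φ (lam i))
    {f : MvPolynomial σ ℂ} {c : ℂ} (hc : c ≠ 0) (hf : φ f = c • f)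
    (hder : ∀ p : σ → MvPolynomial σ ℂ, (∀ i, (p i).IsWeightedHomogeneous a (a i)) →
          ∑ l, p l * pderiv l f = 0 → ∀ i, p i = 0) : ∀ i, φ (X i) = lam i • X i := by
  have hchi : ∀ m ∈ f.support, chi lam m = c := 
    supp_chi φ (AlgHom.id ℂ _) Function.injective_id hX (by
      apply GE_step
      simp [hf])
  have hP := fun i => exists_P hφ (hl i) (isWeightedHomogeneous_X ℂ a i) (hX i)
  choose P hP1 hP2 using hP
  have hP0 : ∀ i, (P i).coeff 0 = X i := by
    intro i
    have := hP2 i 0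
    simp only [pow_zero, AlgHom.one_apply, one_smul, Nat.cast_zero] at this
    rw [this, Polynomial.coeff_zero_eq_eval_zero]
  let Φ : MvPolynomial σ ℂ →ₐ[ℂ] Polynomial (MvPolynomial σ ℂ) := aeval P
  have hev : ∀ (z : MvPolynomial σ ℂ) p, (Φ p).eval z = aeval (fun i => (P i).eval z) p := by
    intro z p
    induction p using MvPolynomial.induction_on with
    | C r =>
      simp only [Φ, aeval_C]
      rw [IsScalarTower.algebraMap_apply ℂ (MvPolynomial σ ℂ) (Polynomial (MvPolynomial σ ℂ))]
      simp
    | add p q hp hq => simp [hp, hq]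
    | mul_X p j hp => simp only [map_mul, Polynomial.eval_mul, hp]; simp [Φ]
  have hfix : ∀ n : ℕ, (Φ f).eval (n : MvPolynomial σ ℂ) = f := by
    intro n
    have e1 : (φ ^ n : MvPolynomial σ ℂ →ₐ[ℂ] MvPolynomial σ ℂ) f = c ^ n • f := by
      induction n with
      | zero => simp
      | succ n ih => rw [pow_succ', AlgHom.mul_apply, ih, map_smul, hf, smul_smul, pow_succ]
    have e2 : (φ ^ n : MvPolynomial σ ℂ →ₐ[ℂ] MvPolynomial σ ℂ) f = 
        c ^ n • aeval (fun i => (P i).eval (n : MvPolynomial σ ℂ)) f := by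
      conv_lhs => rw [MvPolynomial.as_sum f]
      conv_rhs => rw [MvPolynomial.as_sum f]
      rw [map_sum, map_sum, Finset.smul_sum]
      refine Finset.sum_congr rfl fun m hm => ?_
      have e3 : monomial m (coeff m f) = coeff m f • monomial m (1 : ℂ) := by
        rw [smul_monomial, smul_eq_mul, mul_one]
      rw [e3, monomial_prod, map_smul, map_smul, map_prod, map_prod, smul_comm]
      congr 1
      simp only [map_pow, hP2, aeval_X, smul_pow]
      rw [Finset.prod_smul, ← hchi m hm, chi, ← Finset.prod_pow]
      congr 1
      refine Finset.prod_congr rfl fun i _ => ?_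
      rw [← pow_mul, ← pow_mul, mul_comm]
    rw [hev]
    have := e2.symm.trans e1
    exact smul_right_injective _ (pow_ne_zero n hc) this
  have hconst : Φ f = Polynomial.C f := by
    apply Polynomial.eq_of_infinite_eval_eq
    refine Set.Infinite.mono ?_ (Set.infinite_range_of_injective 
      (Nat.cast_injective (R := MvPolynomial σ ℂ)))
    rintro _ ⟨n, rfl⟩
    simp [hfix n]
  have hD : ∑ i, Φ (pderiv i f) * Polynomial.derivative (P i) = 0 := by
    have h1 := chain_rule (Polynomial.derivative'.restrictScalars ℂ : 
      Derivation ℂ (Polynomial (MvPolynomial σ ℂ)) (Polynomial (MvPolynomial σ ℂ))) P f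
    have h2 : (Polynomial.derivative'.restrictScalars ℂ : 
      Derivation ℂ (Polynomial (MvPolynomial σ ℂ)) (Polynomial (MvPolynomial σ ℂ))) (aeval P f) = 0 := by
      change Polynomial.derivative (Φ f) = 0
      rw [hconst, Polynomial.derivative_C]
    rw [h2] at h1
    exact h1.symm
  have hzero : ∀ r, 1 ≤ r → ∀ i, (P i).coeff r = 0 := by
    intro r
    induction r using Nat.strong_induction_on with
    | _ r ih =>
    intro hr
    obtain ⟨s, rfl⟩ : ∃ s, r = s + 1 := ⟨r - 1, by omega⟩
    have h1 := congrArg (fun q => Polynomial.coeff q s) hD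
    simp only [Polynomial.finset_sum_coeff, Polynomial.coeff_zero] at h1
    have h2 : ∀ i, (Φ (pderiv i f) * Polynomial.derivative (P i)).coeff s =
        ((s + 1 : ℕ) • (P i).coeff (s + 1)) * pderiv i f := by
      intro i
      rw [Polynomial.coeff_mul, Finset.sum_eq_single (0, s)]
      · have : (Φ (pderiv i f)).coeff 0 = pderiv i f := by
          rw [Polynomial.coeff_zero_eq_eval_zero, hev]
          have : (fun i => (P i).eval (0 : MvPolynomial σ ℂ)) = X := by
            funext j
            rw [← Polynomial.coeff_zero_eq_eval_zero, hP0]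
          rw [this, aeval_X_left_apply]
        simp only [this, Polynomial.coeff_derivative, nsmul_eq_mul]
        push_cast
        ring
      · rintro ⟨x, y⟩ hxy hne
        rw [Finset.HasAntidiagonal.mem_antidiagonal] at hxy
        simp only at hxy
        have hy : y < s := by
          rcases Nat.eq_zero_or_pos x with h0 | h0
          · subst h0; exfalso; apply hne; simp at hxy; rw [hxy]
          · omega
        simp only [Polynomial.coeff_derivative]
        rw [ih (y + 1) (by omega) (by omega) i]
        simp
      · intro h; exact absurd (Finset.HasAntidiagonal.mem_antidiagonal.mpr (by simp)) h
    simp only [h2] at h1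
    have h3 := hder _ (fun i => by
      exact nsmul_mem (S := weightedHomogeneousSubmodule ℂ a (a i)) (hP1 i (s + 1)) (s + 1)) h1
    intro i
    have := h3 i
    rw [nsmul_eq_mul] at this
    exact (mul_eq_zero.mp this).resolve_left (by exact_mod_cast Nat.succ_ne_zero s)
  intro i
  have h1 : P i = Polynomial.C (X i) := by
    ext1 r
    rcases Nat.eq_zero_or_pos r with h0 | h0
    · subst h0; rw [hP0]; simp
    · rw [hzero r h0 i, Polynomial.coeff_C, if_neg (by omega)]
  have := hP2 i 1
  rw [h1] at this
  simpa using this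

lemma scalar_all {a : σ → ℕ} {φ : MvPolynomial σ ℂ →ₐ[ℂ] MvPolynomial σ ℂ}
    {lam : σ → ℂ} (hX : ∀ i p, IsWeightedHomogeneous a p (a i) → p ∈ GE φ (lam i))
    (h : ∀ i, φ (X i) = lam i • X i) : 
    ∀ i p, IsWeightedHomogeneous a p (a i) → φ p = lam i • p := by
  intro i p hp
  have hchi : ∀ m ∈ p.support, chi lam m = lam i := 
    supp_chi φ (AlgHom.id ℂ _) Function.injective_id 
      (fun j => hX j _ (isWeightedHomogeneous_X ℂ a j)) (hX i p hp)
  conv_lhs => rw [MvPolynomial.as_sum p]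
  conv_rhs => rw [MvPolynomial.as_sum p]
  rw [map_sum, Finset.smul_sum]
  refine Finset.sum_congr rfl fun m hm => ?_
  have e3 : monomial m (coeff m p) = coeff m p • monomial m (1 : ℂ) := by
    rw [smul_monomial, smul_eq_mul, mul_one]
  rw [e3, monomial_prod, map_smul, map_prod, smul_comm]
  congr 1
  simp only [map_pow, h, smul_pow]
  rw [Finset.prod_smul, ← hchi m hm, chi]

end HH
end

noncomputable section

section II
variable {σ : Type} [Fintype σ] [DecidableEq σ]

lemma countable_family {a : σ → ℕ} (ha : ∀ i, 0 < a i) (d : ℕ) :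
    ∃ T : ℕ → MvPolynomial (σ →₀ ℕ) ℂ,
      (∀ k, ∃ g : MvPolynomial σ ℂ, g.IsWeightedHomogeneous a d ∧
        eval (fun m => coeff m g) (T k) ≠ 0) ∧
      ∀ f : MvPolynomial σ ℂ, (∀ k, eval (fun m => coeff m f) (T k) ≠ 0) →
        AlgebraicIndependent ℚ (fun m : mons a ha d => coeff m.1 f) := by
  have : Countable (MvPolynomial (mons a ha d) ℚ) :=
    Cardinal.mk_le_aleph0_iff.mp (MvPolynomial.cardinalMk_le_max.trans
      (by simp [Cardinal.mk_le_aleph0_iff]))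
  have : Nonempty {p : MvPolynomial (mons a ha d) ℚ // p ≠ 0} := ⟨⟨1, one_ne_zero⟩⟩
  obtain ⟨s, hs⟩ := exists_surjective_nat {p : MvPolynomial (mons a ha d) ℚ // p ≠ 0}
  refine ⟨fun k => rename Subtype.val (map (algebraMap ℚ ℂ) (s k).1), fun k => ?_, fun f hf => ?_⟩
  · have h0 : map (algebraMap ℚ ℂ) (s k).1 ≠ 0 := by
      rw [Ne, map_eq_zero_iff _ (map_injective _ (algebraMap ℚ ℂ).injective)]
      exact (s k).2
    obtain ⟨x, hx⟩ : ∃ x, eval x (map (algebraMap ℚ ℂ) (s k).1) ≠ 0 := by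
      by_contra hcon
      push Not at hcon
      exact h0 (MvPolynomial.funext fun x => by rw [hcon x, map_zero])
    refine ⟨∑ m, monomial m.1 (x m), ?_, ?_⟩
    · refine Submodule.sum_mem (weightedHomogeneousSubmodule ℂ a d) fun m hm => ?_
      exact isWeightedHomogeneous_monomial a _ _ (mem_mons.mp m.2)
    · rw [eval_rename]
      convert hx using 3
      funext m
      simp only [Function.comp, coeff_sum, coeff_monomial]
      rw [Finset.sum_eq_single m]
      · simp
      · intro b _ hb
        rw [if_neg]
        exact fun h => hb (Subtype.ext h)
      · simp
  · rw [algebraicIndependent_iff]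
    intro p hp
    by_contra hp0
    obtain ⟨k, hk⟩ := hs ⟨p, hp0⟩
    apply hf k
    rw [eval_rename, hk, eval_map]
    exact hp

lemma QS_of_smooth {a : σ → ℕ} {d : ℕ} (hd : 0 < d) {g : MvPolynomial σ ℂ}
    (hg : g.IsWeightedHomogeneous a d)
    (h : ∀ x : σ → ℂ, x ≠ 0 → eval x g = 0 → ∃ i, eval x (pderiv i g) ≠ 0) : QS g := by
  intro x hx
  by_contra h0
  have h1 := congrArg (eval x) hg.sum_weight_X_mul_pderiv
  have h2 : eval x g = 0 := by
    simp only [map_sum, nsmul_eq_mul, map_mul, hx, mul_zero, Finset.sum_const_zero] at h1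
    have h3 := mul_eq_zero.mp h1.symm
    refine h3.resolve_left ?_
    rw [map_natCast]
    exact_mod_cast hd.ne'
  obtain ⟨i, hi⟩ := h x h0 h2
  exact hi (hx i)

lemma scalar_final {a : σ → ℕ} (ha : ∀ i, 0 < a i) {d : ℕ} (hd : ∀ i, 5 * a i ≤ d)
    {f : MvPolynomial σ ℂ} (hf : f.IsWeightedHomogeneous a d) (hQ : QS f)
    (hind : AlgebraicIndependent ℚ (fun m : mons a ha d => coeff m.1 f))
    (hder : ∀ p : σ → MvPolynomial σ ℂ, (∀ i, (p i).IsWeightedHomogeneous a (a i)) →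
          ∑ l, p l * pderiv l f = 0 → ∀ i, p i = 0)
    (φ : MvPolynomial σ ℂ →ₐ[ℂ] MvPolynomial σ ℂ) (hφi : Function.Injective φ) (hφ : GrHom a φ)
    {c : ℂ} (hc : c ≠ 0) (hfc : φ f = c • f) :
    ∃ lam : σ → ℂ, ∀ i p, IsWeightedHomogeneous a p (a i) → φ p = lam i • p := by
  obtain ⟨lam, hl, hX⟩ := count_main ha hd hf hQ hind φ hφi hφ hfc
  exact ⟨lam, scalar_all hX
    (unip hφ hl (fun i => hX i _ (isWeightedHomogeneous_X ℂ a i)) hc hfc hder)⟩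

end II
end

/-- Suppose `n ≥ 1`, `d ≥ 5·max aᵢ`, `ℙ(a)` is well-formed, and some
quasismooth weighted-homogeneous polynomial of degree `d` exists. Then there is a countable
family of proper Zariski-closed subsets of the space of degree-`d` weighted-homogeneous
polynomials (each cut out as the zero set of a polynomial function `T k` of the coefficients
that does not vanish identically on that space) such that every `f` of degree `d` avoiding
all of them is quasismooth and every graded automorphism multiplying `f` by a scalar lies
in the center of `Aut(S)`; in particular `Lin(X)` is abelian. -/
theorem very_general_automorphisms_central {n : ℕ} (hn : 1 ≤ n) (a : Fin (n + 2) → ℕ)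
    (ha : ∀ i, 0 < a i) (hwf : WellFormed a) (d : ℕ) (hd : 5 * Finset.univ.sup a ≤ d)
    (hex : ∃ g : MvPolynomial (Fin (n + 2)) ℂ,
      g ≠ 0 ∧ g.IsWeightedHomogeneous a d ∧ Quasismooth g) :
    ∃ T : ℕ → MvPolynomial ((Fin (n + 2)) →₀ ℕ) ℂ,
      (∀ k : ℕ, ∃ g : MvPolynomial (Fin (n + 2)) ℂ, g.IsWeightedHomogeneous a d ∧
        eval (fun m => coeff m g) (T k) ≠ 0) ∧
      ∀ f : MvPolynomial (Fin (n + 2)) ℂ, f.IsWeightedHomogeneous a d →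
        (∀ k : ℕ, eval (fun m => coeff m f) (T k) ≠ 0) →
        Quasismooth f ∧
        (∀ φ : MvPolynomial (Fin (n + 2)) ℂ ≃ₐ[ℂ] MvPolynomial (Fin (n + 2)) ℂ,
          IsGradedAut a φ → (∃ c : ℂˣ, φ f = (c : ℂ) • f) →
            ∀ ψ : MvPolynomial (Fin (n + 2)) ℂ ≃ₐ[ℂ] MvPolynomial (Fin (n + 2)) ℂ,
              IsGradedAut a ψ → φ * ψ = ψ * φ) ∧
        (∀ φ₁ ∈ linGroup a f, ∀ φ₂ ∈ linGroup a f, φ₁ * φ₂ = φ₂ * φ₁) := by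
  have hd5 : ∀ i, 5 * a i ≤ d := fun i =>
    (Nat.mul_le_mul_left 5 (Finset.le_sup (f := a) (Finset.mem_univ i))).trans hd
  have hd0 : 0 < d := by
    have h1 := hd5 0
    have h2 := ha 0
    omega
  obtain ⟨g, hg0, hg, hgq⟩ := hex
  have hgQ : QS g := QS_of_smooth hd0 hg hgq
  obtain ⟨T0, hT0, hT0'⟩ := QS_generic ha (fun i => by have := hd5 i; omega) hg hgQ
  obtain ⟨k, Q, hkQ, -⟩ := exists_QData ha hd5 hg hgQ
  obtain ⟨T1, hT1, hT1'⟩ := der_generic hkQ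
  obtain ⟨T2, hT2, hT2'⟩ := countable_family ha d
  refine ⟨fun k => match k with
    | 0 => T0
    | 1 => T1
    | k + 2 => T2 k, ?_, ?_⟩
  · intro k
    match k with
    | 0 => exact ⟨g, hg, hT0⟩
    | 1 => exact ⟨_, gz_hom hkQ, hT1⟩
    | k + 2 => exact hT2 k
  · intro f hf hfT
    have hQ : QS f := hT0' f hf (hfT 0)
    have hder := hT1' f hf (hfT 1)
    have hind := hT2' f (fun k => hfT (k + 2))
    have hcent : ∀ φ : MvPolynomial (Fin (n + 2)) ℂ ≃ₐ[ℂ] MvPolynomial (Fin (n + 2)) ℂ,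
          IsGradedAut a φ → (∃ c : ℂˣ, φ f = (c : ℂ) • f) →
            ∀ ψ : MvPolynomial (Fin (n + 2)) ℂ ≃ₐ[ℂ] MvPolynomial (Fin (n + 2)) ℂ,
              IsGradedAut a ψ → φ * ψ = ψ * φ := by
      rintro φ hφ ⟨c, hc⟩ ψ hψ
      obtain ⟨lam, hlam⟩ := scalar_final ha hd5 hf hQ hind hder (φ : _ →ₐ[ℂ] _) φ.injective
        (fun e p hp => (hφ e p).mp hp) c.ne_zero hc
      have hlam' : ∀ i p, IsWeightedHomogeneous a p (a i) → φ p = lam i • p := hlam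
      have hcomp : ((φ * ψ : MvPolynomial (Fin (n + 2)) ℂ ≃ₐ[ℂ] MvPolynomial (Fin (n + 2)) ℂ) :
          MvPolynomial (Fin (n + 2)) ℂ →ₐ[ℂ] MvPolynomial (Fin (n + 2)) ℂ) =
          ((ψ * φ : MvPolynomial (Fin (n + 2)) ℂ ≃ₐ[ℂ] MvPolynomial (Fin (n + 2)) ℂ) :
          MvPolynomial (Fin (n + 2)) ℂ →ₐ[ℂ] MvPolynomial (Fin (n + 2)) ℂ) := by
        apply MvPolynomial.algHom_ext
        intro i
        change φ (ψ (X i)) = ψ (φ (X i))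
        have hXi := isWeightedHomogeneous_X ℂ a i
        rw [hlam' i _ hXi, hlam' i _ ((hψ _ _).mp hXi), map_smul]
      apply AlgEquiv.ext
      intro p
      exact congrArg (fun F => F p) hcomp
    refine ⟨?_, hcent, ?_⟩
    · intro x hx _
      by_contra hcon
      push Not at hcon
      exact hx (hQ x hcon)
    · rintro φ₁ ⟨h1, h1c⟩ φ₂ ⟨h2, -⟩
      exact hcent φ₁ h1 h1c φ₂ h2

end
end
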